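/- There exists a unique solution u ∈ C^{2,α}(ℝ) of the layer problem: I_s u = W'(u) on ℝ, u' > 0 on ℝ, u(x) → 0 as x → −∞, u(x) → 1 as x → +∞, and u(0) = 1/2. Moreover there exist constants C, c > 0 and κ > 2s (depending only on s) such that |u(x) − H(x) + x/(2s W''(0) |x|^{2s+1})| ≤ C|x|^{−κ} for |x| ≥ 1, where H is the Heaviside function, and c|x|^{−(1+2s)} ≤ u'(x) ≤ C|x|^{−(1+2s)} for |x| ≥ 1. -/

import Mathlib

open Real Filter Set MeasureTheory

noncomputable section

/-- The fractional Laplacian of order `2s` (principal-value form). -/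
def fracLap (s : ℝ) (φ : ℝ → ℝ) (x : ℝ) : ℝ :=
  (1/2) * ∫ y : ℝ, (φ (x + y) + φ (x - y) - 2 * φ x) / |y| ^ (1 + 2*s)

/-- Assumptions on the periodic potential `W`. -/
structure IsPotential (W : ℝ → ℝ) : Prop where
  contDiff : ContDiff ℝ 3 W
  holder3 : ∃ C r : NNReal, 0 < (r : ℝ) ∧ (r : ℝ) < 1 ∧ HolderWith C r (iteratedDeriv 3 W)
  periodic : ∀ v : ℝ, W (v + 1) = W v
  zero_int : ∀ n : ℤ, W (n : ℝ) = 0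
  pos_nonint : ∀ v : ℝ, (∀ n : ℤ, v ≠ (n : ℝ)) → 0 < W v
  second_deriv_pos : 0 < deriv (deriv W) 0

/-- The basic layer solution `u`. -/
structure IsLayer (s : ℝ) (W u : ℝ → ℝ) : Prop where
  diff : Differentiable ℝ u
  eqn : ∀ x, fracLap s u x = deriv W (u x)
  deriv_pos : ∀ x, 0 < deriv u x
  lim_bot : Tendsto u atBot (nhds 0)
  lim_top : Tendsto u atTop (nhds 1)
  half : u 0 = 1/2

/-- Assumptions on the external stress `σ`. -/
structure SigmaOK (s : ℝ) (σ : ℝ → ℝ → ℝ) : Prop where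
  bounded : ∃ B : ℝ, ∀ t x : ℝ, 0 ≤ t → |σ t x| ≤ B
  ucont : UniformContinuousOn (fun p : ℝ × ℝ => σ p.1 p.2) (Ici 0 ×ˢ univ)
  deriv_bound : ∃ M : ℝ, 0 < M ∧ ∃ α : ℝ, s < α ∧ α < 1 ∧
    (∀ t x : ℝ, 0 ≤ t →
      |deriv (fun ξ => σ t ξ) x| + |deriv (fun τ => σ τ x) t| ≤ M) ∧
    (∀ t x h : ℝ, 0 ≤ t →
      |deriv (fun ξ => σ t ξ) (x + h) - deriv (fun ξ => σ t ξ) x| ≤ M * |h| ^ α)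

/-- `v` is a bounded pointwise solution of `ε ∂_t v = I_s v − ε^{−2s} W'(v) + σ`
with initial datum `v0`. -/
def SolvesPDE (s ε : ℝ) (W : ℝ → ℝ) (σ : ℝ → ℝ → ℝ) (v0 : ℝ → ℝ) (v : ℝ → ℝ → ℝ) : Prop :=
  (∃ B : ℝ, ∀ t x : ℝ, |v t x| ≤ B) ∧
  (∀ x : ℝ, v 0 x = v0 x) ∧
  (∀ t : ℝ, 0 < t → ∀ x : ℝ,
    HasDerivAt (fun τ => v τ x)
      ((1/ε) * (fracLap s (v t) x - (1/ε ^ (2*s)) * deriv W (v t x) + σ t x)) t)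

/-- The `δ`-perturbed two-particle system with collision time `Tc`
(the case `δ = 0` is the unperturbed one). -/
def TwoPartPert (s γ δ : ℝ) (σ : ℝ → ℝ → ℝ) (x10 x20 Tc : ℝ) (x1 x2 : ℝ → ℝ) : Prop :=
  x1 0 = x10 - δ ∧ x2 0 = x20 + δ ∧
  ContinuousOn x1 (Ico 0 Tc) ∧ ContinuousOn x2 (Ico 0 Tc) ∧
  (∀ t ∈ Ioo (0:ℝ) Tc,
    HasDerivAt x1 (γ * (1/(2*s*(x2 t - x1 t) ^ (2*s)) - σ t (x1 t) - δ)) t ∧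
    HasDerivAt x2 (γ * (-(1/(2*s*(x2 t - x1 t) ^ (2*s))) + σ t (x2 t) + δ)) t) ∧
  (∀ t ∈ Ico (0:ℝ) Tc, x1 t < x2 t) ∧
  Tendsto (fun t => x2 t - x1 t) (nhdsWithin Tc (Iio Tc)) (nhds 0)

/-- Orientations of the three transition layers. -/
def zeta : Fin 3 → ℝ := ![1, -1, 1]

/-- The `δ`-perturbed three-particle system with collision time `Tc`
(the case `δ = 0` is the unperturbed one). -/
def ThreePartPert (s γ δ : ℝ) (σ : ℝ → ℝ → ℝ) (X0 : Fin 3 → ℝ) (Tc : ℝ)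
    (X : Fin 3 → ℝ → ℝ) : Prop :=
  (∀ i, X i 0 = X0 i - zeta i * δ) ∧
  (∀ i, ContinuousOn (X i) (Ico 0 Tc)) ∧
  (∀ i, ∀ t ∈ Ioo (0:ℝ) Tc,
    HasDerivAt (X i)
      (γ * ((∑ j ∈ Finset.univ.erase i,
          zeta i * zeta j * (X i t - X j t) / (2*s*|X i t - X j t| ^ (1+2*s)))
        - zeta i * σ t (X i t) - zeta i * δ)) t) ∧
  (∀ t ∈ Ico (0:ℝ) Tc, X 0 t < X 1 t ∧ X 1 t < X 2 t) ∧
  Tendsto (fun t => min (X 1 t - X 0 t) (X 2 t - X 1 t)) (nhdsWithin Tc (Iio Tc)) (nhds 0)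

/-- The corrector equation, together with the decay at infinity. -/
def CorrectorEqn (s η : ℝ) (W u ψ : ℝ → ℝ) : Prop :=
  (∀ x, fracLap s ψ x - deriv (deriv W) (u x) * ψ x
      = deriv u x + η * (deriv (deriv W) (u x) - deriv (deriv W) 0)) ∧
  Tendsto ψ atBot (nhds 0) ∧ Tendsto ψ atTop (nhds 0)

/-- The layer problem (without regularity). -/
def LayerEqn (s : ℝ) (W u : ℝ → ℝ) : Prop :=
  (∀ x, fracLap s u x = deriv W (u x)) ∧ (∀ x, 0 < deriv u x) ∧
  Tendsto u atBot (nhds 0) ∧ Tendsto u atTop (nhds 1) ∧ u 0 = 1/2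

/-- Membership in `C^{2,α}(ℝ)` for some `α ∈ (0,1)`. -/
def C2Holder (u : ℝ → ℝ) : Prop :=
  ContDiff ℝ 2 u ∧ ∃ C r : NNReal, 0 < (r : ℝ) ∧ (r : ℝ) < 1 ∧ HolderWith C r (iteratedDeriv 2 u)

def heaviside (x : ℝ) : ℝ := if 0 < x then 1 else 0

/-- The barrier `v̄_ε` for the two-particle system, where the velocities `c̄ᵢ = ẋ̄ᵢ`
are expressed through the right-hand side of the ODE system. -/
def vbar2 (s γ ε δ β : ℝ) (u ψ : ℝ → ℝ) (σ : ℝ → ℝ → ℝ) (x1 x2 : ℝ → ℝ) (t x : ℝ) : ℝ :=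
  ε ^ (2*s) * (σ t x + δ) / β + u ((x - x1 t)/ε) + u ((x2 t - x)/ε) - 1
    - ε ^ (2*s) * (γ * (1/(2*s*(x2 t - x1 t) ^ (2*s)) - σ t (x1 t) - δ)) * ψ ((x - x1 t)/ε)
    + ε ^ (2*s) * (γ * (-(1/(2*s*(x2 t - x1 t) ^ (2*s))) + σ t (x2 t) + δ)) * ψ ((x2 t - x)/ε)

/-- The barrier `v̄_ε` for the three-particle system, where the velocities `c̄ᵢ = ẋ̄ᵢ`
are expressed through the right-hand side of the ODE system. -/
def vbar3 (s γ ε δ β : ℝ) (u ψ : ℝ → ℝ) (σ : ℝ → ℝ → ℝ) (X : Fin 3 → ℝ → ℝ) (t x : ℝ) : ℝ :=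
  ε ^ (2*s) * (σ t x + δ) / β + (∑ i, u (zeta i * (x - X i t)/ε)) - 1
    - ∑ i, zeta i * ε ^ (2*s)
        * (γ * ((∑ j ∈ Finset.univ.erase i,
            zeta i * zeta j * (X i t - X j t) / (2*s*|X i t - X j t| ^ (1+2*s)))
          - zeta i * σ t (X i t) - zeta i * δ))
        * ψ (zeta i * (x - X i t)/ε)

/-- The hat system for two particles, solved on `[0,T]` with prescribed initial data. -/
def HatSys2 (s γ δ : ℝ) (σ : ℝ → ℝ → ℝ) (a b T : ℝ) (x1 x2 : ℝ → ℝ) : Prop :=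
  x1 0 = a ∧ x2 0 = b ∧
  ContinuousOn x1 (Icc 0 T) ∧ ContinuousOn x2 (Icc 0 T) ∧
  (∀ t ∈ Ioo (0:ℝ) T,
    HasDerivAt x1 (γ * (1/(2*s*(x2 t - x1 t) ^ (2*s)) - σ t (x1 t) - δ)) t ∧
    HasDerivAt x2 (γ * (-(1/(2*s*(x2 t - x1 t) ^ (2*s))) + σ t (x2 t) + δ)) t) ∧
  (∀ t ∈ Icc (0:ℝ) T, x1 t < x2 t)

/-- The hat system for three particles, solved on `[0,T]` with prescribed initial data. -/
def HatSys3 (s γ δ : ℝ) (σ : ℝ → ℝ → ℝ) (a : Fin 3 → ℝ) (T : ℝ) (X : Fin 3 → ℝ → ℝ) : Prop :=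
  (∀ i, X i 0 = a i) ∧
  (∀ i, ContinuousOn (X i) (Icc 0 T)) ∧
  (∀ i, ∀ t ∈ Ioo (0:ℝ) T,
    HasDerivAt (X i)
      (γ * ((∑ j ∈ Finset.univ.erase i,
          zeta i * zeta j * (X i t - X j t) / (2*s*|X i t - X j t| ^ (1+2*s)))
        - zeta i * σ t (X i t) - zeta i * δ)) t) ∧
  (∀ t ∈ Icc (0:ℝ) T, X 0 t < X 1 t ∧ X 1 t < X 2 t)

/-- The supersolution barrier used after collision in the three-particle case. -/
def hsup (s ε μ K ρ y : ℝ) (u : ℝ → ℝ) (t x : ℝ) : ℝ :=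
  u ((x - (y + K * ρ * (Real.exp (-μ * t / ε ^ (2*s+1)) - 1)))/ε)
    + ρ * Real.exp (-μ * t / ε ^ (2*s+1))

end

open scoped Topology

noncomputable section

namespace FracLayer

/-- The singular kernel `|t|^{-(1+2s)}`. -/
def pk (s t : ℝ) : ℝ := 1 / |t| ^ (1 + 2 * s)

/-- The weight `min(t²,1) |t|^{-(1+2s)}`. -/
def mk (s t : ℝ) : ℝ := min (t ^ 2) 1 * pk s t

lemma pk_nonneg (s t : ℝ) : 0 ≤ pk s t := by unfold pk; positivity

lemma pk_pos (s : ℝ) {t : ℝ} (ht : t ≠ 0) : 0 < pk s t := by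
  have := abs_pos.2 ht
  unfold pk; positivity

lemma pk_neg (s t : ℝ) : pk s (-t) = pk s t := by simp [pk]

lemma pk_eq_rpow (s : ℝ) {t : ℝ} (ht : 0 < t) : pk s t = t ^ (-(1 + 2 * s)) := by
  rw [pk, abs_of_pos ht, rpow_neg ht.le, one_div]

lemma pk_anti {s : ℝ} (hs : 0 < s) {a b : ℝ} (ha : 0 < |a|) (hab : |a| ≤ |b|) :
    pk s b ≤ pk s a := by
  unfold pk
  have h : |a| ^ (1 + 2 * s) ≤ |b| ^ (1 + 2 * s) := rpow_le_rpow ha.le hab (by linarith)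
  have : 0 < |a| ^ (1 + 2 * s) := by positivity
  exact one_div_le_one_div_of_le this h

lemma measurable_pk (s : ℝ) : Measurable (pk s) := by
  unfold pk
  fun_prop

lemma mk_nonneg (s t : ℝ) : 0 ≤ mk s t :=
  mul_nonneg (le_min (sq_nonneg _) zero_le_one) (pk_nonneg _ _)

/-- An even function integrable on `(0,∞)` is integrable. -/
lemma integrable_of_even {f : ℝ → ℝ} (hf : ∀ t, f (-t) = f t) (h : IntegrableOn f (Ioi 0)) :
    Integrable f := by
  have h1 : IntegrableOn f (Iio 0) := by
    have h0 : IntegrableOn f (Ioi (-0)) := by simpa using h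
    have := IntegrableOn.comp_neg_Iio h0
    simpa only [hf] using this
  have h2 : IntegrableOn f (Iic 0) := h1.congr_set_ae Iio_ae_eq_Iic.symm
  rw [← integrableOn_univ, ← Iic_union_Ioi (a := (0:ℝ))]
  exact h2.union h

lemma integrable_mk {s : ℝ} (hs : s ∈ Ioo (0:ℝ) 1) : Integrable (mk s) := by
  apply integrable_of_even
  · intro t; simp [mk, pk_neg]
  rw [← Ioc_union_Ioi_eq_Ioi (zero_le_one' ℝ)]
  refine IntegrableOn.union ?_ ?_
  · have h : IntegrableOn (fun t : ℝ => t ^ (1 - 2 * s)) (Ioc 0 1) := by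
      have := intervalIntegral.intervalIntegrable_rpow' (a := 0) (b := 1) (r := 1 - 2 * s)
        (by linarith [hs.2])
      rwa [intervalIntegrable_iff_integrableOn_Ioc_of_le zero_le_one] at this
    refine h.congr_fun (fun t ht => ?_) measurableSet_Ioc
    have ht0 := ht.1
    have h1 : min (t ^ 2) 1 = t ^ 2 := min_eq_left (by nlinarith [ht.1, ht.2])
    simp only [mk, h1, pk_eq_rpow s ht0]
    rw [← rpow_natCast t 2, ← rpow_add ht0]
    congr 1; push_cast; ring
  · have h := integrableOn_Ioi_rpow_of_lt (a := -(1 + 2 * s)) (c := 1) (by linarith [hs.1]) one_pos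
    refine h.congr_fun (fun t ht => ?_) measurableSet_Ioi
    have ht1 : 1 < t := ht
    have h1 : min (t ^ 2) 1 = 1 := min_eq_right (by nlinarith)
    simp only [mk, h1, pk_eq_rpow s (by linarith : 0 < t), one_mul]

/-- Smooth, even, compactly supported kernels dominated by the singular kernel. -/
structure Ker (s : ℝ) (J : ℝ → ℝ) : Prop where
  smooth : ContDiff ℝ 2 J
  supp : HasCompactSupport J
  nonneg : ∀ t, 0 ≤ J t
  even : ∀ t, J (-t) = J t
  le : ∀ t, t ≠ 0 → J t ≤ pk s t

/-- Smooth approximations of the singular kernel. -/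
lemma exists_kernels {s : ℝ} (hs : s ∈ Ioo (0:ℝ) 1) :
    ∃ J : ℕ → ℝ → ℝ, (∀ n, Ker s (J n)) ∧
      (∀ t, t ≠ 0 → Tendsto (fun n => J n t) atTop (𝓝 (pk s t))) ∧
      (∀ X > 0, ∀ᶠ n in atTop, ∀ t, |t| ≤ X → pk s X / 2 ≤ J n t) := by
  let χ : ContDiffBump (0:ℝ) := ⟨1, 2, one_pos, one_lt_two⟩
  let e : ℕ → ℝ := fun n => 1 / ((n:ℝ) + 1)
  have he : ∀ n, 0 < e n := fun n => by positivity
  have he0 : Tendsto e atTop (𝓝 0) := tendsto_one_div_add_atTop_nhds_zero_nat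
  let q : ℝ := (1 + 2 * s) / 2
  have hq : 0 < q := by have := hs.1; positivity
  let B : ℝ → ℝ → ℝ := fun a t => (t ^ 2 + a ^ 2) ^ (-q)
  have hpkB : ∀ t, t ≠ 0 → pk s t = (t ^ 2) ^ (-q) := by
    intro t ht
    have h0 : 0 < |t| := abs_pos.2 ht
    rw [pk, ← sq_abs, ← rpow_natCast |t| 2, ← rpow_mul h0.le, one_div, ← rpow_neg h0.le]
    congr 1; simp only [q]; push_cast; ring
  have hev : ∀ X > 0, ∀ᶠ n in atTop, e n * X ≤ 1 := by
    intro X hX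
    have : Tendsto (fun n => e n * X) atTop (𝓝 (0 * X)) := he0.mul_const X
    rw [zero_mul] at this
    exact (this.eventually (gt_mem_nhds one_pos)).mono fun n h => h.le
  have hχ1 : ∀ n t X, |t| ≤ X → e n * X ≤ 1 → χ (e n * t) = 1 := by
    intro n t X ht h
    apply χ.one_of_mem_closedBall
    simp only [χ, Metric.mem_closedBall, dist_zero_right, norm_mul, Real.norm_eq_abs,
      abs_of_pos (he n)]
    nlinarith [he n]
  have hBt : ∀ t, t ≠ 0 → Tendsto (fun n => B (e n) t) atTop (𝓝 (pk s t)) := by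
    intro t ht
    rw [hpkB t ht]
    have h2 : Tendsto (fun n => t ^ 2 + e n ^ 2) atTop (𝓝 (t ^ 2)) := by
      simpa using (he0.pow 2).const_add (t ^ 2)
    exact h2.rpow_const (Or.inl (by positivity))
  refine ⟨fun n t => B (e n) t * χ (e n * t), fun n => ?_, fun t ht => ?_, fun X hX => ?_⟩
  · have hp : ∀ t : ℝ, 0 < t ^ 2 + e n ^ 2 := fun t => by have := he n; positivity
    refine ⟨?_, ?_, fun t => ?_, fun t => ?_, fun t ht => ?_⟩
    · have h1 : ContDiff ℝ 2 (fun t : ℝ => t ^ 2 + e n ^ 2) := by fun_prop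
      have h2 : ContDiff ℝ 2 (B (e n)) := by
        apply h1.rpow_const_of_ne
        intro t; exact (hp t).ne'
      have h3 : ContDiff ℝ 2 (fun t : ℝ => χ (e n * t)) := by
        have : ContDiff ℝ 2 χ := χ.contDiff
        exact this.comp (contDiff_const.mul contDiff_id)
      exact h2.mul h3
    · apply HasCompactSupport.mul_left
      have h := χ.hasCompactSupport
      exact h.comp_homeomorph (Homeomorph.mulLeft₀ (e n) (he n).ne')
    · exact mul_nonneg (rpow_nonneg (hp t).le _) χ.nonneg
    · have : χ (e n * (-t)) = χ (e n * t) := by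
        rw [mul_neg]; exact χ.neg _
      simp only [B, this, neg_sq]
    · have h1 : B (e n) t ≤ pk s t := by
        rw [hpkB t ht]
        exact rpow_le_rpow_of_nonpos (by positivity) (by nlinarith [sq_nonneg (e n)]) (by linarith)
      calc B (e n) t * χ (e n * t) ≤ B (e n) t * 1 :=
            mul_le_mul_of_nonneg_left χ.le_one (rpow_nonneg (hp t).le _)
        _ ≤ pk s t := by rwa [mul_one]
  · have h1 : ∀ᶠ n in atTop, B (e n) t = B (e n) t * χ (e n * t) := by
      filter_upwards [hev |t| (abs_pos.2 ht)] with n hn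
      rw [hχ1 n t _ le_rfl hn, mul_one]
    exact (hBt t ht).congr' h1
  · have hpos := pk_pos s hX.ne'
    have h2 := (hBt X hX.ne').eventually (lt_mem_nhds (half_lt_self hpos))
    filter_upwards [hev X hX, h2] with n h1 h2 t ht
    rw [hχ1 n t X ht h1, mul_one]
    refine h2.le.trans ?_
    have := he n
    refine rpow_le_rpow_of_nonpos (by positivity) ?_ (by linarith)
    have := sq_le_sq' (by linarith [neg_abs_le t]) ((le_abs_self t).trans ht)
    linarith

lemma lip_of_hasDerivAt {f f' : ℝ → ℝ} {K : ℝ} (hf : ∀ x, HasDerivAt f (f' x) x)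
    (hb : ∀ x, |f' x| ≤ K) (x y : ℝ) : |f x - f y| ≤ K * |x - y| := by
  have := convex_univ.norm_image_sub_le_of_norm_hasDerivWithin_le (f := f) (f' := f') (C := K)
    (fun x _ => (hf x).hasDerivWithinAt) (fun x _ => by simpa using hb x) (mem_univ y) (mem_univ x)
  simpa using this

lemma taylor_one {f f' : ℝ → ℝ} {K : ℝ} (hf : ∀ x, HasDerivAt f (f' x) x)
    (hl : ∀ x y, |f' x - f' y| ≤ K * |x - y|) (a b : ℝ) :
    |f b - f a - f' a * (b - a)| ≤ K * (b - a) ^ 2 := by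
  have hK : 0 ≤ K := by
    have := (abs_nonneg _).trans (hl 1 0)
    simpa using this
  have h1 : ∀ x, HasDerivAt (fun x => f x - f' a * x) (f' x - f' a) x := fun x => by
    simpa using (hf x).fun_sub ((hasDerivAt_id' x).const_mul (f' a))
  have h2 := (convex_uIcc a b).norm_image_sub_le_of_norm_hasDerivWithin_le
    (f := fun x => f x - f' a * x) (f' := fun x => f' x - f' a) (C := K * |b - a|)
    (fun x _ => (h1 x).hasDerivWithinAt) (fun x hx => by
      refine (hl x a).trans (mul_le_mul_of_nonneg_left ?_ hK)
      exact abs_sub_left_of_mem_uIcc hx) left_mem_uIcc right_mem_uIcc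
  have h3 : f b - f a - f' a * (b - a) = f b - f' a * b - (f a - f' a * a) := by ring
  rw [h3]
  refine h2.trans (le_of_eq ?_)
  rw [Real.norm_eq_abs, mul_assoc, abs_mul_abs_self, sq]

/-- A `C^{3,r}` double-well potential with wells at `0` and `1`, together with its derivatives. -/
structure Pot (W W1 W2 W3 : ℝ → ℝ) (Λ r D : ℝ) : Prop where
  hd1 : ∀ v, HasDerivAt W (W1 v) v
  hd2 : ∀ v, HasDerivAt W1 (W2 v) v
  hd3 : ∀ v, HasDerivAt W2 (W3 v) v
  c3 : Continuous W3
  r_pos : 0 < r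
  r_lt : r < 1
  Λ_pos : 0 < Λ
  D_nonneg : 0 ≤ D
  b2 : ∀ v, |W2 v| ≤ Λ
  b3 : ∀ v, |W3 v| ≤ Λ
  hol : ∀ a b, |W3 a - W3 b| ≤ D * |a - b| ^ r
  nonneg : ∀ v, 0 ≤ W v
  zero : W 0 = 0
  one : W 1 = 0
  crit_zero : W1 0 = 0
  crit_one : W1 1 = 0
  pos : ∀ v ∈ Ioo (0:ℝ) 1, 0 < W v
  conv : 0 < W2 0
  conv_eq : W2 1 = W2 0

namespace Pot
variable {W W1 W2 W3 : ℝ → ℝ} {Λ r D : ℝ}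

lemma reflect (h : Pot W W1 W2 W3 Λ r D) :
    Pot (fun v => W (1 - v)) (fun v => -W1 (1 - v)) (fun v => W2 (1 - v)) (fun v => -W3 (1 - v))
      Λ r D where
  hd1 v := by
    simpa using (h.hd1 (1 - v)).comp_const_sub 1 v
  hd2 v := by
    simpa using ((h.hd2 (1 - v)).comp_const_sub 1 v).fun_neg
  hd3 v := by
    simpa using (h.hd3 (1 - v)).comp_const_sub 1 v
  c3 := by have := h.c3; fun_prop
  r_pos := h.r_pos
  r_lt := h.r_lt
  Λ_pos := h.Λ_pos
  D_nonneg := h.D_nonneg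
  b2 v := h.b2 _
  b3 v := by rw [abs_neg]; exact h.b3 _
  hol a b := by
    have := h.hol (1 - b) (1 - a)
    rwa [show -W3 (1 - a) - -W3 (1 - b) = W3 (1 - b) - W3 (1 - a) by ring,
      show a - b = 1 - b - (1 - a) by ring]
  nonneg v := h.nonneg _
  zero := by simpa using h.one
  one := by simpa using h.zero
  crit_zero := by simpa using h.crit_one
  crit_one := by simpa using h.crit_zero
  pos v hv := h.pos _ ⟨by linarith [hv.2], by linarith [hv.1]⟩
  conv := by simpa [h.conv_eq] using h.conv
  conv_eq := by simpa using h.conv_eq.symm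


lemma lip1 (h : Pot W W1 W2 W3 Λ r D)
    (a b : ℝ) : |W1 a - W1 b| ≤ Λ * |a - b| := lip_of_hasDerivAt h.hd2 h.b2 a b

lemma lip2 (h : Pot W W1 W2 W3 Λ r D)
    (a b : ℝ) : |W2 a - W2 b| ≤ Λ * |a - b| := lip_of_hasDerivAt h.hd3 h.b3 a b

lemma cont (h : Pot W W1 W2 W3 Λ r D) :
    Continuous W := continuous_iff_continuousAt.2 fun v => (h.hd1 v).continuousAt
lemma cont1 (h : Pot W W1 W2 W3 Λ r D) :
    Continuous W1 := continuous_iff_continuousAt.2 fun v => (h.hd2 v).continuousAt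

lemma taylor_le (h : Pot W W1 W2 W3 Λ r D)
    (a b : ℝ) : W b ≤ W a + W1 a * (b - a) + Λ * (b - a) ^ 2 := by
  have := (abs_le.1 (taylor_one h.hd1 h.lip1 a b)).2
  linarith

lemma taylor_W1 (h : Pot W W1 W2 W3 Λ r D)
    (a b : ℝ) : |W1 b - W1 a - W2 a * (b - a)| ≤ Λ * (b - a) ^ 2 :=
  taylor_one h.hd2 h.lip2 a b

lemma sq_W1_le (h : Pot W W1 W2 W3 Λ r D) (a : ℝ) : W1 a ^ 2 ≤ 4 * Λ * W a := by
  have hΛ := h.Λ_pos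
  have h1 := h.taylor_le a (a - W1 a / (2 * Λ))
  have h2 := h.nonneg (a - W1 a / (2 * Λ))
  have h3 : W a + W1 a * (a - W1 a / (2 * Λ) - a) + Λ * (a - W1 a / (2 * Λ) - a) ^ 2
      = W a - W1 a ^ 2 / (4 * Λ) := by field_simp; ring
  rw [h3] at h1
  have h4 : W1 a ^ 2 / (4 * Λ) ≤ W a := by linarith
  rw [div_le_iff₀ (by positivity)] at h4
  linarith

lemma exists_well (h : Pot W W1 W2 W3 Λ r D) : ∃ δ : ℝ, 0 < δ ∧ δ < 1 / 2 ∧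
    (∀ v, |v| ≤ δ → W2 0 / 2 ≤ W2 v) ∧ (∀ v, |v - 1| ≤ δ → W2 0 / 2 ≤ W2 v) := by
  have hc := h.conv
  have hΛ := h.Λ_pos
  have key : ∀ a v, W2 a = W2 0 → |v - a| ≤ W2 0 / (2 * Λ) → W2 0 / 2 ≤ W2 v := by
    intro a v ha hv
    have h1 := (abs_le.1 ((h.lip2 v a).trans (mul_le_mul_of_nonneg_left hv hΛ.le))).1
    have h2 : Λ * (W2 0 / (2 * Λ)) = W2 0 / 2 := by field_simp
    linarith
  refine ⟨min (1/4) (W2 0 / (2 * Λ)), by positivity, ?_, fun v hv => ?_, fun v hv => ?_⟩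
  · exact (min_le_left _ _).trans_lt (by norm_num)
  · exact key 0 v rfl (by simpa using hv.trans (min_le_right _ _))
  · exact key 1 v h.conv_eq (hv.trans (min_le_right _ _))

lemma exists_W_lower (h : Pot W W1 W2 W3 Λ r D) {δ : ℝ} (hδ : 0 < δ) :
    ∃ c > 0, ∀ v ∈ Icc δ (1 - δ), c ≤ W v := by
  by_cases hne : δ ≤ 1 - δ
  · obtain ⟨v, hv, hmin⟩ := isCompact_Icc.exists_isMinOn (nonempty_Icc.2 hne) h.cont.continuousOn
    exact ⟨W v, h.pos v ⟨by linarith [hv.1], by linarith [hv.2]⟩, fun w hw => hmin hw⟩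
  · exact ⟨1, one_pos, fun v hv => absurd (hv.1.trans hv.2) hne⟩

lemma exists_W_upper (h : Pot W W1 W2 W3 Λ r D) : ∃ B > 0, ∀ v ∈ Icc (0:ℝ) 1, W v ≤ B := by
  obtain ⟨v, hv, hmax⟩ := isCompact_Icc.exists_isMaxOn (nonempty_Icc.2 (zero_le_one' ℝ))
    h.cont.continuousOn
  exact ⟨W v + 1, by linarith [h.nonneg v], fun w hw => by linarith [show W w ≤ W v from hmax hw]⟩

end Pot

lemma periodic_bounded {f : ℝ → ℝ} (hf : Continuous f) (hp : Function.Periodic f 1) :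
    ∃ B, ∀ v, |f v| ≤ B := by
  obtain ⟨B, hB⟩ := isCompact_Icc.exists_bound_of_continuousOn (s := Icc (0:ℝ) 1) hf.continuousOn
  refine ⟨B, fun v => ?_⟩
  obtain ⟨y, hy, hvy⟩ := hp.exists_mem_Ico₀ one_pos v
  rw [hvy]
  exact hB y ⟨hy.1, hy.2.le⟩

lemma periodic_deriv {f : ℝ → ℝ} (hp : Function.Periodic f 1) : Function.Periodic (deriv f) 1 := by
  intro x
  have : (fun y => f (y + 1)) = f := funext hp
  rw [← deriv_comp_add_const, this]

lemma exists_pot {W : ℝ → ℝ} (hW : IsPotential W) :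
    ∃ Λ r D, Pot W (deriv W) (deriv (deriv W)) (deriv (deriv (deriv W))) Λ r D := by
  have h3 : iteratedDeriv 3 W = deriv (deriv (deriv W)) := by
    simp [iteratedDeriv_succ, iteratedDeriv_zero]
  have hc0 : ContDiff ℝ (2 + 1) W := by
    have := hW.contDiff; norm_num; exact this
  have hc1 : ContDiff ℝ (1 + 1) (deriv W) := by
    have := (contDiff_succ_iff_deriv.1 hc0).2.2; norm_num; exact this
  have hc2 : ContDiff ℝ (0 + 1) (deriv (deriv W)) := by
    have := (contDiff_succ_iff_deriv.1 hc1).2.2; norm_num; exact this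
  have hc3 : Continuous (deriv (deriv (deriv W))) := (contDiff_succ_iff_deriv.1 hc2).2.2.continuous
  have hp0 : Function.Periodic W 1 := hW.periodic
  have hp1 := periodic_deriv hp0
  have hp2 := periodic_deriv hp1
  have hp3 := periodic_deriv hp2
  obtain ⟨B2, hB2⟩ := periodic_bounded hc2.continuous hp2
  obtain ⟨B3, hB3⟩ := periodic_bounded hc3 hp3
  obtain ⟨D, r, hr0, hr1, hol⟩ := hW.holder3
  have hnn : ∀ v, 0 ≤ W v := by
    intro v
    by_cases hv : ∀ n : ℤ, v ≠ n
    · exact (hW.pos_nonint v hv).le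
    · push Not at hv
      obtain ⟨n, rfl⟩ := hv
      exact (hW.zero_int n).ge
  have hz : ∀ n : ℤ, deriv W n = 0 := by
    intro n
    apply IsLocalMin.deriv_eq_zero
    exact Eventually.of_forall fun v => by rw [hW.zero_int]; exact hnn v
  refine ⟨max 1 (max B2 B3), r, D, ?_⟩
  exact
  { hd1 := fun v => (hc0.differentiable (by norm_num) v).hasDerivAt
    hd2 := fun v => (hc1.differentiable (by norm_num) v).hasDerivAt
    hd3 := fun v => (hc2.differentiable (by norm_num) v).hasDerivAt
    c3 := hc3
    r_pos := hr0
    r_lt := hr1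
    Λ_pos := by positivity
    D_nonneg := D.2
    b2 := fun v => (hB2 v).trans (by simp)
    b3 := fun v => (hB3 v).trans (by simp)
    hol := fun a b => by
      have := hol.dist_le a b
      rw [h3] at this
      simpa [Real.dist_eq] using this
    nonneg := hnn
    zero := by simpa using hW.zero_int 0
    one := by simpa using hW.zero_int 1
    crit_zero := by simpa using hz 0
    crit_one := by simpa using hz 1
    pos := fun v hv => hW.pos_nonint v fun n hn => by
      rw [hn] at hv
      have h1 : (0:ℤ) < n := by exact_mod_cast hv.1
      have h2 : n < (1:ℤ) := by exact_mod_cast hv.2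
      omega
    conv := hW.second_deriv_pos
    conv_eq := by simpa using hp2 0 }

lemma exists_subseq_countable {f : ℕ → ℝ → ℝ} {B : ℝ} (hB : ∀ n x, |f n x| ≤ B) {S : Set ℝ}
    (hS : S.Countable) :
    ∃ φ : ℕ → ℕ, StrictMono φ ∧ ∀ x ∈ S, ∃ l, Tendsto (fun n => f (φ n) x) atTop (𝓝 l) := by
  have := hS.to_subtype
  let F : ℕ → S → Icc (-B) B := fun n x => ⟨f n x, abs_le.1 (hB n x)⟩
  obtain ⟨a, φ, hφ, hl⟩ := CompactSpace.tendsto_subseq F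
  refine ⟨φ, hφ, fun x hx => ⟨a ⟨x, hx⟩, ?_⟩⟩
  have := (tendsto_pi_nhds.1 hl) ⟨x, hx⟩
  exact (continuous_subtype_val.tendsto _).comp this

/-- A bounded sequence of functions converging at enough points around `x` converges at `x`. -/
lemma exists_tendsto_of_squeeze {f : ℕ → ℝ}
    (h : ∀ ε > 0, ∃ l, ∀ᶠ n in atTop, |f n - l| ≤ ε) : ∃ l, Tendsto f atTop (𝓝 l) := by
  apply cauchySeq_tendsto_of_complete
  rw [Metric.cauchySeq_iff']
  intro ε hε
  obtain ⟨l, hl⟩ := h (ε / 3) (by positivity)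
  obtain ⟨N, hN⟩ := eventually_atTop.1 hl
  refine ⟨N, fun n hn => ?_⟩
  have h1 := abs_le.1 (hN n hn)
  have h2 := abs_le.1 (hN N le_rfl)
  rw [Real.dist_eq, abs_lt]
  constructor <;> linarith [h1.1, h1.2, h2.1, h2.2]

/-- Helly's selection theorem. -/
lemma helly {f : ℕ → ℝ → ℝ} (hm : ∀ n, Monotone (f n)) (h01 : ∀ n x, f n x ∈ Icc (0:ℝ) 1) :
    ∃ φ : ℕ → ℕ, StrictMono φ ∧ ∃ g : ℝ → ℝ, Monotone g ∧
      ∀ x, Tendsto (fun n => f (φ n) x) atTop (𝓝 (g x)) := by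
  have hB : ∀ n x, |f n x| ≤ 1 := fun n x => abs_le.2 ⟨by linarith [(h01 n x).1], (h01 n x).2⟩
  obtain ⟨φ, hφ, hl⟩ := exists_subseq_countable hB (countable_range ((↑) : ℚ → ℝ))
  have hl' : ∀ q : ℚ, ∃ l, Tendsto (fun n => f (φ n) q) atTop (𝓝 l) := fun q => hl q ⟨q, rfl⟩
  choose L hL using hl'
  have hL01 : ∀ q, L q ∈ Icc (0:ℝ) 1 := fun q =>
    isClosed_Icc.mem_of_tendsto (hL q) (Eventually.of_forall fun n => h01 _ _)
  let S : ℝ → Set ℝ := fun x => L '' {q : ℚ | (q:ℝ) < x}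
  have hbd : ∀ x, BddAbove (S x) := fun x => ⟨1, by rintro _ ⟨q, _, rfl⟩; exact (hL01 q).2⟩
  have hne : ∀ x, (S x).Nonempty := fun x => by
    obtain ⟨q, hq⟩ := exists_rat_lt x
    exact ⟨L q, q, hq, rfl⟩
  let G : ℝ → ℝ := fun x => sSup (S x)
  have hG : Monotone G := fun x y hxy =>
    csSup_le_csSup (hbd y) (hne x) (image_mono fun q hq => lt_of_lt_of_le hq hxy)
  have hLm : ∀ q p : ℚ, (q:ℝ) ≤ p → L q ≤ L p := fun q p hqp =>
    le_of_tendsto_of_tendsto' (hL q) (hL p) fun n => hm _ hqp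
  have hcont : ∀ x, ContinuousAt G x → ∃ l, Tendsto (fun n => f (φ n) x) atTop (𝓝 l) := by
    intro x hx
    apply exists_tendsto_of_squeeze
    intro ε hε
    obtain ⟨δ, hδ, hd⟩ := Metric.continuousAt_iff.1 hx (ε / 4) (by positivity)
    obtain ⟨a, ha1, ha2⟩ := exists_rat_btwn (show x - δ / 2 < x - δ / 4 by linarith)
    obtain ⟨b, hb1, hb2⟩ := exists_rat_btwn (show x < x + δ / 2 by linarith)
    have e1 : dist (G (x - δ / 2)) (G x) < ε / 4 := hd (by
      rw [Real.dist_eq, abs_lt]; constructor <;> linarith)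
    have e2 : dist (G (x + δ / 2)) (G x) < ε / 4 := hd (by
      rw [Real.dist_eq, abs_lt]; constructor <;> linarith)
    rw [Real.dist_eq, abs_lt] at e1 e2
    have h1 : G (x - δ / 2) ≤ L a := csSup_le (hne _) (by
      rintro _ ⟨q, hq, rfl⟩
      exact hLm q a (le_of_lt (lt_trans hq ha1)))
    have h2 : L b ≤ G (x + δ / 2) := le_csSup (hbd _) ⟨b, hb2, rfl⟩
    have h3 : L a ≤ L b := hLm _ _ (by linarith)
    refine ⟨G x, ?_⟩
    filter_upwards [(hL a).eventually (lt_mem_nhds (show L a - ε / 4 < L a by linarith)),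
      (hL b).eventually (gt_mem_nhds (show L b < L b + ε / 4 by linarith))] with n h4 h5
    have h6 : f (φ n) a ≤ f (φ n) x := hm _ (by linarith)
    have h7 : f (φ n) x ≤ f (φ n) b := hm _ hb1.le
    rw [abs_le]
    constructor <;> linarith [e1.1, e1.2, e2.1, e2.2]
  obtain ⟨ψ, hψ, hl2⟩ := exists_subseq_countable (f := fun n => f (φ n)) (fun n x => hB _ x)
    hG.countable_not_continuousAt
  have hall : ∀ x, ∃ l, Tendsto (fun n => f (φ (ψ n)) x) atTop (𝓝 l) := by
    intro x
    by_cases hx : ContinuousAt G x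
    · obtain ⟨l, h⟩ := hcont x hx
      exact ⟨l, h.comp hψ.tendsto_atTop⟩
    · exact hl2 x hx
  choose g hg using hall
  exact ⟨φ ∘ ψ, hφ.comp hψ, g, fun x y hxy =>
    le_of_tendsto_of_tendsto' (hg x) (hg y) fun n => hm _ hxy, hg⟩

/-- A bounded, uniformly equicontinuous sequence has a pointwise convergent subsequence. -/
lemma exists_subseq_of_equicontinuous {f : ℕ → ℝ → ℝ} {B : ℝ} (hB : ∀ n x, |f n x| ≤ B)
    (he : ∀ ε > 0, ∃ δ > 0, ∀ n x y, |x - y| ≤ δ → |f n x - f n y| ≤ ε) :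
    ∃ φ : ℕ → ℕ, StrictMono φ ∧ ∃ g : ℝ → ℝ,
      ∀ x, Tendsto (fun n => f (φ n) x) atTop (𝓝 (g x)) := by
  obtain ⟨φ, hφ, hl⟩ := exists_subseq_countable hB (countable_range ((↑) : ℚ → ℝ))
  have hall : ∀ x, ∃ l, Tendsto (fun n => f (φ n) x) atTop (𝓝 l) := by
    intro x
    apply exists_tendsto_of_squeeze
    intro ε hε
    obtain ⟨δ, hδ, hd⟩ := he (ε / 2) (by positivity)
    obtain ⟨q, hq1, hq2⟩ := exists_rat_btwn (show x < x + δ by linarith)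
    obtain ⟨l, hlq⟩ := hl q ⟨q, rfl⟩
    refine ⟨l, ?_⟩
    filter_upwards [hlq.eventually (Metric.ball_mem_nhds l (half_pos hε))] with n hn
    have h1 := hd (φ n) x q (by rw [abs_le]; constructor <;> linarith)
    rw [Real.dist_eq] at hn
    calc |f (φ n) x - l| = |(f (φ n) x - f (φ n) q) + (f (φ n) q - l)| := by ring_nf
      _ ≤ _ := abs_add_le _ _
      _ ≤ ε := by linarith
  choose g hg using hall
  exact ⟨φ, hφ, g, hg⟩

/-- The nonlocal operator with kernel `J`. -/
def opL (J f : ℝ → ℝ) (x : ℝ) : ℝ := ∫ t, J t * (f (x + t) - f x)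

lemma opL_neg (J f : ℝ → ℝ) (x : ℝ) : opL J (fun y => -f y) x = -opL J f x := by
  unfold opL
  rw [← integral_neg]
  congr 1; ext t; ring

lemma opL_const_mul (J : ℝ → ℝ) (c : ℝ) (f : ℝ → ℝ) (x : ℝ) :
    opL J (fun y => c * f y) x = c * opL J f x := by
  unfold opL
  rw [← integral_const_mul]
  congr 1; ext t; ring

namespace Ker
variable {s : ℝ} {J : ℝ → ℝ}

lemma cont (hJ : Ker s J) : Continuous J := hJ.smooth.continuous

lemma integrable (hJ : Ker s J) : Integrable J := hJ.cont.integrable_of_hasCompactSupport hJ.supp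

lemma integrable_mul (hJ : Ker s J)
    {g : ℝ → ℝ} (hg : Continuous g) : Integrable (fun t => J t * g t) :=
  (hJ.cont.mul hg).integrable_of_hasCompactSupport hJ.supp.mul_right

lemma mass_nonneg (hJ : Ker s J) : 0 ≤ ∫ t, J t := integral_nonneg hJ.nonneg

lemma opL_eq_sub (hJ : Ker s J) {f : ℝ → ℝ} (hf : Continuous f) (x : ℝ) :
    opL J f x = (∫ t, J t * f (x + t)) - (∫ t, J t) * f x := by
  have h1 := hJ.integrable_mul (g := fun t => f (x + t)) (by fun_prop)
  rw [← integral_mul_const, ← integral_sub h1 (hJ.integrable.mul_const _)]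
  simp only [opL, mul_sub]

lemma integral_reflect (hJ : Ker s J) (f : ℝ → ℝ) (x : ℝ) :
    ∫ t, J t * f (x - t) = ∫ t, J t * f (x + t) := by
  rw [← integral_neg_eq_self]
  simp [hJ.even]

/-- Symmetric form of the operator. -/
lemma opL_symm (hJ : Ker s J) {f : ℝ → ℝ} (hf : Continuous f) (x : ℝ) :
    2 * opL J f x = ∫ t, J t * (f (x + t) + f (x - t) - 2 * f x) := by
  have h1 := hJ.integrable_mul (g := fun t => f (x + t)) (by fun_prop)
  have h2 := hJ.integrable_mul (g := fun t => f (x - t)) (by fun_prop)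
  have h3 := hJ.integrable.mul_const (2 * f x)
  have : ∀ t, J t * (f (x + t) + f (x - t) - 2 * f x)
      = J t * f (x + t) + J t * f (x - t) - J t * (2 * f x) := fun t => by ring
  simp only [this]
  rw [integral_sub (h1.fun_add h2) h3, integral_add h1 h2, integral_mul_const, hJ.integral_reflect,
    hJ.opL_eq_sub hf]
  ring

lemma opL_sub (hJ : Ker s J) {f g : ℝ → ℝ} (hf : Continuous f) (hg : Continuous g) (x : ℝ) :
    opL J (fun y => f y - g y) x = opL J f x - opL J g x := by
  unfold opL
  rw [← integral_sub (hJ.integrable_mul (g := fun t => f (x + t) - f x) (by fun_prop))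
    (hJ.integrable_mul (g := fun t => g (x + t) - g x) (by fun_prop))]
  congr 1; ext t; ring

/-- At a near-maximum point the operator is almost nonpositive. -/
lemma opL_le_of_near_max (hJ : Ker s J) {f : ℝ → ℝ} (hf : Continuous f) {x η : ℝ}
    (h : ∀ y, f y ≤ f x + η) : opL J f x ≤ (∫ t, J t) * η := by
  rw [← integral_mul_const]
  refine integral_mono (hJ.integrable_mul (g := fun t => f (x + t) - f x) (by fun_prop))
    (hJ.integrable.mul_const _) fun t => ?_
  exact mul_le_mul_of_nonneg_left (by linarith [h (x + t)]) (hJ.nonneg t)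

lemma sup_bound (hJ : Ker s J) {z : ℝ → ℝ} (hz : Continuous z) {N Λ β B k ρ : ℝ} (hN : ∀ x, z x ≤ N)
    (hβ : 0 ≤ β) (hk : 0 ≤ k) (hρ : 0 ≤ ρ) (hkρ : Λ + 1 ≤ 2 * k * ρ)
    (hJk : ∀ t, |t| ≤ ρ → k ≤ J t) (heq : ∀ x, -(Λ * |z x| + β) ≤ opL J z x)
    (hB : ∀ x, |∫ t in (-ρ)..ρ, z (x + t)| ≤ B) (x : ℝ) : z x ≤ k * B + β := by
  have hB0 : 0 ≤ B := (abs_nonneg _).trans (hB 0)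
  have hbdd : BddAbove (range z) := ⟨N, by rintro _ ⟨y, rfl⟩; exact hN y⟩
  have hM := hJ.mass_nonneg
  set M := ∫ t, J t with hMdef
  set Z := sSup (range z) with hZ
  have hle : ∀ y, z y ≤ Z := fun y => le_csSup hbdd ⟨y, rfl⟩
  refine (hle x).trans ?_
  by_contra! hlt
  have hpos : 0 ≤ k * B + β := by positivity
  set η := (Z - (k * B + β)) / (2 * (M + 1)) with hη
  have hηpos : 0 < η := div_pos (by linarith) (by positivity)
  have hη2 : 2 * (M + 1) * η = Z - (k * B + β) := by
    rw [hη]; field_simp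
  have hη3 : η ≤ (M + 1) * η := by nlinarith
  obtain ⟨_, ⟨y, rfl⟩, hy⟩ := exists_lt_of_lt_csSup (range_nonempty z)
    (show Z - η < sSup (range z) by linarith)
  have hzy : 0 < z y := by linarith
  have hneg : ∀ t, z (y + t) - z y - η ≤ 0 := fun t => by linarith [hle (y + t)]
  have hcont : Continuous fun t => z (y + t) - z y - η := by fun_prop
  have h1 : ∫ t, J t * (z (y + t) - z y - η) = opL J z y - M * η := by
    rw [hMdef, ← integral_mul_const, opL, ← integral_sub
      (hJ.integrable_mul (g := fun t => z (y + t) - z y) (by fun_prop)) (hJ.integrable.mul_const _)]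
    congr 1; ext t; ring
  have h2 : ∫ t, J t * (z (y + t) - z y - η)
      ≤ ∫ t in Ioc (-ρ) ρ, k * (z (y + t) - z y - η) := by
    rw [← integral_indicator measurableSet_Ioc]
    refine integral_mono (hJ.integrable_mul hcont) ?_ fun t => ?_
    · rw [integrable_indicator_iff measurableSet_Ioc]
      exact (hcont.const_mul k).integrableOn_Ioc
    · by_cases ht : t ∈ Ioc (-ρ) ρ
      · simp only [indicator_of_mem ht]
        exact mul_le_mul_of_nonpos_right (hJk t (abs_le.2 ⟨ht.1.le, ht.2⟩)) (hneg t)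
      · simp only [indicator_of_notMem ht]
        exact mul_nonpos_of_nonneg_of_nonpos (hJ.nonneg t) (hneg t)
  have h3 : ∫ t in Ioc (-ρ) ρ, k * (z (y + t) - z y - η)
      = k * (∫ t in (-ρ)..ρ, z (y + t)) - k * (2 * ρ * (z y + η)) := by
    rw [← intervalIntegral.integral_of_le (by linarith), intervalIntegral.integral_const_mul,
      ← mul_sub]
    have : ∀ t, z (y + t) - z y - η = z (y + t) - (z y + η) := fun t => by ring
    simp only [this]
    rw [intervalIntegral.integral_sub, intervalIntegral.integral_const]
    · rw [smul_eq_mul]; ring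
    · exact (by fun_prop : Continuous fun t => z (y + t)).intervalIntegrable _ _
    · simp
  have h4 := heq y
  rw [abs_of_pos hzy] at h4
  have h5 : k * (∫ t in (-ρ)..ρ, z (y + t)) ≤ k * B :=
    mul_le_mul_of_nonneg_left ((abs_le.1 (hB y)).2) hk
  have h6 : 0 ≤ k * ρ * η := by positivity
  nlinarith

/-- Maximum-principle bound for functions with controlled local averages. -/
lemma abs_bound (hJ : Ker s J)
    {z : ℝ → ℝ} (hz : Continuous z) {N Λ β B k ρ : ℝ} (hN : ∀ x, |z x| ≤ N)
    (hβ : 0 ≤ β) (hk : 0 ≤ k) (hρ : 0 ≤ ρ) (hkρ : Λ + 1 ≤ 2 * k * ρ)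
    (hJk : ∀ t, |t| ≤ ρ → k ≤ J t) (heq : ∀ x, |opL J z x| ≤ Λ * |z x| + β)
    (hB : ∀ x, |∫ t in (-ρ)..ρ, z (x + t)| ≤ B) (x : ℝ) : |z x| ≤ k * B + β := by
  rw [abs_le']
  refine ⟨hJ.sup_bound hz (fun x => (abs_le.1 (hN x)).2) hβ hk hρ hkρ hJk
    (fun x => (abs_le.1 (heq x)).1) hB x, ?_⟩
  refine hJ.sup_bound (z := fun x => -z x) hz.neg (N := N) (Λ := Λ)
    (fun x => by linarith [(abs_le.1 (hN x)).1]) hβ hk hρ hkρ hJk (fun x => ?_) (fun x => ?_) x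
  · rw [opL_neg, abs_neg]; linarith [(abs_le.1 (heq x)).2]
  · rw [intervalIntegral.integral_neg, abs_neg]; exact hB x

end Ker

/-- Second differences are controlled by a local bound on the second derivative. -/
lemma second_diff_le {f f' f'' : ℝ → ℝ} {K x t : ℝ}
    (h1 : ∀ y, |y - x| ≤ |t| → HasDerivAt f (f' y) y)
    (h2 : ∀ y, |y - x| ≤ |t| → HasDerivAt f' (f'' y) y)
    (hK : ∀ y, |y - x| ≤ |t| → |f'' y| ≤ K) :
    |f (x + t) + f (x - t) - 2 * f x| ≤ 2 * K * t ^ 2 := by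
  have hmem : ∀ y, y ∈ Icc (x - |t|) (x + |t|) → |y - x| ≤ |t| := fun y hy =>
    abs_le.2 ⟨by linarith [hy.1], by linarith [hy.2]⟩
  have hτ : ∀ τ ∈ uIcc 0 t, |τ| ≤ |t| := fun τ hτ => by
    have := abs_sub_left_of_mem_uIcc hτ
    simpa using this
  have hg : ∀ τ ∈ uIcc 0 t, HasDerivAt (fun τ => f (x + τ) + f (x - τ))
      (f' (x + τ) - f' (x - τ)) τ := fun τ hτ' => by
    have a1 := (h1 (x + τ) (by simpa using hτ τ hτ')).comp_const_add x τ
    have a2 := (h1 (x - τ) (by simpa using hτ τ hτ')).comp_const_sub x τ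
    exact (a1.fun_add a2).congr_deriv (by ring)
  have hg' : ∀ τ ∈ uIcc 0 t, |f' (x + τ) - f' (x - τ)| ≤ 2 * K * |t| := fun τ hτ' => by
    have hl := (convex_Icc (x - |t|) (x + |t|)).norm_image_sub_le_of_norm_hasDerivWithin_le
      (f := f') (f' := f'') (C := K) (fun y hy => (h2 y (hmem y hy)).hasDerivWithinAt)
      (fun y hy => hK y (hmem y hy)) (x := x - τ) (y := x + τ)
      (by have := abs_le.1 (hτ τ hτ'); constructor <;> linarith [this.1, this.2])
      (by have := abs_le.1 (hτ τ hτ'); constructor <;> linarith [this.1, this.2])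
    have hK0 : 0 ≤ K := (abs_nonneg _).trans (hK x (by simp))
    refine hl.trans ?_
    rw [Real.norm_eq_abs, show x + τ - (x - τ) = 2 * τ by ring, abs_mul, abs_two]
    nlinarith [hτ τ hτ']
  have := (convex_uIcc 0 t).norm_image_sub_le_of_norm_hasDerivWithin_le
    (fun τ hτ => (hg τ hτ).hasDerivWithinAt) hg' left_mem_uIcc right_mem_uIcc
  simp only [add_zero, sub_zero, Real.norm_eq_abs] at this
  rw [show 2 * f x = f x + f x by ring]
  refine this.trans (le_of_eq ?_)
  rw [mul_assoc, abs_mul_abs_self, sq]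

lemma rpow_second_diff {p : ℝ} (hp : 0 ≤ p) {x t : ℝ} (hx : 0 < x) (ht : |t| ≤ x / 2) :
    |(x + t) ^ (-p) + (x - t) ^ (-p) - 2 * x ^ (-p)|
      ≤ 2 * (p * (p + 1) * 2 ^ (p + 2) * x ^ (-p - 2)) * t ^ 2 := by
  have hy : ∀ y, |y - x| ≤ |t| → x / 2 ≤ y := fun y hy => by linarith [(abs_le.1 (hy.trans ht)).1]
  refine second_diff_le (f := fun y => y ^ (-p)) (f' := fun y => -p * y ^ (-p - 1))
    (f'' := fun y => -p * ((-p - 1) * y ^ (-p - 1 - 1))) (fun y h => ?_) (fun y h => ?_)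
    (fun y h => ?_)
  · exact hasDerivAt_rpow_const (Or.inl (by linarith [hy y h]))
  · exact (hasDerivAt_rpow_const (Or.inl (by linarith [hy y h]))).const_mul _
  · have h0 := hy y h
    have hy0 : 0 < y := by linarith
    have h1 : y ^ (-p - 1 - 1) ≤ (x / 2) ^ (-p - 2) := by
      rw [show -p - 1 - 1 = -p - 2 by ring]
      exact rpow_le_rpow_of_nonpos (by positivity) h0 (by linarith)
    have h2 : (x / 2) ^ (-p - 2) = 2 ^ (p + 2) * x ^ (-p - 2) := by
      rw [div_rpow hx.le zero_le_two, div_eq_mul_inv, ← rpow_neg zero_le_two, mul_comm]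
      congr 2; ring
    have h3 : 0 ≤ y ^ (-p - 1 - 1) := by positivity
    rw [show -p * ((-p - 1) * y ^ (-p - 1 - 1)) = p * (p + 1) * y ^ (-p - 1 - 1) by ring,
      abs_of_nonneg (by positivity), mul_assoc (p * (p + 1))]
    rw [h2] at h1
    exact mul_le_mul_of_nonneg_left h1 (by positivity)

/-- The decay barrier. -/
def bar (s R x : ℝ) : ℝ := (max |x| R) ^ (-(1 + 2 * s))

section bar
variable {s R : ℝ}

lemma bar_pos (hR : 0 < R) (x : ℝ) : 0 < bar s R x := by
  unfold bar; have : 0 < max |x| R := lt_max_of_lt_right hR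
  positivity

lemma continuous_bar (hR : 0 < R) : Continuous (bar s R) := by
  unfold bar
  refine Continuous.rpow_const (by fun_prop) fun x => Or.inl ?_
  exact (lt_max_of_lt_right hR).ne'

lemma bar_of_le {x : ℝ} (h : |x| ≤ R) : bar s R x = R ^ (-(1 + 2 * s)) := by
  rw [bar, max_eq_right h]

lemma bar_of_ge {x : ℝ} (h : R ≤ |x|) : bar s R x = |x| ^ (-(1 + 2 * s)) := by
  rw [bar, max_eq_left h]

lemma bar_neg (x : ℝ) : bar s R (-x) = bar s R x := by simp [bar]

lemma bar_le_const (hs : 0 < s) (hR : 0 < R) (x : ℝ) : bar s R x ≤ R ^ (-(1 + 2 * s)) :=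
  rpow_le_rpow_of_nonpos hR (le_max_right _ _) (by linarith)

lemma bar_le (hs : 0 < s) {x : ℝ} (hx : 0 < |x|) : bar s R x ≤ |x| ^ (-(1 + 2 * s)) :=
  rpow_le_rpow_of_nonpos hx (le_max_left _ _) (by linarith)

lemma integrable_bar (hs : 0 < s) (hR : 0 < R) : Integrable (bar s R) := by
  apply integrable_of_even bar_neg
  rw [← Ioc_union_Ioi_eq_Ioi hR.le]
  refine IntegrableOn.union (continuous_bar hR).integrableOn_Ioc ?_
  have h := integrableOn_Ioi_rpow_of_lt (a := -(1 + 2 * s)) (c := R) (by linarith) hR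
  refine h.congr_fun (fun t ht => ?_) measurableSet_Ioi
  have ht1 : R < t := ht
  rw [bar_of_ge (by rw [abs_of_pos (by linarith)]; exact ht1.le), abs_of_pos (by linarith)]

lemma bar_scale (hR : 0 < R) (x : ℝ) : bar s R x = R ^ (-(1 + 2 * s)) * bar s 1 (x / R) := by
  unfold bar
  rw [← mul_rpow hR.le (by positivity), mul_max_of_nonneg _ _ hR.le, abs_div, abs_of_pos hR,
    mul_div_cancel₀ _ hR.ne', mul_one]

lemma integral_bar (hR : 0 < R) :
    ∫ x, bar s R x = R ^ (-(2 * s)) * ∫ x, bar s 1 x := by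
  have : ∀ x, bar s R x = R ^ (-(1 + 2 * s)) * bar s 1 (x / R) := bar_scale hR
  simp only [this]
  rw [integral_const_mul, Measure.integral_comp_div, abs_of_pos hR, smul_eq_mul, ← mul_assoc]
  congr 1
  nth_rewrite 2 [← rpow_one R]
  rw [← rpow_add hR]; congr 1; ring

lemma pk_scale {x : ℝ} (hx : 0 < x) (t : ℝ) :
    pk s t = x ^ (-(1 + 2 * s)) * pk s (t / x) := by
  unfold pk
  rw [abs_div, abs_of_pos hx, div_rpow (abs_nonneg _) hx.le, rpow_neg hx.le]
  have : x ^ (1 + 2 * s) ≠ 0 := by positivity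
  field_simp

end bar

lemma exists_bar_supersolution {s : ℝ} (hs : s ∈ Ioo (0:ℝ) 1) :
    ∃ C0 : ℝ, 0 < C0 ∧ ∀ R > 0, ∀ J, Ker s J → ∀ x, R ≤ |x| →
      opL J (bar s R) x ≤ C0 * R ^ (-(2 * s)) * bar s R x := by
  have hs0 := hs.1
  set q := 1 + 2 * s with hq
  have hq0 : 0 < q := by positivity
  set Cq := 2 * (q * (q + 1) * 2 ^ (q + 2)) with hCq
  have hCq0 : 0 < Cq := by positivity
  have hI := integrable_mk hs
  have hI0 : 0 ≤ ∫ t, mk s t := integral_nonneg (mk_nonneg s)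
  have hΨ0 : 0 ≤ ∫ t, bar s 1 t := integral_nonneg fun t => (bar_pos one_pos t).le
  refine ⟨Cq * (∫ t, mk s t) + 2 ^ q * (2 * ∫ t, bar s 1 t) + 1, by positivity, ?_⟩
  intro R hR J hJ
  -- it is enough to treat positive points
  suffices key : ∀ x, R ≤ x → 2 * opL J (bar s R) x ≤
      (Cq * (∫ t, mk s t) + 2 ^ q * (2 * ∫ t, bar s 1 t)) * R ^ (-(2 * s)) * bar s R x by
    have key2 : ∀ x, R ≤ x → opL J (bar s R) x ≤
      (Cq * (∫ t, mk s t) + 2 ^ q * (2 * ∫ t, bar s 1 t) + 1) * R ^ (-(2 * s)) * bar s R x := by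
      intro x hx
      have h1 := key x hx
      have h2 : 0 < R ^ (-(2 * s)) * bar s R x := mul_pos (by positivity) (bar_pos hR x)
      have h3 : 0 ≤ (Cq * (∫ t, mk s t) + 2 ^ q * (2 * ∫ t, bar s 1 t)) *
        (R ^ (-(2 * s)) * bar s R x) := by positivity
      nlinarith
    intro x hx
    rcases le_total 0 x with h | h
    · rw [abs_of_nonneg h] at hx; exact key2 x hx
    · rw [abs_of_nonpos h] at hx
      have h1 : opL J (bar s R) x = opL J (bar s R) (-x) := by
        rw [hJ.opL_eq_sub (continuous_bar hR), hJ.opL_eq_sub (continuous_bar hR), bar_neg,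
          ← hJ.integral_reflect]
        congr 2; ext t
        rw [← bar_neg]; congr 2; ring
      rw [h1, ← bar_neg]; exact key2 _ hx
  intro x hRx
  have hx : 0 < x := hR.trans_le hRx
  have hbx : bar s R x = x ^ (-q) := by
    rw [bar_of_ge (by rwa [abs_of_pos hx]), abs_of_pos hx]
  rw [hJ.opL_symm (continuous_bar hR), hbx]
  have hIb := integrable_bar hs0 hR
  have hI1 : Integrable fun t => mk s (t / x) := hI.comp_div hx.ne'
  have hIp : Integrable fun t => bar s R (x + t) := hIb.comp_add_left x
  have hIm : Integrable fun t => bar s R (x - t) := hIb.comp_sub_left x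
  have hpt : ∀ t, J t * (bar s R (x + t) + bar s R (x - t) - 2 * x ^ (-q)) ≤
      Cq * x ^ (-q) * x ^ (-q) * mk s (t / x)
        + 2 ^ q * x ^ (-q) * (bar s R (x + t) + bar s R (x - t)) := by
    intro t
    have hp := bar_pos (s := s) hR (x + t)
    have hm := bar_pos (s := s) hR (x - t)
    have hmk := mk_nonneg s (t / x)
    rcases le_or_gt |t| (x / 2) with ht | ht
    · have h0 := abs_le.1 ht
      have h1 : bar s R (x + t) ≤ (x + t) ^ (-q) := by
        have := bar_le (R := R) hs0 (x := x + t) (abs_pos.2 (by linarith))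
        rwa [abs_of_pos (by linarith)] at this
      have h2 : bar s R (x - t) ≤ (x - t) ^ (-q) := by
        have := bar_le (R := R) hs0 (x := x - t) (abs_pos.2 (by linarith))
        rwa [abs_of_pos (by linarith)] at this
      have h3 := (abs_le.1 (rpow_second_diff hq0.le hx ht)).2
      have h4 : J t * (bar s R (x + t) + bar s R (x - t) - 2 * x ^ (-q))
          ≤ J t * (Cq * x ^ (-q - 2) * t ^ 2) := by
        refine mul_le_mul_of_nonneg_left ?_ (hJ.nonneg t)
        calc _ ≤ 2 * (q * (q + 1) * 2 ^ (q + 2) * x ^ (-q - 2)) * t ^ 2 := by linarith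
          _ = _ := by rw [hCq]; ring
      have h5 : J t * (Cq * x ^ (-q - 2) * t ^ 2)
          ≤ Cq * x ^ (-q) * x ^ (-q) * mk s (t / x) := by
        rcases eq_or_ne t 0 with rfl | htne
        · simp [mk]
        · have e1 : min ((t / x) ^ 2) 1 = (t / x) ^ 2 := by
            apply min_eq_left
            rw [sq_le_one_iff_abs_le_one, abs_div, abs_of_pos hx, div_le_one hx]
            linarith
          have e2 : x ^ (-q - 2) * t ^ 2 = x ^ (-q) * (t / x) ^ 2 := by
            rw [rpow_sub hx, div_pow]; norm_cast; ring
          calc J t * (Cq * x ^ (-q - 2) * t ^ 2)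
              ≤ pk s t * (Cq * x ^ (-q - 2) * t ^ 2) :=
                mul_le_mul_of_nonneg_right (hJ.le t htne) (by positivity)
            _ = Cq * x ^ (-q) * x ^ (-q) * mk s (t / x) := by
              rw [mk, e1, pk_scale hx t, mul_assoc Cq, e2]; ring
      have h6 : 0 ≤ 2 ^ q * x ^ (-q) * (bar s R (x + t) + bar s R (x - t)) := by positivity
      linarith
    · have h1 : J t ≤ 2 ^ q * x ^ (-q) := by
        have htne : t ≠ 0 := by rintro rfl; rw [abs_zero] at ht; linarith
        have h2 := pk_anti hs0 (a := x / 2) (b := t) (abs_pos.2 (by positivity))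
          (by rw [abs_of_pos (by positivity : 0 < x / 2)]; exact ht.le)
        refine (hJ.le t htne).trans (h2.trans (le_of_eq ?_))
        rw [pk_eq_rpow s (by positivity), div_rpow hx.le zero_le_two, ← hq, rpow_neg zero_le_two]
        have : (2:ℝ) ^ q ≠ 0 := by positivity
        field_simp
      have h2 : J t * (bar s R (x + t) + bar s R (x - t) - 2 * x ^ (-q))
          ≤ J t * (bar s R (x + t) + bar s R (x - t)) :=
        mul_le_mul_of_nonneg_left (by have : 0 < x ^ (-q) := by positivity
                                      linarith) (hJ.nonneg t)
      have h3 := mul_le_mul_of_nonneg_right h1 (add_pos hp hm).le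
      have h4 : 0 ≤ Cq * x ^ (-q) * x ^ (-q) * mk s (t / x) := by positivity
      linarith
  have hle_int := integral_mono (hJ.integrable_mul
    (g := fun t => bar s R (x + t) + bar s R (x - t) - 2 * x ^ (-q))
    (by have := continuous_bar (s := s) hR; fun_prop))
    ((hI1.const_mul (Cq * x ^ (-q) * x ^ (-q))).add
      ((hIp.add hIm).const_mul (2 ^ q * x ^ (-q)))) hpt
  refine hle_int.trans ?_
  have hev : ∫ t, bar s R (x - t) = ∫ t, bar s R t := integral_sub_left_eq_self _ _ x
  have hev2 : ∫ t, bar s R (x + t) = ∫ t, bar s R t := integral_add_left_eq_self _ x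
  have hcalc : ∫ t, (Cq * x ^ (-q) * x ^ (-q) * mk s (t / x)
        + 2 ^ q * x ^ (-q) * (bar s R (x + t) + bar s R (x - t)))
      = Cq * x ^ (-q) * x ^ (-q) * (x * ∫ t, mk s t)
        + 2 ^ q * x ^ (-q) * (2 * (R ^ (-(2 * s)) * ∫ t, bar s 1 t)) := by
    rw [integral_add (hI1.const_mul _) ((hIp.fun_add hIm).const_mul _), integral_const_mul,
      integral_const_mul, integral_add hIp hIm, hev, hev2, integral_bar hR,
      Measure.integral_comp_div, abs_of_pos hx, smul_eq_mul]
    ring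
  refine hcalc.le.trans ?_
  have hxq : x ^ (-q) * x = x ^ (-(2 * s)) := by
    nth_rewrite 2 [← rpow_one x]
    rw [← rpow_add hx]; congr 1; rw [hq]; ring
  have hxR : x ^ (-(2 * s)) ≤ R ^ (-(2 * s)) := rpow_le_rpow_of_nonpos hR hRx (by linarith)
  calc Cq * x ^ (-q) * x ^ (-q) * (x * ∫ t, mk s t)
        + 2 ^ q * x ^ (-q) * (2 * (R ^ (-(2 * s)) * ∫ t, bar s 1 t))
      = Cq * x ^ (-q) * (x ^ (-q) * x) * (∫ t, mk s t)
        + 2 ^ q * x ^ (-q) * (2 * (R ^ (-(2 * s)) * ∫ t, bar s 1 t)) := by ring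
    _ ≤ Cq * x ^ (-q) * R ^ (-(2 * s)) * (∫ t, mk s t)
        + 2 ^ q * x ^ (-q) * (2 * (R ^ (-(2 * s)) * ∫ t, bar s 1 t)) := by
        rw [hxq]; gcongr
    _ = _ := by ring

/-- Decay of bounded functions satisfying a linear equation outside a compact set. -/
lemma Ker.le_bar {s : ℝ} {J : ℝ → ℝ} (hJ : Ker s J) {f a b : ℝ → ℝ} {R β B K F N C0 : ℝ}
    (hR : 0 < R) (hf : Continuous f) (hN : ∀ x, f x ≤ N) (hβ : 0 < β)
    (hC : ∀ x, R ≤ |x| → opL J (bar s R) x ≤ C0 * R ^ (-(2 * s)) * bar s R x)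
    (hRβ : C0 * R ^ (-(2 * s)) ≤ β)
    (heq : ∀ x, R ≤ |x| → opL J f x = a x * f x + b x)
    (ha : ∀ x, R ≤ |x| → 2 * β ≤ a x) (hb : ∀ x, R ≤ |x| → -(B * bar s R x) ≤ b x)
    (hF : ∀ x, |x| ≤ R → f x ≤ F) (hK0 : 0 ≤ K) (hKF : F * R ^ (1 + 2 * s) ≤ K)
    (hKB : B ≤ β * K) (x : ℝ) : f x ≤ K * bar s R x := by
  have hcb := continuous_bar (s := s) hR
  have hM := hJ.mass_nonneg
  set M := ∫ t, J t with hMdef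
  set g : ℝ → ℝ := fun y => f y - K * bar s R y with hg
  have hgc : Continuous g := by fun_prop
  have hbdd : BddAbove (range g) := ⟨N, by
    rintro _ ⟨y, rfl⟩
    have := mul_nonneg hK0 (bar_pos (s := s) hR y).le
    simp only [hg]; linarith [hN y]⟩
  set Z := sSup (range g) with hZ
  have hle : ∀ y, g y ≤ Z := fun y => le_csSup hbdd ⟨y, rfl⟩
  suffices Z ≤ 0 by have := hle x; simp only [hg] at this; linarith
  by_contra! hpos
  set η := β * Z / (M + 2 * β + 1) with hη
  have hηe : (M + 2 * β + 1) * η = β * Z := by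
    rw [hη]; field_simp
  have hηpos : 0 < η := by positivity
  have hηZ : η < Z := by nlinarith [mul_nonneg hM hηpos.le]
  obtain ⟨_, ⟨y, rfl⟩, hy⟩ := exists_lt_of_lt_csSup (range_nonempty g)
    (show Z - η < sSup (range g) by linarith)
  have hgy : 0 < g y := by linarith
  have hRy : R ≤ |y| := by
    by_contra! h
    have h1 := hF y h.le
    have h2 : F ≤ K * bar s R y := by
      rw [bar_of_le h.le, rpow_neg hR.le, ← div_eq_mul_inv, le_div_iff₀ (by positivity)]
      exact hKF
    simp only [hg] at hgy; linarith
  have h1 : opL J g y ≤ M * η := hJ.opL_le_of_near_max hgc fun z => by linarith [hle z]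
  have h2 : opL J g y = opL J f y - K * opL J (bar s R) y := by
    rw [hg, hJ.opL_sub hf (hcb.const_mul K), opL_const_mul]
  have hby := bar_pos (s := s) hR y
  have h3 : opL J (bar s R) y ≤ β * bar s R y :=
    (hC y hRy).trans (mul_le_mul_of_nonneg_right hRβ hby.le)
  have h4 := mul_le_mul_of_nonneg_left h3 hK0
  have hgy' : f y = g y + K * bar s R y := by simp [hg]
  have h5 : 2 * β * f y ≤ a y * f y := by
    refine mul_le_mul_of_nonneg_right (ha y hRy) ?_
    rw [hgy']; positivity
  have h6 := hb y hRy
  have h7 := mul_le_mul_of_nonneg_right hKB hby.le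
  rw [h2, heq y hRy] at h1
  rw [hgy'] at h5
  nlinarith [mul_pos hβ hgy]

lemma integral_Icc_comp_add {u v : ℝ → ℝ} (hv : Continuous v) (hu : ∀ x, HasDerivAt u (v x) x)
    (x : ℝ) {ρ : ℝ} (hρ : 0 ≤ ρ) :
    ∫ t in Icc (-ρ) ρ, (v (x + t) + v (x - t)) = 2 * (u (x + ρ) - u (x - ρ)) := by
  rw [integral_Icc_eq_integral_Ioc, ← intervalIntegral.integral_of_le (by linarith)]
  rw [intervalIntegral.integral_eq_sub_of_hasDerivAt (f := fun t => u (x + t) - u (x - t))]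
  · simp only [← sub_eq_add_neg, sub_neg_eq_add]; ring
  · intro t _
    have a1 := (hu (x + t)).comp_const_add x t
    have a2 := (hu (x - t)).comp_const_sub x t
    exact (a1.fun_sub a2).congr_deriv (by ring)
  · exact (by fun_prop : Continuous fun t => v (x + t) + v (x - t)).intervalIntegrable _ _

/-- Quantitative positivity of the derivative of a monotone solution. -/
lemma deriv_pos_bound {s : ℝ} (hs : s ∈ Ioo (0:ℝ) 1) {J : ℝ → ℝ} (hJ : Ker s J) {u v : ℝ → ℝ}
    (hu : ∀ x, HasDerivAt u (v x) x) (hv : Continuous v) (hv0 : ∀ x, 0 ≤ v x) {Λ ρ X A j : ℝ}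
    (hL : ∀ x, opL J v x ≤ Λ * v x) (hρ : 0 < ρ) (hρ1 : ρ ≤ 1) (hΛ : 0 ≤ Λ)
    (hinc : ∀ x, u (x + ρ) - u (x - ρ) ≤ 1 / 4) (hA : 1 / 2 ≤ u A - u (-A))
    {x0 : ℝ} (hX : |x0| + 1 + A ≤ X) (hA0 : 0 ≤ A) (hj0 : 0 ≤ j) (hj : ∀ t, |t| ≤ X → j ≤ J t) :
    j ≤ (4 * Λ + 8 / ρ ^ 2 * ∫ t, mk s t) * v x0 := by
  have hI := integrable_mk hs
  set m := v x0 with hm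
  have hm0 : 0 ≤ m := hv0 x0
  obtain ⟨x1, hx1, hmin⟩ := (isCompact_Icc (a := x0 - 1) (b := x0 + 1)).exists_isMinOn
    ⟨x0, by constructor <;> linarith⟩
    (f := fun x => v x + 2 * m * (x - x0) ^ 2) (by fun_prop)
  have hx10 : v x1 + 2 * m * (x1 - x0) ^ 2 ≤ m := by
    have := hmin (show x0 ∈ Icc (x0 - 1) (x0 + 1) by constructor <;> linarith)
    simpa using this
  have hglob : ∀ x, v x1 + 2 * m * (x1 - x0) ^ 2 ≤ v x + 2 * m * (x - x0) ^ 2 := by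
    intro x
    by_cases hx : x ∈ Icc (x0 - 1) (x0 + 1)
    · exact hmin hx
    · have : 1 ≤ (x - x0) ^ 2 := by
        rw [mem_Icc, not_and_or] at hx
        rcases hx with h | h <;> nlinarith
      nlinarith [hv0 x]
  have hvx1 : v x1 ≤ m := by nlinarith [mul_nonneg hm0 (sq_nonneg (x1 - x0))]
  have hmono : Monotone u := monotone_of_hasDerivAt_nonneg hu hv0
  have hρX : ρ ≤ X := by linarith [abs_nonneg x0]
  have hx1' : |x1| ≤ |x0| + 1 := by
    have h1 := le_abs_self x0
    have h2 := neg_abs_le x0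
    exact abs_le.2 ⟨by linarith [hx1.1], by linarith [hx1.2]⟩
  have hsum : Continuous fun t => v (x1 + t) + v (x1 - t) := by fun_prop
  have hpt : ∀ t, j * ((Icc (-X) X).indicator (fun t => v (x1 + t) + v (x1 - t)) t
        - (Icc (-ρ) ρ).indicator (fun t => v (x1 + t) + v (x1 - t)) t)
      ≤ J t * (v (x1 + t) + v (x1 - t) - 2 * v x1) + 4 / ρ ^ 2 * m * mk s t := by
    intro t
    have hJt := hJ.nonneg t
    have hvp := hv0 (x1 + t)
    have hvm := hv0 (x1 - t)
    rcases eq_or_ne t 0 with rfl | htne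
    · have h1 : (0:ℝ) ∈ Icc (-X) X := by constructor <;> linarith
      have h2 : (0:ℝ) ∈ Icc (-ρ) ρ := by constructor <;> linarith
      simp only [indicator_of_mem h1, indicator_of_mem h2, mk]
      norm_num
      linarith
    have hJp := hJ.le t htne
    have hmin1 : 0 ≤ min (t ^ 2) 1 := le_min (sq_nonneg _) zero_le_one
    have hS : -(4 / ρ ^ 2 * m * min (t ^ 2) 1)
        + (if |t| ≤ ρ then 0 else v (x1 + t) + v (x1 - t))
        ≤ v (x1 + t) + v (x1 - t) - 2 * v x1 := by
      have hρ2 : 1 ≤ 1 / ρ ^ 2 := by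
        rw [le_div_iff₀ (by positivity)]; nlinarith
      split_ifs with ht
      · have h1 : min (t ^ 2) 1 = t ^ 2 := by
          apply min_eq_left
          rw [sq_le_one_iff_abs_le_one]; linarith
        rw [h1]
        have h2 := hglob (x1 + t)
        have h3 := hglob (x1 - t)
        have h4 : m * t ^ 2 ≤ (1 / ρ ^ 2) * (m * t ^ 2) :=
          le_mul_of_one_le_left (by positivity) hρ2
        have h5 : 4 / ρ ^ 2 * m * t ^ 2 = 4 * ((1 / ρ ^ 2) * (m * t ^ 2)) := by ring
        rw [h5]
        nlinarith
      · push Not at ht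
        have h1 : ρ ^ 2 ≤ min (t ^ 2) 1 := by
          refine le_min ?_ (by nlinarith)
          rw [← sq_abs t]; nlinarith
        have h2 : 4 * m ≤ 4 / ρ ^ 2 * m * min (t ^ 2) 1 := by
          calc 4 * m = 4 / ρ ^ 2 * m * ρ ^ 2 := by field_simp
            _ ≤ _ := by gcongr
        linarith
    have h1 : J t * (4 / ρ ^ 2 * m * min (t ^ 2) 1) ≤ 4 / ρ ^ 2 * m * mk s t := by
      calc J t * (4 / ρ ^ 2 * m * min (t ^ 2) 1) ≤ pk s t * (4 / ρ ^ 2 * m * min (t ^ 2) 1) :=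
            mul_le_mul_of_nonneg_right hJp (by positivity)
        _ = _ := by rw [mk]; ring
    have h2 := mul_le_mul_of_nonneg_left hS hJt
    have h3 : j * ((Icc (-X) X).indicator (fun t => v (x1 + t) + v (x1 - t)) t
        - (Icc (-ρ) ρ).indicator (fun t => v (x1 + t) + v (x1 - t)) t)
        ≤ J t * (if |t| ≤ ρ then 0 else v (x1 + t) + v (x1 - t)) := by
      by_cases hρt : |t| ≤ ρ
      · have ha : t ∈ Icc (-ρ) ρ := abs_le.1 hρt
        have hb : t ∈ Icc (-X) X := abs_le.1 (hρt.trans hρX)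
        simp [indicator_of_mem ha, indicator_of_mem hb, hρt]
      · have ha : t ∉ Icc (-ρ) ρ := fun h => hρt (abs_le.2 h)
        simp only [indicator_of_notMem ha, hρt, if_false, sub_zero]
        by_cases hXt : |t| ≤ X
        · have hb : t ∈ Icc (-X) X := abs_le.1 hXt
          simp only [indicator_of_mem hb]
          exact mul_le_mul_of_nonneg_right (hj t hXt) (by positivity)
        · have hb : t ∉ Icc (-X) X := fun h => hXt (abs_le.2 h)
          simp only [indicator_of_notMem hb, mul_zero]
          positivity
    linarith
  have hi1 : Integrable ((Icc (-X) X).indicator (fun t => v (x1 + t) + v (x1 - t))) := by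
    rw [integrable_indicator_iff measurableSet_Icc]; exact hsum.integrableOn_Icc
  have hi2 : Integrable ((Icc (-ρ) ρ).indicator (fun t => v (x1 + t) + v (x1 - t))) := by
    rw [integrable_indicator_iff measurableSet_Icc]; exact hsum.integrableOn_Icc
  have hi3 := hJ.integrable_mul (g := fun t => v (x1 + t) + v (x1 - t) - 2 * v x1) (by fun_prop)
  have hle_int := integral_mono ((hi1.sub hi2).const_mul j)
    (hi3.add (hI.const_mul (4 / ρ ^ 2 * m))) hpt
  have e1 : ∫ t, j * ((Icc (-X) X).indicator (fun t => v (x1 + t) + v (x1 - t)) t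
        - (Icc (-ρ) ρ).indicator (fun t => v (x1 + t) + v (x1 - t)) t)
      = j * (2 * (u (x1 + X) - u (x1 - X)) - 2 * (u (x1 + ρ) - u (x1 - ρ))) := by
    rw [integral_const_mul, integral_sub hi1 hi2, integral_indicator measurableSet_Icc,
      integral_indicator measurableSet_Icc, integral_Icc_comp_add hv hu x1 (by linarith),
      integral_Icc_comp_add hv hu x1 hρ.le]
  have e2 : ∫ t, (J t * (v (x1 + t) + v (x1 - t) - 2 * v x1) + 4 / ρ ^ 2 * m * mk s t)
      = 2 * opL J v x1 + 4 / ρ ^ 2 * m * ∫ t, mk s t := by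
    rw [integral_add hi3 (hI.const_mul _), integral_const_mul, ← hJ.opL_symm hv]
  have h1 := (e1.symm.le.trans hle_int).trans e2.le
  have h2 : u A ≤ u (x1 + X) := hmono (by linarith [(abs_le.1 hx1').1])
  have h3 : u (x1 - X) ≤ u (-A) := hmono (by linarith [(abs_le.1 hx1').2])
  have h4 := hinc x1
  have h5 : j * (1 / 2) ≤ j * (2 * (u (x1 + X) - u (x1 - X)) - 2 * (u (x1 + ρ) - u (x1 - ρ))) :=
    mul_le_mul_of_nonneg_left (by linarith) hj0
  have h6 := hL x1
  have h7 : Λ * v x1 ≤ Λ * m := mul_le_mul_of_nonneg_left hvx1 hΛ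
  have h8 : (4 * Λ + 8 / ρ ^ 2 * ∫ t, mk s t) * m
      = 4 * (Λ * m) + 2 * (4 / ρ ^ 2 * m * ∫ t, mk s t) := by ring
  rw [h8]
  linarith

lemma opL_shift (J f : ℝ → ℝ) (h x : ℝ) :
    opL J (fun y => f (y + h)) x = opL J f (x + h) := by
  unfold opL
  congr 1; ext t
  rw [add_right_comm]

lemma Ker.opL_diff {s : ℝ} {J f : ℝ → ℝ} (hJ : Ker s J) (hf : Continuous f) (h x : ℝ) :
    opL J (fun y => f (y + h) - f y) x = opL J f (x + h) - opL J f x := by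
  rw [hJ.opL_sub (f := fun y => f (y + h)) (by fun_prop) hf, opL_shift]

lemma abs_integral_diff_le {f : ℝ → ℝ} (hf : Continuous f) {N : ℝ} (hN : ∀ x, |f x| ≤ N)
    (ρ h x : ℝ) : |∫ t in (-ρ)..ρ, (f (x + t + h) - f (x + t))| ≤ 2 * N * |h| := by
  have hi : ∀ a b, IntervalIntegrable f volume a b := fun a b => hf.intervalIntegrable a b
  rw [intervalIntegral.integral_sub
    ((by fun_prop : Continuous fun t => f (x + t + h)).intervalIntegrable _ _)
    ((by fun_prop : Continuous fun t => f (x + t)).intervalIntegrable _ _)]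
  have e1 : ∫ t in (-ρ)..ρ, f (x + t + h) = ∫ t in (x + h + -ρ)..(x + h + ρ), f t := by
    rw [← intervalIntegral.integral_comp_add_left]
    congr 1; ext t; congr 1; ring
  rw [e1, intervalIntegral.integral_comp_add_left (fun t => f t),
    intervalIntegral.integral_interval_sub_interval_comm (hi _ _) (hi _ _) (hi _ _)]
  have b1 := intervalIntegral.norm_integral_le_of_norm_le_const (a := x + h + -ρ) (b := x + -ρ)
    (f := f) (C := N) fun t _ => hN t
  have b2 := intervalIntegral.norm_integral_le_of_norm_le_const (a := x + h + ρ) (b := x + ρ)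
    (f := f) (C := N) fun t _ => hN t
  rw [show x + -ρ - (x + h + -ρ) = -h by ring, abs_neg] at b1
  rw [show x + ρ - (x + h + ρ) = -h by ring, abs_neg] at b2
  refine (abs_sub _ _).trans ?_
  rw [Real.norm_eq_abs] at b1 b2
  linarith

lemma Ker.hasDerivAt_opL {s : ℝ} {J f f' : ℝ → ℝ} (hJ : Ker s J)
    (hf : ∀ x, HasDerivAt f (f' x) x) (hf' : Continuous f') {N : ℝ} (hN : ∀ x, |f' x| ≤ N)
    (x : ℝ) : HasDerivAt (opL J f) (opL J f' x) x := by
  have hc : Continuous f := continuous_iff_continuousAt.2 fun x => (hf x).continuousAt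
  have hJc := hJ.cont
  refine (hasDerivAt_integral_of_dominated_loc_of_deriv_le (s := univ)
    (F := fun x t => J t * (f (x + t) - f x))
    (F' := fun x t => J t * (f' (x + t) - f' x)) (bound := fun t => J t * (2 * N)) univ_mem
    (Eventually.of_forall fun y => ?_) ?_ ?_ ?_ ?_ ?_).2
  · exact (by fun_prop : Continuous fun t => J t * (f (y + t) - f y)).aestronglyMeasurable
  · exact hJ.integrable_mul (g := fun t => f (x + t) - f x) (by fun_prop)
  · exact (by fun_prop : Continuous fun t => J t * (f' (x + t) - f' x)).aestronglyMeasurable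
  · refine Eventually.of_forall fun t y _ => ?_
    rw [Real.norm_eq_abs, abs_mul, abs_of_nonneg (hJ.nonneg t)]
    refine mul_le_mul_of_nonneg_left ?_ (hJ.nonneg t)
    refine (abs_sub _ _).trans ?_
    linarith [hN (y + t), hN y]
  · exact hJ.integrable.mul_const _
  · refine Eventually.of_forall fun t y _ => ?_
    exact (((hf (y + t)).comp_add_const y t).fun_sub (hf y)).const_mul (J t)

lemma abs_deriv_le_of_lip {f : ℝ → ℝ} {f' x K : ℝ} (hf : HasDerivAt f f' x)
    (hK : ∀ h, |f (x + h) - f x| ≤ K * |h|) : |f'| ≤ K := by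
  have hK0 : 0 ≤ K := by
    have := (abs_nonneg _).trans (hK 1)
    simpa using this
  refine hf.le_of_lip' hK0 (Eventually.of_forall fun y => ?_)
  have := hK (y - x)
  simpa using this

/-- Smooth increasing solutions of the regularised equation. -/
structure Sol (J W1 u v w : ℝ → ℝ) : Prop where
  hu : ∀ x, HasDerivAt u (v x) x
  hv : ∀ x, HasDerivAt v (w x) x
  cw : Continuous w
  eqn : ∀ x, opL J u x = W1 (u x)
  mem : ∀ x, u x ∈ Icc (0:ℝ) 1
  nonneg : ∀ x, 0 ≤ v x

namespace Sol
variable {s : ℝ} {J W W1 W2 W3 u v w : ℝ → ℝ} {Λ r D k ρ : ℝ}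

lemma cu (h : Sol J W1 u v w) : Continuous u :=
  continuous_iff_continuousAt.2 fun x => (h.hu x).continuousAt

lemma cv (h : Sol J W1 u v w) : Continuous v :=
  continuous_iff_continuousAt.2 fun x => (h.hv x).continuousAt

lemma abs_le_one (h : Sol J W1 u v w) (x : ℝ) : |u x| ≤ 1 :=
  abs_le.2 ⟨by linarith [(h.mem x).1], (h.mem x).2⟩

lemma lip (h : Sol J W1 u v w) (hW : Pot W W1 W2 W3 Λ r D) (hJ : Ker s J) (hk : 0 ≤ k)
    (hρ : 0 ≤ ρ) (hkρ : Λ + 1 ≤ 2 * k * ρ) (hJk : ∀ t, |t| ≤ ρ → k ≤ J t) (x a : ℝ) :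
    |u (x + a) - u x| ≤ 2 * k * |a| := by
  have hc := h.cu
  have := hJ.abs_bound (z := fun x => u (x + a) - u x) (by fun_prop) (N := 2) (β := 0)
    (B := 2 * 1 * |a|) (Λ := Λ) (fun y => ?_) le_rfl hk hρ hkρ hJk (fun y => ?_)
    (abs_integral_diff_le hc h.abs_le_one ρ a) x
  · linarith
  · refine (abs_sub _ _).trans ?_
    linarith [h.abs_le_one (y + a), h.abs_le_one y]
  · rw [hJ.opL_diff hc, h.eqn, h.eqn, add_zero]
    exact hW.lip1 _ _

lemma eqn1 (h : Sol J W1 u v w) (hW : Pot W W1 W2 W3 Λ r D) (hJ : Ker s J) {C1 : ℝ}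
    (hC1 : ∀ x, |v x| ≤ C1) (x : ℝ) : opL J v x = W2 (u x) * v x := by
  have h1 := hJ.hasDerivAt_opL h.hu h.cv hC1 x
  rw [funext h.eqn] at h1
  exact h1.unique ((hW.hd2 (u x)).comp x (h.hu x))

lemma eqn2 (h : Sol J W1 u v w) (hW : Pot W W1 W2 W3 Λ r D) (hJ : Ker s J) {C1 C2 : ℝ}
    (hC1 : ∀ x, |v x| ≤ C1) (hC2 : ∀ x, |w x| ≤ C2) (x : ℝ) :
    opL J w x = W2 (u x) * w x + W3 (u x) * v x ^ 2 := by
  have h1 := hJ.hasDerivAt_opL h.hv h.cw hC2 x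
  rw [funext (h.eqn1 hW hJ hC1)] at h1
  have h2 := ((hW.hd3 (u x)).comp x (h.hu x)).fun_mul (h.hv x)
  rw [h1.unique h2]
  simp only [Function.comp_apply]; ring

lemma lip_v (h : Sol J W1 u v w) (hW : Pot W W1 W2 W3 Λ r D) (hJ : Ker s J) (hk : 0 ≤ k)
    (hρ : 0 ≤ ρ) (hkρ : Λ + 1 ≤ 2 * k * ρ) (hJk : ∀ t, |t| ≤ ρ → k ≤ J t) {C1 : ℝ}
    (hC1 : ∀ x, |v x| ≤ C1) (x a : ℝ) :
    |v (x + a) - v x| ≤ (2 * k * C1 + Λ * C1 ^ 2) * |a| := by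
  have hc := h.cv
  have hC0 : 0 ≤ C1 := (abs_nonneg _).trans (hC1 0)
  have hΛ := hW.Λ_pos.le
  have := hJ.abs_bound (z := fun x => v (x + a) - v x) (by fun_prop) (N := 2 * C1)
    (β := Λ * C1 ^ 2 * |a|) (B := 2 * C1 * |a|) (Λ := Λ) (fun y => ?_) (by positivity) hk hρ hkρ
    hJk (fun y => ?_) (abs_integral_diff_le hc hC1 ρ a) x
  · linarith
  · refine (abs_sub _ _).trans ?_
    linarith [hC1 (y + a), hC1 y]
  · rw [hJ.opL_diff hc, h.eqn1 hW hJ hC1, h.eqn1 hW hJ hC1]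
    have hl := lip_of_hasDerivAt h.hu hC1 (y + a) y
    rw [add_sub_cancel_left] at hl
    have h2 := (hW.lip2 (u (y + a)) (u y)).trans (mul_le_mul_of_nonneg_left hl hΛ)
    calc |W2 (u (y + a)) * v (y + a) - W2 (u y) * v y|
        = |W2 (u (y + a)) * (v (y + a) - v y) + (W2 (u (y + a)) - W2 (u y)) * v y| := by ring_nf
      _ ≤ |W2 (u (y + a)) * (v (y + a) - v y)| + |(W2 (u (y + a)) - W2 (u y)) * v y| :=
          abs_add_le _ _
      _ ≤ Λ * |v (y + a) - v y| + Λ * (C1 * |a|) * C1 := by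
          rw [abs_mul, abs_mul]
          gcongr
          · exact hW.b2 _
          · exact hC1 y
      _ = _ := by ring

lemma holder_w (h : Sol J W1 u v w) (hW : Pot W W1 W2 W3 Λ r D) (hJ : Ker s J) (hk : 0 ≤ k)
    (hρ : 0 ≤ ρ) (hkρ : Λ + 1 ≤ 2 * k * ρ) (hJk : ∀ t, |t| ≤ ρ → k ≤ J t) {C1 C2 : ℝ}
    (hC1 : ∀ x, |v x| ≤ C1) (hC2 : ∀ x, |w x| ≤ C2) (x a : ℝ) :
    |w (x + a) - w x| ≤ (2 * k * C2 + (3 * Λ * C1 * C2 + D * C1 ^ r * C1 ^ 2) + 2 * C2) * |a| ^ r := by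
  have hc := h.cw
  have hC0 : 0 ≤ C1 := (abs_nonneg _).trans (hC1 0)
  have hC20 : 0 ≤ C2 := (abs_nonneg _).trans (hC2 0)
  have hΛ := hW.Λ_pos.le
  have hD := hW.D_nonneg
  have hr := hW.r_pos
  rcases le_total 1 |a| with ha | ha
  · have h1 : 1 ≤ |a| ^ r := one_le_rpow ha hr.le
    have h2 : |w (x + a) - w x| ≤ 2 * C2 := by
      refine (abs_sub _ _).trans ?_
      linarith [hC2 (x + a), hC2 x]
    have h3 : 0 ≤ 2 * k * C2 + (3 * Λ * C1 * C2 + D * C1 ^ r * C1 ^ 2) := by positivity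
    nlinarith
  have har : |a| ≤ |a| ^ r := by
    have := rpow_le_rpow_of_exponent_ge' (abs_nonneg a) ha hr.le hW.r_lt.le
    rwa [rpow_one] at this
  have := hJ.abs_bound (z := fun x => w (x + a) - w x) (by fun_prop) (N := 2 * C2)
    (β := (3 * Λ * C1 * C2 + D * C1 ^ r * C1 ^ 2) * |a| ^ r) (B := 2 * C2 * |a|) (Λ := Λ)
    (fun y => ?_) (by positivity) hk hρ hkρ hJk (fun y => ?_) (abs_integral_diff_le hc hC2 ρ a) x
  · have h1 : k * (2 * C2 * |a|) ≤ k * (2 * C2 * |a| ^ r) := by gcongr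
    have h2 : 0 ≤ C2 * |a| ^ r := by positivity
    nlinarith
  · refine (abs_sub _ _).trans ?_
    linarith [hC2 (y + a), hC2 y]
  · rw [hJ.opL_diff hc, h.eqn2 hW hJ hC1 hC2, h.eqn2 hW hJ hC1 hC2]
    have hl := lip_of_hasDerivAt h.hu hC1 (y + a) y
    have hl2 := lip_of_hasDerivAt h.hv hC2 (y + a) y
    rw [add_sub_cancel_left] at hl hl2
    have h2 := (hW.lip2 (u (y + a)) (u y)).trans (mul_le_mul_of_nonneg_left hl hΛ)
    have h3 : |W3 (u (y + a)) - W3 (u y)| ≤ D * (C1 ^ r * |a| ^ r) := by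
      refine (hW.hol _ _).trans (mul_le_mul_of_nonneg_left ?_ hD)
      rw [← mul_rpow hC0 (abs_nonneg _)]
      exact rpow_le_rpow (abs_nonneg _) hl hr.le
    have h4 : |v (y + a) ^ 2| ≤ C1 ^ 2 := by
      rw [abs_pow]; exact pow_le_pow_left₀ (abs_nonneg _) (hC1 _) 2
    have h5 : |v (y + a) ^ 2 - v y ^ 2| ≤ 2 * C1 * (C2 * |a|) := by
      rw [sq_sub_sq, abs_mul]
      refine mul_le_mul ?_ hl2 (abs_nonneg _) (by positivity)
      refine (abs_add_le _ _).trans ?_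
      linarith [hC1 (y + a), hC1 y]
    calc |W2 (u (y + a)) * w (y + a) + W3 (u (y + a)) * v (y + a) ^ 2
          - (W2 (u y) * w y + W3 (u y) * v y ^ 2)|
        = |(W2 (u (y + a)) * (w (y + a) - w y) + (W2 (u (y + a)) - W2 (u y)) * w y)
          + ((W3 (u (y + a)) - W3 (u y)) * v (y + a) ^ 2
            + W3 (u y) * (v (y + a) ^ 2 - v y ^ 2))| := by ring_nf
      _ ≤ (|W2 (u (y + a)) * (w (y + a) - w y)| + |(W2 (u (y + a)) - W2 (u y)) * w y|)
          + (|(W3 (u (y + a)) - W3 (u y)) * v (y + a) ^ 2|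
            + |W3 (u y) * (v (y + a) ^ 2 - v y ^ 2)|) :=
          (abs_add_le _ _).trans (add_le_add (abs_add_le _ _) (abs_add_le _ _))
      _ ≤ (Λ * |w (y + a) - w y| + Λ * (C1 * |a|) * C2)
          + (D * (C1 ^ r * |a| ^ r) * C1 ^ 2 + Λ * (2 * C1 * (C2 * |a|))) := by
          rw [abs_mul, abs_mul, abs_mul, abs_mul]
          gcongr
          · exact hW.b2 _
          · exact hC2 y
          · exact hW.b3 _
      _ = Λ * |w (y + a) - w y| + (3 * Λ * C1 * C2 * |a| + D * C1 ^ r * C1 ^ 2 * |a| ^ r) := by ring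
      _ ≤ Λ * |w (y + a) - w y| + (3 * Λ * C1 * C2 * |a| ^ r + D * C1 ^ r * C1 ^ 2 * |a| ^ r) := by
          gcongr
      _ = _ := by ring

lemma abs_v_le (h : Sol J W1 u v w) (hW : Pot W W1 W2 W3 Λ r D) (hJ : Ker s J) (hk : 0 ≤ k)
    (hρ : 0 ≤ ρ) (hkρ : Λ + 1 ≤ 2 * k * ρ) (hJk : ∀ t, |t| ≤ ρ → k ≤ J t) (x : ℝ) :
    |v x| ≤ 2 * k :=
  abs_deriv_le_of_lip (h.hu x) (h.lip hW hJ hk hρ hkρ hJk x)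

lemma abs_w_le (h : Sol J W1 u v w) (hW : Pot W W1 W2 W3 Λ r D) (hJ : Ker s J) (hk : 0 ≤ k)
    (hρ : 0 ≤ ρ) (hkρ : Λ + 1 ≤ 2 * k * ρ) (hJk : ∀ t, |t| ≤ ρ → k ≤ J t) {C1 : ℝ}
    (hC1 : ∀ x, |v x| ≤ C1) (x : ℝ) : |w x| ≤ 2 * k * C1 + Λ * C1 ^ 2 :=
  abs_deriv_le_of_lip (h.hv x) (h.lip_v hW hJ hk hρ hkρ hJk hC1 x)

end Sol

/-- Monotone transitions from `0` to `1`. -/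
structure Prof (u : ℝ → ℝ) : Prop where
  mono : Monotone u
  bot : Tendsto u atBot (𝓝 0)
  top : Tendsto u atTop (𝓝 1)

/-- `∫ (u(x+t) - u(x))² dx`. -/
def sqInc (u : ℝ → ℝ) (t : ℝ) : ℝ := ∫ x, (u (x + t) - u x) ^ 2

/-- The nonlocal energy. -/
def energy (J W u : ℝ → ℝ) : ℝ := (1 / 4) * (∫ t, J t * sqInc u t) + ∫ x, W (u x)

lemma sqInc_nonneg (u : ℝ → ℝ) (t : ℝ) : 0 ≤ sqInc u t := integral_nonneg fun _ => sq_nonneg _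

namespace Prof
variable {u : ℝ → ℝ}

lemma mem (h : Prof u)
    (x : ℝ) : u x ∈ Icc (0:ℝ) 1 := ⟨h.mono.le_of_tendsto h.bot x, h.mono.ge_of_tendsto h.top x⟩

lemma abs_diff_le (h : Prof u) (x y : ℝ) : |u x - u y| ≤ 1 :=
  abs_le.2 ⟨by linarith [(h.mem x).1, (h.mem y).2], by linarith [(h.mem x).2, (h.mem y).1]⟩

lemma measurable (h : Prof u) : Measurable u := h.mono.measurable

lemma intervalIntegrable (h : Prof u)
    (a b : ℝ) : IntervalIntegrable u volume a b := h.mono.intervalIntegrable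

lemma interval_bound (h : Prof u)
    {t : ℝ} (ht : 0 ≤ t) (a b : ℝ) : ∫ x in a..b, (u (x + t) - u x) ≤ t := by
  have hs : IntervalIntegrable (fun x => u (x + t)) volume a b := by
    have := (h.intervalIntegrable (a + t) (b + t)).comp_add_right (c := t)
    simpa using this
  rw [intervalIntegral.integral_sub hs (h.intervalIntegrable _ _),
    intervalIntegral.integral_comp_add_right,
    intervalIntegral.integral_interval_sub_interval_comm (h.intervalIntegrable _ _)
      (h.intervalIntegrable _ _) (h.intervalIntegrable _ _),
    intervalIntegral.integral_symm, intervalIntegral.integral_symm b]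
  have h1 : 0 ≤ ∫ x in a..(a + t), u x :=
    intervalIntegral.integral_nonneg (by linarith) fun x _ => (h.mem x).1
  have h2 : ∫ x in b..(b + t), u x ≤ ∫ x in b..(b + t), (1:ℝ) :=
    intervalIntegral.integral_mono_on (by linarith) (h.intervalIntegrable _ _) (by simp)
      fun x _ => (h.mem x).2
  simp at h2
  linarith

lemma integrable_diff_aux (h : Prof u) {t : ℝ} (ht : 0 ≤ t) :
    Integrable (fun x => u (x + t) - u x) ∧ ∫ x, (u (x + t) - u x) ≤ t := by
  have hloc : LocallyIntegrable u := h.mono.locallyIntegrable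
  have hnn : ∀ x, 0 ≤ u (x + t) - u x := fun x => sub_nonneg.2 (h.mono (by linarith))
  have hnorm : ∀ x, ‖u (x + t) - u x‖ = u (x + t) - u x := fun x => by
    rw [Real.norm_eq_abs, abs_of_nonneg (hnn x)]
  have hm := h.measurable
  have hi : Integrable (fun x => u (x + t) - u x) := by
    refine integrable_of_intervalIntegral_norm_bounded (ι := ℕ) (l := atTop) t
      (a := fun n => -(n:ℝ)) (b := fun n => (n:ℝ)) (fun n => ?_)
      (tendsto_neg_atTop_atBot.comp tendsto_natCast_atTop_atTop) tendsto_natCast_atTop_atTop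
      (Eventually.of_forall fun n => ?_)
    · refine Measure.integrableOn_of_bounded (M := 1) (by simp) ?_ ?_
      · exact (by fun_prop : Measurable fun x => u (x + t) - u x).aestronglyMeasurable
      · exact Eventually.of_forall fun x => h.abs_diff_le _ _
    · simp only [hnorm]
      exact h.interval_bound ht _ _
  refine ⟨hi, ?_⟩
  have hlim := intervalIntegral_tendsto_integral (l := atTop) (a := fun n : ℕ => -(n:ℝ))
    (b := fun n : ℕ => (n:ℝ)) hi
    (tendsto_neg_atTop_atBot.comp tendsto_natCast_atTop_atTop) tendsto_natCast_atTop_atTop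
  exact le_of_tendsto' hlim fun n => h.interval_bound ht _ _

lemma integrable_diff (h : Prof u) (t : ℝ) : Integrable (fun x => u (x + t) - u x) := by
  rcases le_total 0 t with ht | ht
  · exact (h.integrable_diff_aux ht).1
  · have := ((h.integrable_diff_aux (neg_nonneg.2 ht)).1.comp_add_right t).neg
    refine this.congr (Eventually.of_forall fun x => ?_)
    simp

lemma integral_abs_diff_le (h : Prof u) (t : ℝ) : ∫ x, |u (x + t) - u x| ≤ |t| := by
  rcases le_total 0 t with ht | ht
  · have : ∀ x, |u (x + t) - u x| = u (x + t) - u x := fun x =>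
      abs_of_nonneg (sub_nonneg.2 (h.mono (by linarith)))
    simp only [this]
    rw [abs_of_nonneg ht]
    exact (h.integrable_diff_aux ht).2
  · have : ∀ x, |u (x + t) - u x| = u (x + t + -t) - u (x + t) := fun x => by
      rw [abs_of_nonpos (sub_nonpos.2 (h.mono (by linarith)))]; simp
    simp only [this]
    rw [integral_add_right_eq_self (fun y => u (y + -t) - u y), abs_of_nonpos ht]
    exact (h.integrable_diff_aux (neg_nonneg.2 ht)).2

lemma sq_le_abs (h : Prof u) (x t : ℝ) : (u (x + t) - u x) ^ 2 ≤ |u (x + t) - u x| := by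
  have h1 := h.abs_diff_le (x + t) x
  rw [← sq_abs]
  nlinarith [abs_nonneg (u (x + t) - u x)]

lemma integrable_sq (h : Prof u) (t : ℝ) : Integrable (fun x => (u (x + t) - u x) ^ 2) := by
  have hm := h.measurable
  refine (h.integrable_diff t).abs.mono'
    (by fun_prop : Measurable fun x => (u (x + t) - u x) ^ 2).aestronglyMeasurable
    (Eventually.of_forall fun x => ?_)
  rw [Real.norm_eq_abs, abs_of_nonneg (sq_nonneg _)]
  exact h.sq_le_abs x t

lemma integrable_prod (h : Prof u) {s : ℝ} {J : ℝ → ℝ} (hJ : Ker s J) :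
    Integrable (fun p : ℝ × ℝ => J p.1 * (u (p.2 + p.1) - u p.2)) (volume.prod volume) := by
  have hm := h.measurable
  have hJm := hJ.cont.measurable
  have hmeas : Measurable fun p : ℝ × ℝ => J p.1 * (u (p.2 + p.1) - u p.2) := by fun_prop
  rw [integrable_prod_iff hmeas.aestronglyMeasurable]
  refine ⟨Eventually.of_forall fun t => (h.integrable_diff t).const_mul (J t), ?_⟩
  have hb : Integrable fun t => J t * |t| := hJ.integrable_mul continuous_abs
  refine hb.mono' ?_ (Eventually.of_forall fun t => ?_)
  · exact (hmeas.norm.stronglyMeasurable.integral_prod_right' (ν := volume)).aestronglyMeasurable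
  · simp only [norm_mul, integral_const_mul, Real.norm_eq_abs, abs_of_nonneg (hJ.nonneg t)]
    rw [abs_of_nonneg (integral_nonneg fun x => abs_nonneg (u (x + t) - u x))]
    exact mul_le_mul_of_nonneg_left (h.integral_abs_diff_le t) (hJ.nonneg t)

lemma integrable_prod_sq (h : Prof u) {s : ℝ} {J : ℝ → ℝ} (hJ : Ker s J) :
    Integrable (fun p : ℝ × ℝ => J p.1 * (u (p.2 + p.1) - u p.2) ^ 2) (volume.prod volume) := by
  have hm := h.measurable
  have hJm := hJ.cont.measurable
  refine (h.integrable_prod hJ).abs.mono' (by fun_prop : Measurable fun p : ℝ × ℝ =>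
    J p.1 * (u (p.2 + p.1) - u p.2) ^ 2).aestronglyMeasurable (Eventually.of_forall fun p => ?_)
  rw [Real.norm_eq_abs, abs_mul, abs_mul, abs_of_nonneg (sq_nonneg (u (p.2 + p.1) - u p.2))]
  exact mul_le_mul_of_nonneg_left (h.sq_le_abs _ _) (abs_nonneg _)

lemma integrable_sqInc (h : Prof u) {s : ℝ} {J : ℝ → ℝ} (hJ : Ker s J) :
    Integrable (fun t => J t * sqInc u t) := by
  have := (h.integrable_prod_sq hJ).integral_prod_left
  simp only [sqInc]
  simpa only [integral_const_mul] using this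

lemma integral_sqInc (h : Prof u) {s : ℝ} {J : ℝ → ℝ} (hJ : Ker s J) :
    ∫ t, J t * sqInc u t
      = ∫ p, J p.1 * (u (p.2 + p.1) - u p.2) ^ 2 ∂((volume : Measure ℝ).prod volume) := by
  rw [integral_prod _ (h.integrable_prod_sq hJ)]
  simp only [integral_const_mul, sqInc]

lemma shift (h : Prof u) (c : ℝ) : Prof (fun x => u (x + c)) where
  mono := fun x y hxy => h.mono (by linarith)
  bot := h.bot.comp (tendsto_atBot_add_const_right _ c tendsto_id)
  top := h.top.comp (tendsto_atTop_add_const_right _ c tendsto_id)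

end Prof

lemma sqInc_shift (u : ℝ → ℝ) (c t : ℝ) : sqInc (fun x => u (x + c)) t = sqInc u t := by
  unfold sqInc
  rw [← integral_add_right_eq_self (fun x => (u (x + t) - u x) ^ 2) c]
  simp only [add_right_comm]

lemma energy_shift (J W u : ℝ → ℝ) (c : ℝ) : energy J W (fun x => u (x + c)) = energy J W u := by
  unfold energy
  simp only [sqInc_shift]
  rw [integral_add_right_eq_self (fun x => W (u x)) c]

/-- Admissible profiles. -/
structure Adm (W u : ℝ → ℝ) : Prop extends Prof u where
  int : Integrable (fun x => W (u x))

lemma Adm.shift {W u : ℝ → ℝ} (h : Adm W u) (c : ℝ) : Adm W (fun x => u (x + c)) where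
  toProf := h.toProf.shift c
  int := h.int.comp_add_right c

/-- Fatou's lemma for real integrals. -/
lemma fatou_real {α : Type*} [MeasurableSpace α] {μ : Measure α} {f : ℕ → α → ℝ} {g : α → ℝ}
    (hf : ∀ n, Integrable (f n) μ) (hf0 : ∀ n x, 0 ≤ f n x)
    (hlim : ∀ᵐ x ∂μ, Tendsto (fun n => f n x) atTop (𝓝 (g x))) {c : ℕ → ℝ} {C : ℝ}
    (hc : ∀ n, ∫ x, f n x ∂μ ≤ c n) (hC : Tendsto c atTop (𝓝 C)) :
    Integrable g μ ∧ ∫ x, g x ∂μ ≤ C := by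
  have hg0 : ∀ᵐ x ∂μ, 0 ≤ g x := by
    filter_upwards [hlim] with x hx using ge_of_tendsto' hx fun n => hf0 n x
  have hgm : AEStronglyMeasurable g μ :=
    aestronglyMeasurable_of_tendsto_ae atTop (fun n => (hf n).1) hlim
  have hC0 : 0 ≤ C := ge_of_tendsto' hC fun n => (integral_nonneg (hf0 n)).trans (hc n)
  have h1 : ∫⁻ x, ENNReal.ofReal (g x) ∂μ ≤ ENNReal.ofReal C := by
    have e : ∫⁻ x, ENNReal.ofReal (g x) ∂μ
        = ∫⁻ x, liminf (fun n => ENNReal.ofReal (f n x)) atTop ∂μ := by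
      apply lintegral_congr_ae
      filter_upwards [hlim] with x hx
      exact ((ENNReal.continuous_ofReal.tendsto _).comp hx).liminf_eq.symm
    rw [e]
    refine (lintegral_liminf_le' fun n => (hf n).1.aemeasurable.ennreal_ofReal).trans ?_
    have e2 : ∀ n, ∫⁻ x, ENNReal.ofReal (f n x) ∂μ = ENNReal.ofReal (∫ x, f n x ∂μ) := fun n =>
      (ofReal_integral_eq_lintegral_ofReal (hf n) (Eventually.of_forall (hf0 n))).symm
    simp only [e2]
    have h2 := ((ENNReal.continuous_ofReal.tendsto _).comp hC).liminf_eq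
    rw [← h2]
    exact liminf_le_liminf (Eventually.of_forall fun n => ENNReal.ofReal_le_ofReal (hc n))
  have hgi : Integrable g μ := by
    refine ⟨hgm, ?_⟩
    rw [hasFiniteIntegral_iff_ofReal hg0]
    exact h1.trans_lt ENNReal.ofReal_lt_top
  refine ⟨hgi, ?_⟩
  rw [← ofReal_integral_eq_lintegral_ofReal hgi hg0] at h1
  exact (ENNReal.ofReal_le_ofReal_iff hC0).1 h1

lemma Prof.exists_center {u : ℝ → ℝ} (h : Prof u) :
    ∃ c, (∀ x < 0, u (x + c) ≤ 1 / 2) ∧ ∀ x > 0, 1 / 2 ≤ u (x + c) := by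
  have hne : {x | u x < 1 / 2}.Nonempty :=
    (h.bot.eventually (gt_mem_nhds (by norm_num : (0:ℝ) < 1 / 2))).exists
  obtain ⟨b, hb⟩ := (h.top.eventually (lt_mem_nhds (by norm_num : (1:ℝ) / 2 < 1))).exists
  have hbdd : BddAbove {x | u x < 1 / 2} := ⟨b, fun x hx => by
    by_contra hxb
    have h1 : u b ≤ u x := h.mono (not_le.1 hxb).le
    have h2 : u x < 1 / 2 := hx
    linarith⟩
  refine ⟨sSup {x | u x < 1 / 2}, fun x hx => ?_, fun x hx => ?_⟩
  · obtain ⟨y, hy, hxy⟩ := exists_lt_of_lt_csSup hne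
      (show x + sSup {x | u x < 1 / 2} < sSup {x | u x < 1 / 2} by linarith)
    exact (h.mono hxy.le).trans (le_of_lt hy)
  · by_contra hlt
    have := le_csSup hbdd (show x + sSup {x | u x < 1 / 2} ∈ {x | u x < 1 / 2} from not_le.1 hlt)
    linarith

lemma energy_nonneg {s : ℝ} {J W u : ℝ → ℝ} (hJ : Ker s J) (hW : ∀ v, 0 ≤ W v) :
    0 ≤ energy J W u := by
  have h1 : 0 ≤ ∫ t, J t * sqInc u t :=
    integral_nonneg fun t => mul_nonneg (hJ.nonneg t) (sqInc_nonneg u t)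
  have h2 : 0 ≤ ∫ x, W (u x) := integral_nonneg fun x => hW _
  unfold energy
  linarith

section
variable {W W1 W2 W3 : ℝ → ℝ} {Λ r D : ℝ}

lemma Pot.adm_clamp (hW : Pot W W1 W2 W3 Λ r D) : Adm W (fun x => max 0 (min x 1)) where
  mono := fun x y hxy => max_le_max le_rfl (min_le_min hxy le_rfl)
  bot := tendsto_const_nhds.congr' (by
    filter_upwards [eventually_le_atBot (0:ℝ)] with x hx
    rw [min_eq_left (by linarith), max_eq_left hx])
  top := tendsto_const_nhds.congr' (by
    filter_upwards [eventually_ge_atTop (1:ℝ)] with x hx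
    rw [min_eq_right hx, max_eq_right zero_le_one])
  int := by
    refine Continuous.integrable_of_hasCompactSupport ?_ ?_
    · exact hW.cont.comp (by fun_prop)
    · refine HasCompactSupport.intro (K := Icc 0 1) isCompact_Icc fun x hx => ?_
      rcases lt_or_ge x 0 with h | h
      · rw [min_eq_left (by linarith), max_eq_left h.le, hW.zero]
      · have h1 : 1 < x := by
          by_contra h1
          exact hx ⟨h, not_lt.1 h1⟩
        rw [min_eq_right h1.le, max_eq_right zero_le_one, hW.one]

lemma Pot.eq_zero_of_tendsto (hW : Pot W W1 W2 W3 Λ r D)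
    {g : ℝ → ℝ} (hi : Integrable (fun x => W (g x))) {l : Filter ℝ} {a : ℝ}
    (hl : ∀ S ∈ l, volume S = ⊤) (hg : Tendsto g l (𝓝 a)) : W a = 0 := by
  by_contra hne
  have hpos : 0 < W a := lt_of_le_of_ne (hW.nonneg a) (Ne.symm hne)
  have hev : ∀ᶠ x in l, W a / 2 < W (g x) :=
    ((hW.cont.tendsto a).comp hg).eventually (lt_mem_nhds (by linarith))
  have h1 := hl _ hev
  have h2 := hi.measure_norm_ge_lt_top (half_pos hpos)
  have h3 : volume {x | W a / 2 < W (g x)} ≤ volume {x | W a / 2 ≤ ‖W (g x)‖} :=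
    measure_mono fun x hx => (le_of_lt hx).trans (le_norm_self _)
  rw [h1] at h3
  exact absurd (h3.trans_lt h2) (lt_irrefl _)

lemma Pot.adm_of_center (hW : Pot W W1 W2 W3 Λ r D)
    {g : ℝ → ℝ} (hg : Monotone g) (h01 : ∀ x, g x ∈ Icc (0:ℝ) 1)
    (hi : Integrable (fun x => W (g x))) (h0 : ∀ x < 0, g x ≤ 1 / 2) (h1 : ∀ x > 0, 1 / 2 ≤ g x) :
    Adm W g := by
  have ht := tendsto_atTop_ciSup hg ⟨1, by rintro _ ⟨x, rfl⟩; exact (h01 x).2⟩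
  have hb := tendsto_atBot_ciInf hg ⟨0, by rintro _ ⟨x, rfl⟩; exact (h01 x).1⟩
  have hT := hW.eq_zero_of_tendsto hi (fun S hS => by
    obtain ⟨a, ha⟩ := mem_atTop_sets.1 hS
    have := measure_mono (μ := volume) (show Ici a ⊆ S from ha)
    simpa using this) ht
  have hB := hW.eq_zero_of_tendsto hi (fun S hS => by
    obtain ⟨a, ha⟩ := mem_atBot_sets.1 hS
    have := measure_mono (μ := volume) (show Iic a ⊆ S from ha)
    simpa using this) hb
  have hTr : 1 / 2 ≤ ⨆ x, g x := ge_of_tendsto ht (by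
    filter_upwards [eventually_gt_atTop (0:ℝ)] with x hx using h1 x hx)
  have hTr' : ⨆ x, g x ≤ 1 := le_of_tendsto' ht fun x => (h01 x).2
  have hBr : ⨅ x, g x ≤ 1 / 2 := le_of_tendsto hb (by
    filter_upwards [eventually_lt_atBot (0:ℝ)] with x hx using h0 x hx)
  have hBr' : 0 ≤ ⨅ x, g x := ge_of_tendsto' hb fun x => (h01 x).1
  have eT : ⨆ x, g x = 1 := by
    by_contra hne
    exact (hW.pos _ ⟨by linarith, lt_of_le_of_ne hTr' hne⟩).ne' hT
  have eB : ⨅ x, g x = 0 := by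
    by_contra hne
    exact (hW.pos _ ⟨lt_of_le_of_ne hBr' (Ne.symm hne), by linarith⟩).ne' hB
  rw [eT] at ht
  rw [eB] at hb
  exact ⟨⟨hg, hb, ht⟩, hi⟩

lemma Pot.exists_minimizer (hW : Pot W W1 W2 W3 Λ r D) {s : ℝ} {J : ℝ → ℝ} (hJ : Ker s J) :
    ∃ u, Adm W u ∧ ∀ v, Adm W v → energy J W u ≤ energy J W v := by
  set A : Set ℝ := {e | ∃ u, Adm W u ∧ energy J W u = e} with hA
  have hAne : A.Nonempty := ⟨_, _, hW.adm_clamp, rfl⟩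
  have hAb : BddBelow A := ⟨0, by
    rintro _ ⟨u, _, rfl⟩
    exact energy_nonneg hJ hW.nonneg⟩
  have hseq : ∀ n : ℕ, ∃ u, Adm W u ∧ energy J W u < sInf A + 1 / ((n:ℝ) + 1) ∧
      (∀ x < 0, u x ≤ 1 / 2) ∧ ∀ x > 0, 1 / 2 ≤ u x := fun n => by
    obtain ⟨e, ⟨u, hu, rfl⟩, he⟩ := exists_lt_of_csInf_lt hAne
      (show sInf A < sInf A + 1 / ((n:ℝ) + 1) by linarith [Nat.one_div_pos_of_nat (α := ℝ) (n := n)])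
    obtain ⟨c, h0, h1⟩ := hu.exists_center
    exact ⟨_, hu.shift c, by rwa [energy_shift], h0, h1⟩
  choose u hu hlt h0 h1 using hseq
  have hE : Tendsto (fun n => energy J W (u n)) atTop (𝓝 (sInf A)) := by
    refine tendsto_of_tendsto_of_tendsto_of_le_of_le tendsto_const_nhds
      (h := fun n : ℕ => sInf A + 1 / ((n:ℝ) + 1)) ?_
      (fun n => csInf_le hAb ⟨_, hu n, rfl⟩) fun n => (hlt n).le
    simpa using tendsto_one_div_add_atTop_nhds_zero_nat.const_add (sInf A)
  have hP0 : ∀ n, 0 ≤ ∫ x, W (u n x) := fun n => integral_nonneg fun x => hW.nonneg _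
  have hK0 : ∀ n, 0 ≤ ∫ t, J t * sqInc (u n) t := fun n =>
    integral_nonneg fun t => mul_nonneg (hJ.nonneg t) (sqInc_nonneg _ t)
  have hPle : ∀ n, ∫ x, W (u n x) ≤ sInf A + 1 := fun n => by
    have h2 := (hlt n).le
    have h3 := hK0 n
    have h4 : 1 / ((n:ℝ) + 1) ≤ 1 := by
      rw [div_le_one (by positivity)]
      linarith [Nat.cast_nonneg (α := ℝ) n]
    unfold energy at h2
    linarith
  obtain ⟨P, -, φ, hφ, hP⟩ := (isCompact_Icc (a := (0:ℝ)) (b := sInf A + 1)).tendsto_subseq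
    (x := fun n => ∫ x, W (u n x)) fun n => ⟨hP0 n, hPle n⟩
  obtain ⟨ψ, hψ, g, hgm, hg⟩ := helly (f := fun n => u (φ n)) (fun n => (hu (φ n)).mono)
    (fun n x => (hu (φ n)).mem x)
  have hP' : Tendsto (fun n => ∫ x, W (u (φ (ψ n)) x)) atTop (𝓝 P) := hP.comp hψ.tendsto_atTop
  have hE' : Tendsto (fun n => energy J W (u (φ (ψ n)))) atTop (𝓝 (sInf A)) :=
    hE.comp (hφ.tendsto_atTop.comp hψ.tendsto_atTop)
  have hK : Tendsto (fun n => ∫ t, J t * sqInc (u (φ (ψ n))) t) atTop (𝓝 (4 * (sInf A - P))) := by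
    refine ((hE'.sub hP').const_mul 4).congr fun n => ?_
    unfold energy
    ring
  have hg01 : ∀ x, g x ∈ Icc (0:ℝ) 1 := fun x =>
    isClosed_Icc.mem_of_tendsto (hg x) (Eventually.of_forall fun n => (hu (φ (ψ n))).mem x)
  obtain ⟨hgi, hgP⟩ := fatou_real (fun n => (hu (φ (ψ n))).int) (fun n x => hW.nonneg _)
    (Eventually.of_forall fun x => (hW.cont.tendsto _).comp (hg x)) (fun n => le_rfl) hP'
  have hadm : Adm W g := hW.adm_of_center hgm hg01 hgi
    (fun x hx => le_of_tendsto' (hg x) fun n => h0 _ x hx)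
    (fun x hx => ge_of_tendsto' (hg x) fun n => h1 _ x hx)
  refine ⟨g, hadm, fun v hv => ?_⟩
  have hkin := (fatou_real (fun n => (hu (φ (ψ n))).integrable_prod_sq hJ)
    (fun n p => mul_nonneg (hJ.nonneg _) (sq_nonneg _))
    (Eventually.of_forall fun p => (((hg (p.2 + p.1)).sub (hg p.2)).pow 2).const_mul (J p.1))
    (fun n => ((hu (φ (ψ n))).integral_sqInc hJ).symm.le) hK).2
  rw [← hadm.integral_sqInc hJ] at hkin
  have : energy J W g ≤ sInf A := by
    unfold energy
    linarith
  exact this.trans (csInf_le hAb ⟨v, hv, rfl⟩)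

end

lemma contDiff_two_of_hasDerivAt {f f' f'' : ℝ → ℝ} (h : ∀ x, HasDerivAt f (f' x) x)
    (h' : ∀ x, HasDerivAt f' (f'' x) x) (hc : Continuous f'') : ContDiff ℝ 2 f := by
  have e : deriv f = f' := funext fun x => (h x).deriv
  have e' : deriv f' = f'' := funext fun x => (h' x).deriv
  rw [show (2 : WithTop ℕ∞) = 1 + 1 by norm_num, contDiff_succ_iff_deriv, e]
  refine ⟨fun x => (h x).differentiableAt, by simp, ?_⟩
  rw [contDiff_one_iff_deriv, e']
  exact ⟨fun x => (h' x).differentiableAt, hc⟩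

namespace Prof
variable {u : ℝ → ℝ} {s : ℝ} {J : ℝ → ℝ}

lemma norm_le_one (h : Prof u) (x : ℝ) : ‖u x‖ ≤ 1 := by
  rw [Real.norm_eq_abs, abs_of_nonneg (h.mem x).1]
  exact (h.mem x).2

lemma integrable_avg (h : Prof u) (hJ : Ker s J)
    (x : ℝ) : Integrable (fun t => J t * u (x + t)) := by
  have hm := h.measurable
  exact hJ.integrable.mul_bdd (c := 1) (by fun_prop : Measurable fun t => u (x + t)).aestronglyMeasurable
    (Eventually.of_forall fun t => h.norm_le_one _)

lemma opL_eq (h : Prof u) (hJ : Ker s J)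
    (x : ℝ) : opL J u x = (∫ t, J t * u (x + t)) - (∫ t, J t) * u x := by
  rw [← integral_mul_const, ← integral_sub (h.integrable_avg hJ x) (hJ.integrable.mul_const _)]
  simp only [opL, mul_sub]

lemma avg_mono (h : Prof u) (hJ : Ker s J) :
    Monotone (fun x => ∫ t, J t * u (x + t)) := fun x y hxy =>
  integral_mono (h.integrable_avg hJ x) (h.integrable_avg hJ y) fun t =>
    mul_le_mul_of_nonneg_left (h.mono (by linarith)) (hJ.nonneg t)

lemma avg_contDiff (h : Prof u) (hJ : Ker s J) : ContDiff ℝ 2 (fun x => ∫ t, J t * u (x + t)) := by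
  have := hJ.supp.contDiff_convolution_left (ContinuousLinearMap.mul ℝ ℝ) hJ.smooth
    (μ := volume) h.mono.locallyIntegrable
  have e : (fun x => ∫ t, J t * u (x + t))
      = convolution J u (ContinuousLinearMap.mul ℝ ℝ) volume := by
    funext x
    simp only [convolution, ContinuousLinearMap.mul_apply']
    exact (hJ.integral_reflect u x).symm
  rw [e]
  exact this

lemma avg_tendsto (h : Prof u) (hJ : Ker s J) {l : Filter ℝ} [l.IsCountablyGenerated] {a : ℝ}
    (hl : ∀ t, Tendsto (fun x => u (x + t)) l (𝓝 a)) :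
    Tendsto (fun x => ∫ t, J t * u (x + t)) l (𝓝 ((∫ t, J t) * a)) := by
  rw [← integral_mul_const]
  refine tendsto_integral_filter_of_dominated_convergence J
    (Eventually.of_forall fun x => (h.integrable_avg hJ x).1)
    (Eventually.of_forall fun x => Eventually.of_forall fun t => ?_) hJ.integrable
    (Eventually.of_forall fun t => (hl t).const_mul _)
  rw [norm_mul, Real.norm_eq_abs, abs_of_nonneg (hJ.nonneg t)]
  exact mul_le_of_le_one_right (hJ.nonneg t) (h.norm_le_one _)

lemma integrable_opL (h : Prof u) (hJ : Ker s J) :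
    Integrable (opL J u) := (h.integrable_prod hJ).integral_prod_right

lemma abs_opL_le (h : Prof u) (hJ : Ker s J) (x : ℝ) : |opL J u x| ≤ ∫ t, J t := by
  rw [← Real.norm_eq_abs]
  refine (norm_integral_le_of_norm_le (μ := volume) hJ.integrable (Eventually.of_forall fun t => ?_))
  rw [norm_mul, Real.norm_eq_abs, Real.norm_eq_abs, abs_of_nonneg (hJ.nonneg t)]
  exact mul_le_of_le_one_right (hJ.nonneg t) (h.abs_diff_le _ _)

end Prof

section
variable {W W1 W2 W3 : ℝ → ℝ} {Λ r D : ℝ} {s : ℝ} {J : ℝ → ℝ} {u : ℝ → ℝ}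

lemma Pot.residual_props (hW : Pot W W1 W2 W3 Λ r D) (hJ : Ker s J) (hu : Adm W u) :
    Measurable (fun x => opL J u x - W1 (u x)) ∧
    (∃ B, ∀ x, |opL J u x - W1 (u x)| ≤ B) ∧
    Integrable (fun x => (opL J u x - W1 (u x)) ^ 2) := by
  have hm := hu.measurable
  have h1 := hW.cont1.measurable
  have hoL : Measurable (opL J u) := by
    have : opL J u = fun x => (∫ t, J t * u (x + t)) - (∫ t, J t) * u x :=
      funext fun x => hu.opL_eq hJ x
    rw [this]
    exact (hu.avg_mono hJ).measurable.sub (hm.const_mul _)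
  have hg : Measurable (fun x => opL J u x - W1 (u x)) := hoL.sub (h1.comp hm)
  refine ⟨hg, ⟨(∫ t, J t) + Λ, fun x => ?_⟩, ?_⟩
  · have a1 := hu.abs_opL_le hJ x
    have a2 := hW.lip1 (u x) 0
    rw [hW.crit_zero, sub_zero, sub_zero, abs_of_nonneg (hu.mem x).1] at a2
    have a3 := mul_le_mul_of_nonneg_left (hu.mem x).2 hW.Λ_pos.le
    calc _ ≤ |opL J u x| + |W1 (u x)| := abs_sub _ _
      _ ≤ _ := by linarith
  · refine (((hu.integrable_opL hJ).abs.const_mul (2 * ∫ t, J t)).fun_add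
      (hu.int.const_mul (8 * Λ))).mono' (hg.pow_const 2).aestronglyMeasurable
      (Eventually.of_forall fun x => ?_)
    rw [Real.norm_eq_abs, abs_of_nonneg (sq_nonneg _)]
    have a1 := hu.abs_opL_le hJ x
    have a2 := hW.sq_W1_le (u x)
    have a3 := mul_le_mul_of_nonneg_right a1 (abs_nonneg (opL J u x))
    rw [abs_mul_abs_self] at a3
    nlinarith [sq_nonneg (opL J u x + W1 (u x))]

lemma Pot.adm_step (hW : Pot W W1 W2 W3 Λ r D) (hJ : Ker s J) (hu : Adm W u)
    {τ : ℝ} (hτ : 0 ≤ τ) (hτ1 : τ * ((∫ t, J t) + Λ) ≤ 1) :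
    Adm W (fun x => u x + τ * (opL J u x - W1 (u x))) := by
  obtain ⟨hgm, -, hg2⟩ := hW.residual_props hJ hu
  have hm := hu.measurable
  have key : ∀ {l : Filter ℝ} [l.IsCountablyGenerated] {a : ℝ}, W1 a = 0 → Tendsto u l (𝓝 a) →
      (∀ t, Tendsto (fun x => u (x + t)) l (𝓝 a)) →
      Tendsto (fun x => u x + τ * (opL J u x - W1 (u x))) l (𝓝 a) := by
    intro l _ a ha h0 ht
    have e : (fun x => u x + τ * (opL J u x - W1 (u x)))
        = fun x => u x + τ * ((∫ t, J t * u (x + t)) - (∫ t, J t) * u x - W1 (u x)) := by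
      funext x; rw [hu.opL_eq hJ x]
    rw [e]
    have := h0.add ((((hu.avg_tendsto hJ ht).sub (h0.const_mul (∫ t, J t))).sub
      ((hW.cont1.tendsto a).comp h0)).const_mul τ)
    simpa [ha] using this
  refine ⟨⟨fun x y hxy => ?_, key hW.crit_zero hu.bot fun t => (hu.shift t).bot,
    key hW.crit_one hu.top fun t => (hu.shift t).top⟩, ?_⟩
  · simp only [hu.opL_eq hJ]
    have h1 : (∫ t, J t * u (x + t)) ≤ ∫ t, J t * u (y + t) := hu.avg_mono hJ hxy
    have h2 := hu.mono hxy
    have h3 := (abs_le.1 (hW.lip1 (u y) (u x))).2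
    rw [abs_of_nonneg (sub_nonneg.2 h2)] at h3
    have h4 := mul_le_mul_of_nonneg_left h3 hτ
    have h5 := mul_le_mul_of_nonneg_left h1 hτ
    have h6 := mul_le_mul_of_nonneg_right hτ1 (sub_nonneg.2 h2)
    nlinarith
  · have hWm : Measurable fun x => W (u x + τ * (opL J u x - W1 (u x))) :=
      hW.cont.measurable.comp (hm.add (hgm.const_mul τ))
    refine ((hu.int.const_mul (1 + 4 * Λ)).fun_add (hg2.const_mul (τ ^ 2 + Λ * τ ^ 2))).mono'
      hWm.aestronglyMeasurable (Eventually.of_forall fun x => ?_)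
    rw [Real.norm_eq_abs, abs_of_nonneg (hW.nonneg _)]
    have a1 := hW.taylor_le (u x) (u x + τ * (opL J u x - W1 (u x)))
    have a2 := hW.sq_W1_le (u x)
    rw [add_sub_cancel_left] at a1
    nlinarith [sq_nonneg (W1 (u x) - τ * (opL J u x - W1 (u x))),
      sq_nonneg (W1 (u x)), sq_nonneg (τ * (opL J u x - W1 (u x)))]

end

lemma integrable_fun_sub {α : Type*} [MeasurableSpace α] {μ : Measure α} {f g : α → ℝ}
    (hf : Integrable f μ) (hg : Integrable g μ) : Integrable (fun x => f x - g x) μ := hf.sub hg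

section
variable {u : ℝ → ℝ} {g : ℝ → ℝ} {B : ℝ}

lemma Prof.integrable_diff_mul (h : Prof u) (hg : Measurable g) (hB : ∀ x, |g x| ≤ B)
    (t : ℝ) : Integrable (fun x => (u (x + t) - u x) * g x) :=
  (h.integrable_diff t).mul_bdd hg.aestronglyMeasurable (Eventually.of_forall hB)

lemma Prof.integral_diff_mul (h : Prof u) (hg : Measurable g) (hB : ∀ x, |g x| ≤ B)
    {s : ℝ} {J : ℝ → ℝ} (hJ : Ker s J) :
    Integrable (fun t => J t * ∫ x, (u (x + t) - u x) * g x) ∧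
    Integrable (fun x => opL J u x * g x) ∧
    ∫ t, J t * ∫ x, (u (x + t) - u x) * g x = ∫ x, opL J u x * g x := by
  have hF : Integrable (fun p : ℝ × ℝ => J p.1 * (u (p.2 + p.1) - u p.2) * g p.2)
      (volume.prod volume) :=
    (h.integrable_prod hJ).mul_bdd (hg.comp measurable_snd).aestronglyMeasurable
      (Eventually.of_forall fun p => hB p.2)
  have e1 : ∀ t, ∫ x, J t * (u (x + t) - u x) * g x = J t * ∫ x, (u (x + t) - u x) * g x :=
    fun t => by simp only [mul_assoc, integral_const_mul]
  have e2 : ∀ x, ∫ t, J t * (u (x + t) - u x) * g x = opL J u x * g x :=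
    fun x => by rw [integral_mul_const, opL]
  have h1 := hF.integral_prod_left
  have h2 := hF.integral_prod_right
  have h3 := integral_integral_swap (f := fun t x => J t * (u (x + t) - u x) * g x) hF
  simp only [e1] at h1 h3
  simp only [e2] at h2 h3
  exact ⟨h1, h2, h3⟩

lemma Prof.sqInc_step (h : Prof u) (hg : Measurable g) (hB : ∀ x, |g x| ≤ B)
    {τ : ℝ} (hg2 : Integrable (fun x => g x ^ 2)) (t : ℝ) :
    sqInc (fun x => u x + τ * g x) t ≤ sqInc u t
      - 2 * τ * ((∫ x, (u (x + t) - u x) * g x) + ∫ x, (u (x + -t) - u x) * g x)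
      + 4 * τ ^ 2 * ∫ x, g x ^ 2 := by
  have i1 := h.integrable_sq t
  have i2 := h.integrable_diff_mul hg hB t
  have i3 := (h.integrable_diff_mul hg hB (-t)).comp_add_right t
  have i4 := hg2.comp_add_right t
  have e3 : ∫ x, (u (x + -t) - u x) * g x = ∫ x, (u (x + t + -t) - u (x + t)) * g (x + t) :=
    (integral_add_right_eq_self (fun x => (u (x + -t) - u x) * g x) t).symm
  have e4 : ∫ x, g x ^ 2 = ∫ x, g (x + t) ^ 2 :=
    (integral_add_right_eq_self (fun x => g x ^ 2) t).symm
  have key : sqInc (fun x => u x + τ * g x) t ≤ ∫ x, ((u (x + t) - u x) ^ 2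
      - 2 * τ * ((u (x + t) - u x) * g x + (u (x + t + -t) - u (x + t)) * g (x + t))
      + 2 * τ ^ 2 * (g x ^ 2 + g (x + t) ^ 2)) := by
    refine integral_mono_of_nonneg (Eventually.of_forall fun x => sq_nonneg _)
      ((integrable_fun_sub i1 ((i2.fun_add i3).const_mul _)).fun_add ((hg2.fun_add i4).const_mul _))
      (Eventually.of_forall fun x => ?_)
    have : x + t + -t = x := by ring
    simp only [this]
    nlinarith [mul_nonneg (sq_nonneg τ) (sq_nonneg (g (x + t) + g x))]
  rw [integral_add (integrable_fun_sub i1 ((i2.fun_add i3).const_mul _)) ((hg2.fun_add i4).const_mul _),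
    integral_sub i1 ((i2.fun_add i3).const_mul _), integral_const_mul, integral_const_mul,
    integral_add i2 i3, integral_add hg2 i4, ← e3, ← e4] at key
  unfold sqInc at key ⊢
  linarith

end

section
variable {W W1 W2 W3 : ℝ → ℝ} {Λ r D : ℝ} {s : ℝ} {J : ℝ → ℝ} {u : ℝ → ℝ}

lemma Pot.energy_step (hW : Pot W W1 W2 W3 Λ r D) (hJ : Ker s J) (hu : Adm W u)
    {τ : ℝ} (hτ : 0 ≤ τ) (hτ1 : τ * ((∫ t, J t) + Λ) ≤ 1) :
    energy J W (fun x => u x + τ * (opL J u x - W1 (u x))) ≤ energy J W u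
      - τ * (1 - τ * ((∫ t, J t) + Λ)) * ∫ x, (opL J u x - W1 (u x)) ^ 2 := by
  have hv := hW.adm_step hJ hu hτ hτ1
  obtain ⟨hgm, ⟨B, hB⟩, hg2⟩ := hW.residual_props hJ hu
  obtain ⟨f1, f2, f3⟩ := hu.integral_diff_mul hgm hB hJ
  obtain ⟨g, hg⟩ : ∃ g : ℝ → ℝ, ∀ x, opL J u x - W1 (u x) = g x := ⟨_, fun x => rfl⟩
  simp only [hg] at hv hgm hB hg2 f1 f2 f3 ⊢
  have f1' : Integrable (fun t => J t * ∫ x, (u (x + -t) - u x) * g x) := by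
    have := f1.comp_neg
    simpa only [hJ.even] using this
  have f3' : ∫ t, J t * ∫ x, (u (x + -t) - u x) * g x = ∫ x, opL J u x * g x := by
    rw [← f3, ← integral_neg_eq_self (fun t => J t * ∫ x, (u (x + t) - u x) * g x)]
    simp only [hJ.even]
  have k1 : ∫ t, J t * sqInc (fun x => u x + τ * g x) t ≤ ∫ t, (J t * sqInc u t
      - 2 * τ * ((J t * ∫ x, (u (x + t) - u x) * g x) + J t * ∫ x, (u (x + -t) - u x) * g x)
      + J t * (4 * τ ^ 2 * ∫ x, g x ^ 2)) := by
    refine integral_mono (hv.integrable_sqInc hJ) ((integrable_fun_sub (hu.integrable_sqInc hJ)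
      ((f1.fun_add f1').const_mul _)).fun_add (hJ.integrable.mul_const _)) fun t => ?_
    have := mul_le_mul_of_nonneg_left (hu.sqInc_step hgm hB (τ := τ) hg2 t) (hJ.nonneg t)
    simp only
    linarith
  rw [integral_add (integrable_fun_sub (hu.integrable_sqInc hJ) ((f1.fun_add f1').const_mul _))
    (hJ.integrable.mul_const _), integral_sub (hu.integrable_sqInc hJ)
    ((f1.fun_add f1').const_mul _), integral_const_mul, integral_add f1 f1', f3, f3',
    integral_mul_const] at k1
  have i5 : Integrable (fun x => W1 (u x) * g x) :=
    (f2.sub hg2).congr (Eventually.of_forall fun x => by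
      simp only [Pi.sub_apply, ← hg]; ring)
  have e5 : ∫ x, W1 (u x) * g x = (∫ x, opL J u x * g x) - ∫ x, g x ^ 2 := by
    rw [← integral_sub f2 hg2]
    congr 1; ext x; simp only [← hg]; ring
  have k2 : ∫ x, W (u x + τ * g x) ≤ ∫ x, (W (u x) + τ * (W1 (u x) * g x)
      + Λ * τ ^ 2 * g x ^ 2) := by
    refine integral_mono hv.int ((hu.int.fun_add (i5.const_mul _)).fun_add (hg2.const_mul _))
      fun x => ?_
    have := hW.taylor_le (u x) (u x + τ * g x)
    rw [add_sub_cancel_left] at this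
    simp only
    linarith
  rw [integral_add (hu.int.fun_add (i5.const_mul _)) (hg2.const_mul _),
    integral_add hu.int (i5.const_mul _), integral_const_mul, integral_const_mul, e5] at k2
  unfold energy
  linarith

lemma Pot.euler_lagrange_ae (hW : Pot W W1 W2 W3 Λ r D) (hJ : Ker s J) (hu : Adm W u)
    (hmin : ∀ v, Adm W v → energy J W u ≤ energy J W v) :
    ∀ᵐ x, opL J u x = W1 (u x) := by
  have hM := hJ.mass_nonneg
  have hΛ := hW.Λ_pos
  have hpos : 0 < (∫ t, J t) + Λ := by linarith
  set τ := 1 / (2 * ((∫ t, J t) + Λ)) with hτ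
  have hτ0 : 0 < τ := by positivity
  have hτ1 : τ * ((∫ t, J t) + Λ) = 1 / 2 := by rw [hτ]; field_simp
  have h1 := hW.energy_step hJ hu hτ0.le (by rw [hτ1]; norm_num)
  have h2 := hmin _ (hW.adm_step hJ hu hτ0.le (by rw [hτ1]; norm_num))
  rw [hτ1] at h1
  have hg2 := (hW.residual_props hJ hu).2.2
  have h3 : ∫ x, (opL J u x - W1 (u x)) ^ 2 = 0 := by
    refine le_antisymm ?_ (integral_nonneg fun x => sq_nonneg _)
    by_contra hlt
    have := mul_pos hτ0 (not_le.1 hlt)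
    linarith
  rw [integral_eq_zero_iff_of_nonneg (fun x => sq_nonneg _) hg2] at h3
  filter_upwards [h3] with x hx
  have : (opL J u x - W1 (u x)) ^ 2 = 0 := hx
  exact sub_eq_zero.1 (pow_eq_zero_iff two_ne_zero |>.1 this)

end

lemma monotone_eq_of_ae_eq {p h : ℝ → ℝ} (hp : Monotone p) (hh : Continuous h)
    (hae : ∀ᵐ x, p x = h x) : p = h := by
  have hd : Dense {x | p x = h x} := Measure.dense_of_ae hae
  funext x
  refine le_antisymm ?_ ?_
  · by_contra hlt
    obtain ⟨ε, hε, hb⟩ := Metric.eventually_nhds_iff.1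
      ((hh.tendsto x).eventually (gt_mem_nhds (not_le.1 hlt)))
    obtain ⟨y, hy, hy1, hy2⟩ := hd.exists_between (show x < x + ε by linarith)
    have h1 := hb (y := y) (by rw [Real.dist_eq, abs_of_pos (by linarith)]; linarith)
    have h2 : p y = h y := hy
    have h3 := hp hy1.le
    linarith
  · by_contra hlt
    obtain ⟨ε, hε, hb⟩ := Metric.eventually_nhds_iff.1
      ((hh.tendsto x).eventually (lt_mem_nhds (not_le.1 hlt)))
    obtain ⟨y, hy, hy1, hy2⟩ := hd.exists_between (show x - ε < x by linarith)
    have h1 := hb (y := y) (by rw [Real.dist_eq, abs_of_neg (by linarith)]; linarith)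
    have h2 : p y = h y := hy
    have h3 := hp hy2.le
    linarith

section
variable {W W1 W2 W3 : ℝ → ℝ} {Λ r D : ℝ} {s : ℝ} {J : ℝ → ℝ}

/-- A minimiser is smooth and solves the Euler-Lagrange equation. -/
lemma Pot.sol_of_minimizer (hW : Pot W W1 W2 W3 Λ r D) (hJ : Ker s J)
    (hM : Λ < ∫ t, J t) {u : ℝ → ℝ} (hu : Adm W u)
    (hmin : ∀ v, Adm W v → energy J W u ≤ energy J W v) :
    Sol J W1 u (deriv u) (deriv (deriv u)) := by
  set M := ∫ t, J t with hMdef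
  set P : ℝ → ℝ := fun p => M * p + W1 p with hP
  have hPd : ∀ p, HasDerivAt P (M + W2 p) p := fun p =>
    (((hasDerivAt_id' p).const_mul M).fun_add (hW.hd2 p)).congr_deriv (by ring)
  have hpos : ∀ p, M - Λ ≤ M + W2 p := fun p => by linarith [(abs_le.1 (hW.b2 p)).1]
  have hmono : StrictMono P := strictMono_of_hasDerivAt_pos hPd fun p => by linarith [hpos p]
  have hcont : Continuous P := continuous_iff_continuousAt.2 fun p => (hPd p).continuousAt
  have hlip : ∀ p, (M - Λ) * |p| ≤ |P p - P 0| := fun p => by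
    have h1 := hW.lip1 p 0
    rw [sub_zero] at h1
    have h2 : P p - P 0 = M * p + (W1 p - W1 0) := by simp only [hP]; ring
    have h3 : |M * p| = M * |p| := by rw [abs_mul, abs_of_pos (by linarith [hW.Λ_pos])]
    have h4 : |M * p| ≤ |M * p + (W1 p - W1 0)| + |W1 p - W1 0| := by
      have := abs_sub (M * p + (W1 p - W1 0)) (W1 p - W1 0)
      rwa [add_sub_cancel_right] at this
    rw [h2]
    linarith
  have hsurj : Function.Surjective P := by
    refine hcont.surjective ?_ ?_
    · have : Tendsto (fun p => P 0 + (M - Λ) * p) atTop atTop :=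
        tendsto_atTop_add_const_left _ _ (tendsto_id.const_mul_atTop (by linarith))
      refine tendsto_atTop_mono' _ ?_ this
      filter_upwards [eventually_ge_atTop 0] with p hp
      have h1 := hlip p
      rw [abs_of_nonneg hp, abs_of_nonneg (sub_nonneg.2 (hmono.monotone hp))] at h1
      linarith
    · have : Tendsto (fun p => P 0 + (M - Λ) * p) atBot atBot :=
        tendsto_atBot_add_const_left _ _ (tendsto_id.const_mul_atBot (by linarith))
      refine tendsto_atBot_mono' _ ?_ this
      filter_upwards [eventually_le_atBot 0] with p hp
      have h1 := hlip p
      rw [abs_of_nonpos hp, abs_of_nonpos (sub_nonpos.2 (hmono.monotone hp))] at h1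
      linarith
  let e : ℝ ≃ₜ ℝ := (hmono.orderIsoOfSurjective P hsurj).toHomeomorph
  have heP : ∀ p, e p = P p := fun p => rfl
  have hPu : (fun x => P (u x)) = fun x => ∫ t, J t * u (x + t) := by
    refine monotone_eq_of_ae_eq (hmono.monotone.comp hu.mono)
      (hu.avg_contDiff hJ).continuous ?_
    filter_upwards [hW.euler_lagrange_ae hJ hu hmin] with x hx
    rw [hu.opL_eq hJ] at hx
    simp only [hP]
    linarith
  have hue : u = fun x => e.symm (∫ t, J t * u (x + t)) := by
    funext x
    rw [← congrFun hPu x, ← heP, e.symm_apply_apply]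
  have hP2 : ContDiff ℝ 2 P :=
    contDiff_two_of_hasDerivAt hPd (fun p => (hW.hd3 p).const_add M) hW.c3
  have hu2 : ContDiff ℝ 2 u := by
    rw [hue]
    exact (e.contDiff_symm_deriv (fun p => by linarith [hpos p]) hPd hP2).comp (hu.avg_contDiff hJ)
  have hu1 : ContDiff ℝ 1 (deriv u) := by
    have := (contDiff_succ_iff_deriv (n := 1) (f := u)).1 (by norm_num; exact hu2)
    exact this.2.2
  refine ⟨fun x => (hu2.differentiable (by norm_num) x).hasDerivAt,
    fun x => (hu1.differentiable (by norm_num) x).hasDerivAt,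
    hu1.continuous_deriv le_rfl, fun x => ?_, hu.mem, fun x => hu.mono.deriv_nonneg⟩
  have := congrFun hPu x
  rw [hu.opL_eq hJ, ← this]
  simp only [hP]
  ring

lemma Pot.exists_sol (hW : Pot W W1 W2 W3 Λ r D) (hJ : Ker s J) (hM : Λ < ∫ t, J t) :
    ∃ u v w, Sol J W1 u v w ∧ Adm W u ∧ (∀ v, Adm W v → energy J W u ≤ energy J W v) ∧
      u 0 = 1 / 2 := by
  obtain ⟨u, hu, hmin⟩ := hW.exists_minimizer hJ
  have hsol := hW.sol_of_minimizer hJ hM hu hmin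
  have hc : Continuous u := continuous_iff_continuousAt.2 fun x => (hsol.hu x).continuousAt
  obtain ⟨a, ha⟩ := (hu.bot.eventually (gt_mem_nhds (by norm_num : (0:ℝ) < 1 / 2))).exists
  obtain ⟨b, hb⟩ := (hu.top.eventually (lt_mem_nhds (by norm_num : (1:ℝ) / 2 < 1))).exists
  obtain ⟨c, hcc⟩ := mem_range_of_exists_le_of_exists_ge hc ⟨a, ha.le⟩ ⟨b, hb.le⟩
  have hmin' : ∀ v, Adm W v → energy J W (fun x => u (x + c)) ≤ energy J W v := fun v hv => by
    rw [energy_shift]; exact hmin v hv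
  exact ⟨_, _, _, hW.sol_of_minimizer hJ hM (hu.shift c) hmin', hu.shift c, hmin', by
    simp only [zero_add]; exact hcc⟩

end

lemma sqInc_even (u : ℝ → ℝ) (t : ℝ) : sqInc u (-t) = sqInc u t := by
  unfold sqInc
  rw [← integral_add_right_eq_self (fun x => (u (x + -t) - u x) ^ 2) t]
  congr 1; ext x
  rw [add_neg_cancel_right]; ring

lemma sqInc_abs (u : ℝ → ℝ) (t : ℝ) : sqInc u |t| = sqInc u t := by
  rcases abs_choice t with h | h <;> rw [h]
  exact sqInc_even u t

lemma integral_split {f : ℝ → ℝ} (hf : Integrable f) (p q : ℝ) :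
    ∫ x, f x = (∫ x in Iic p, f x) + (∫ x in p..q, f x) + ∫ x in Ioi q, f x := by
  have h1 := intervalIntegral.integral_Iic_add_Ioi (b := p) hf.integrableOn hf.integrableOn
  have h2 := intervalIntegral.integral_interval_add_Ioi (a := p) (b := q) hf.integrableOn
    hf.integrableOn
  linarith

/-- Integral bound for a function obtained from `f` by deleting an interval of length `a`. -/
lemma cut_integral {f F : ℝ → ℝ} {p q a Q : ℝ} (hf : Integrable f) (hf0 : ∀ x, 0 ≤ f x)
    (hF0 : ∀ x, 0 ≤ F x) (hFm : AEStronglyMeasurable F) (hpq : p < q) (hQ : 0 ≤ Q)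
    (h1 : ∀ x ≤ p, F x = f x) (h2 : ∀ x, q ≤ x → F x = f (x + a))
    (h3 : ∀ x, p < x → x < q → F x ≤ Q) :
    Integrable F ∧ ∫ x, F x ≤ (∫ x, f x) - (∫ x in p..(q + a), f x) + (q - p) * Q := by
  have i1 : Integrable ((Iic p).indicator f) := hf.indicator measurableSet_Iic
  have i2 : Integrable ((Ioc p q).indicator fun _ : ℝ => Q) :=
    (integrableOn_const (by simp)).integrable_indicator measurableSet_Ioc
  have i3 : Integrable ((Ioi (q + a)).indicator f) := hf.indicator measurableSet_Ioi
  have i3' := i3.comp_add_right a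
  have hG : Integrable fun x => (Iic p).indicator f x + (Ioc p q).indicator (fun _ : ℝ => Q) x
      + (Ioi (q + a)).indicator f (x + a) := (i1.fun_add i2).fun_add i3'
  have hle : ∀ᵐ x, F x ≤ (Iic p).indicator f x + (Ioc p q).indicator (fun _ : ℝ => Q) x
      + (Ioi (q + a)).indicator f (x + a) := by
    filter_upwards [Measure.ae_ne volume q] with x hx
    have n1 := indicator_nonneg (s := Iic p) (fun x _ => hf0 x) x
    have n2 := indicator_nonneg (s := Ioc p q) (f := fun _ : ℝ => Q) (fun x _ => hQ) x
    have n3 := indicator_nonneg (s := Ioi (q + a)) (fun x _ => hf0 x) (x + a)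
    rcases le_or_gt x p with hxp | hxp
    · rw [h1 x hxp]
      rw [indicator_of_mem (mem_Iic.2 hxp)] at n1 ⊢
      linarith
    rcases lt_or_gt_of_ne hx with hxq | hxq
    · have := h3 x hxp hxq
      rw [indicator_of_mem (show x ∈ Ioc p q from ⟨hxp, hxq.le⟩)]
      linarith
    · rw [h2 x hxq.le]
      rw [indicator_of_mem (show x + a ∈ Ioi (q + a) from add_lt_add_left hxq a)]
      linarith
  have hFi : Integrable F := hG.mono' hFm (by
    filter_upwards [hle] with x hx
    rwa [Real.norm_eq_abs, abs_of_nonneg (hF0 x)])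
  refine ⟨hFi, (integral_mono_ae hFi hG hle).trans (le_of_eq ?_)⟩
  rw [integral_add (i1.fun_add i2) i3', integral_add i1 i2,
    integral_add_right_eq_self (fun x => (Ioi (q + a)).indicator f x) a,
    integral_indicator measurableSet_Iic, integral_indicator measurableSet_Ioi,
    integral_indicator measurableSet_Ioc, setIntegral_const, integral_split hf p (q + a)]
  simp [Measure.real, Real.volume_Ioc, hpq.le]
  ring

/-- Delete an interval of length `a` from a profile. -/
def cut (u : ℝ → ℝ) (a x : ℝ) : ℝ := u x + max 0 (min x 1) * (u (x + a) - u x)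

lemma cut_of_nonpos (u : ℝ → ℝ) (a : ℝ) {x : ℝ} (hx : x ≤ 0) : cut u a x = u x := by
  unfold cut
  rw [min_eq_left (by linarith), max_eq_left hx]; ring

lemma cut_of_one_le (u : ℝ → ℝ) (a : ℝ) {x : ℝ} (hx : 1 ≤ x) : cut u a x = u (x + a) := by
  unfold cut
  rw [min_eq_right hx, max_eq_right zero_le_one]; ring

lemma clamp_mem (x : ℝ) : max 0 (min x 1) ∈ Icc (0:ℝ) 1 :=
  ⟨le_max_left _ _, max_le zero_le_one (min_le_right _ _)⟩

lemma clamp_lip {x y : ℝ} (h : x ≤ y) :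
    max 0 (min x 1) ≤ max 0 (min y 1) ∧ max 0 (min y 1) - max 0 (min x 1) ≤ y - x := by
  refine ⟨max_le_max le_rfl (min_le_min h le_rfl), ?_⟩
  simp only [min_def, max_def]
  split_ifs <;> linarith

section
variable {u : ℝ → ℝ} {a : ℝ}

lemma Prof.cut (h : Prof u) (ha : 0 ≤ a) : Prof (cut u a) where
  mono := fun x y hxy => by
    have h1 := h.mono hxy
    have h2 := h.mono (show x + a ≤ y + a by linarith)
    have h3 := h.mono (show x ≤ x + a by linarith)
    have h4 := (clamp_lip hxy).1
    have h5 := clamp_mem y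
    have h6 := clamp_mem x
    unfold FracLayer.cut
    nlinarith [h5.1, h5.2, h6.1, mul_le_mul_of_nonneg_right h4 (sub_nonneg.2 h3),
      mul_nonneg h5.1 (sub_nonneg.2 h2), mul_nonneg (sub_nonneg.2 h5.2) (sub_nonneg.2 h1)]
  bot := h.bot.congr' (by
    filter_upwards [eventually_le_atBot (0:ℝ)] with x hx
    rw [cut_of_nonpos u a hx])
  top := (h.shift a).top.congr' (by
    filter_upwards [eventually_ge_atTop (1:ℝ)] with x hx
    rw [cut_of_one_le u a hx])

lemma Prof.cut_lip (h : Prof u) (ha : 0 ≤ a)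
    {C1 : ℝ} (hl : ∀ x y, |u x - u y| ≤ C1 * |x - y|) {x y : ℝ} (hxy : x ≤ y) :
    FracLayer.cut u a y - FracLayer.cut u a x ≤ (C1 + 1) * (y - x) := by
  have h1 := (le_abs_self _).trans (hl y x)
  have h2 := (le_abs_self _).trans (hl (y + a) (x + a))
  rw [add_sub_add_right_eq_sub] at h2
  rw [abs_of_nonneg (sub_nonneg.2 hxy)] at h1 h2
  have h4 := clamp_lip hxy
  have h5 := clamp_mem y
  have h3 := h.mono (show x ≤ x + a by linarith)
  have h7 : u (x + a) - u x ≤ 1 := (le_abs_self _).trans (h.abs_diff_le _ _)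
  unfold FracLayer.cut
  nlinarith [h5.1, h5.2, mul_le_mul_of_nonneg_left h2 h5.1,
    mul_le_mul_of_nonneg_left h1 (sub_nonneg.2 h5.2),
    mul_le_mul h4.2 h7 (sub_nonneg.2 h3) (sub_nonneg.2 hxy)]

lemma Prof.sqInc_cut_le (h : Prof u) (ha : 0 ≤ a)
    {C1 : ℝ} (hl : ∀ x y, |u x - u y| ≤ C1 * |x - y|) {t : ℝ} (ht : 0 ≤ t) :
    sqInc (FracLayer.cut u a) t ≤ sqInc u t + (1 + t) * min 1 ((C1 + 1) ^ 2 * t ^ 2) := by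
  have hc := h.cut ha
  have hQ : 0 ≤ min 1 ((C1 + 1) ^ 2 * t ^ 2) := le_min zero_le_one (by positivity)
  have := (cut_integral (f := fun x => (u (x + t) - u x) ^ 2)
    (F := fun x => (FracLayer.cut u a (x + t) - FracLayer.cut u a x) ^ 2)
    (p := -t) (q := 1) (a := a) (h.integrable_sq t) (fun x => sq_nonneg _) (fun x => sq_nonneg _)
    (hc.integrable_sq t).1 (by linarith) hQ
    (fun x hx => by rw [cut_of_nonpos u a (by linarith), cut_of_nonpos u a (by linarith)])
    (fun x hx => by
      rw [cut_of_one_le u a (by linarith), cut_of_one_le u a (by linarith), add_right_comm])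
    (fun x _ _ => by
      have h0 := hc.mono (show x ≤ x + t by linarith)
      have h1 : FracLayer.cut u a (x + t) - FracLayer.cut u a x ≤ 1 :=
        (le_abs_self _).trans (hc.abs_diff_le _ _)
      have h2 := h.cut_lip ha hl (show x ≤ x + t by linarith)
      rw [add_sub_cancel_left] at h2
      refine le_min ?_ ?_
      · nlinarith
      · rw [← mul_pow]
        exact pow_le_pow_left₀ (by linarith) h2 2)).2
  have h0 : 0 ≤ ∫ x in (-t)..(1 + a), (u (x + t) - u x) ^ 2 :=
    intervalIntegral.integral_nonneg (by linarith) fun x _ => sq_nonneg _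
  unfold sqInc
  linarith

lemma Prof.sqInc_cut_le' (h : Prof u) (ha : 0 ≤ a)
    {t : ℝ} : sqInc (FracLayer.cut u a) t ≤ sqInc u t + 4 * a := by
  have hc := h.cut ha
  have i1 := h.integrable_sq t
  have i2 := h.integrable_diff a
  have i3 := i2.comp_add_right t
  have h0 : ∫ x, (u (x + a) - u x) ≤ a := (h.integrable_diff_aux ha).2
  have e : ∫ x, (u (x + t + a) - u (x + t)) = ∫ x, (u (x + a) - u x) :=
    integral_add_right_eq_self (fun x => u (x + a) - u x) t
  have key : sqInc (FracLayer.cut u a) t ≤ ∫ x, ((u (x + t) - u x) ^ 2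
      + 2 * ((u (x + t + a) - u (x + t)) + (u (x + a) - u x))) := by
    refine integral_mono (hc.integrable_sq t) (i1.fun_add ((i3.fun_add i2).const_mul 2)) fun x => ?_
    have b1 := abs_le.1 (hc.abs_diff_le (x + t) x)
    have b2 := abs_le.1 (h.abs_diff_le (x + t) x)
    have d : ∀ y, 0 ≤ FracLayer.cut u a y - u y ∧ FracLayer.cut u a y - u y ≤ u (y + a) - u y :=
      fun y => by
        have h1 := clamp_mem y
        have h3 := sub_nonneg.2 (h.mono (show y ≤ y + a by linarith))
        unfold FracLayer.cut
        rw [add_sub_cancel_left]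
        exact ⟨mul_nonneg h1.1 h3, mul_le_of_le_one_left h3 h1.2⟩
    have d1 := d x
    have d2 := d (x + t)
    simp only
    generalize FracLayer.cut u a (x + t) = p at *
    generalize FracLayer.cut u a x = q at *
    have hd : |(p - q) - (u (x + t) - u x)| ≤
        (u (x + t + a) - u (x + t)) + (u (x + a) - u x) := abs_le.2 ⟨by linarith, by linarith⟩
    have hs : |(p - q) + (u (x + t) - u x)| ≤ 2 := abs_le.2 ⟨by linarith, by linarith⟩
    have hm := mul_le_mul hd hs (abs_nonneg _) ((abs_nonneg _).trans hd)
    rw [← abs_mul] at hm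
    have := (le_abs_self _).trans hm
    nlinarith
  rw [integral_add i1 ((i3.fun_add i2).const_mul 2), integral_const_mul, integral_add i3 i2, e] at key
  unfold sqInc at key ⊢
  linarith

end

/-- Majorant of the kinetic energy gained by cutting, divided by the length `a`. -/
def cutF (s L a t : ℝ) : ℝ := pk s t * min ((1 + |t|) * min 1 (L * t ^ 2) / a) 4

lemma cutF_nonneg {s L a : ℝ} (hL : 0 ≤ L) (ha : 0 < a) (t : ℝ) : 0 ≤ cutF s L a t := by
  have : 0 ≤ min 1 (L * t ^ 2) := le_min zero_le_one (by positivity)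
  exact mul_nonneg (pk_nonneg s t) (le_min (by positivity) (by norm_num))

lemma cutF_le {s L a : ℝ} (hL : 0 ≤ L) (ha : 1 ≤ a) (t : ℝ) :
    cutF s L a t ≤ (2 * L + 4) * mk s t := by
  have hp := pk_nonneg s t
  unfold cutF mk
  rw [← mul_assoc, mul_comm]
  refine mul_le_mul_of_nonneg_right ?_ hp
  rcases le_total |t| 1 with h | h
  · have ht2 : t ^ 2 ≤ 1 := by rw [← sq_abs]; exact pow_le_one₀ (abs_nonneg t) h
    rw [min_eq_left ht2]
    refine (min_le_left _ _).trans ((div_le_self ?_ ha).trans ?_)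
    · have : 0 ≤ min 1 (L * t ^ 2) := le_min zero_le_one (by positivity)
      positivity
    · have h1 : (1 + |t|) * min 1 (L * t ^ 2) ≤ 2 * (L * t ^ 2) :=
        mul_le_mul (by linarith) (min_le_right _ _) (le_min zero_le_one (by positivity)) (by norm_num)
      nlinarith [sq_nonneg t]
  · have ht2 : 1 ≤ t ^ 2 := by rw [← sq_abs]; exact one_le_pow₀ h
    rw [min_eq_right ht2]
    exact (min_le_right _ _).trans (by linarith)

lemma measurable_cutF (s L a : ℝ) : Measurable (cutF s L a) := by
  have := measurable_pk s
  unfold cutF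
  fun_prop

lemma integrable_cutF {s L a : ℝ} (hs : s ∈ Ioo (0:ℝ) 1) (hL : 0 ≤ L) (ha : 1 ≤ a) :
    Integrable (cutF s L a) :=
  ((integrable_mk hs).const_mul (2 * L + 4)).mono' (measurable_cutF s L a).aestronglyMeasurable
    (Eventually.of_forall fun t => by
      rw [Real.norm_eq_abs, abs_of_nonneg (cutF_nonneg hL (by linarith) t)]
      exact cutF_le hL ha t)

lemma tendsto_integral_cutF {s L : ℝ} (hs : s ∈ Ioo (0:ℝ) 1) (hL : 0 ≤ L) :
    Tendsto (fun a => ∫ t, cutF s L a t) atTop (𝓝 0) := by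
  have h : Tendsto (fun a => ∫ t, cutF s L a t) atTop (𝓝 (∫ _t : ℝ, (0:ℝ))) := by
    refine tendsto_integral_filter_of_dominated_convergence (fun t => (2 * L + 4) * mk s t)
      (Eventually.of_forall fun a => (measurable_cutF s L a).aestronglyMeasurable) ?_
      ((integrable_mk hs).const_mul _) (Eventually.of_forall fun t => ?_)
    · filter_upwards [eventually_ge_atTop (1:ℝ)] with a ha
      refine Eventually.of_forall fun t => ?_
      rw [Real.norm_eq_abs, abs_of_nonneg (cutF_nonneg hL (by linarith) t)]
      exact cutF_le hL ha t
    · have h1 : Tendsto (fun a : ℝ => (1 + |t|) * min 1 (L * t ^ 2) / a) atTop (𝓝 0) :=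
        tendsto_const_nhds.div_atTop tendsto_id
      have h2 := (h1.min (tendsto_const_nhds (x := (4:ℝ)))).const_mul (pk s t)
      simpa [cutF] using h2
  simpa using h

section
variable {W W1 W2 W3 : ℝ → ℝ} {Λ r D : ℝ} {s : ℝ}

lemma Pot.cut_estimate (hW : Pot W W1 W2 W3 Λ r D) (hs : s ∈ Ioo (0:ℝ) 1)
    {J : ℝ → ℝ} (hJ : Ker s J) {u : ℝ → ℝ} (hu : Adm W u)
    (hmin : ∀ v, Adm W v → energy J W u ≤ energy J W v) {C1 : ℝ}
    (hl : ∀ x y, |u x - u y| ≤ C1 * |x - y|) {a c B : ℝ} (ha : 1 ≤ a)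
    (hc : ∀ x ∈ Icc 0 (1 + a), c ≤ W (u x)) (hB0 : 0 ≤ B) (hB : ∀ v ∈ Icc (0:ℝ) 1, W v ≤ B) :
    (1 + a) * c ≤ B + a / 4 * ∫ t, cutF s ((C1 + 1) ^ 2) a t := by
  have ha0 : 0 ≤ a := by linarith
  have hcut := hu.toProf.cut ha0
  obtain ⟨hi, hle⟩ := cut_integral (f := fun x => W (u x)) (F := fun x => W (cut u a x))
    (p := 0) (q := 1) (a := a) (Q := B) hu.int (fun x => hW.nonneg _) (fun x => hW.nonneg _)
    (hW.cont.measurable.comp hcut.measurable).aestronglyMeasurable zero_lt_one hB0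
    (fun x hx => by rw [cut_of_nonpos u a hx]) (fun x hx => by rw [cut_of_one_le u a hx])
    (fun x _ _ => hB _ (hcut.mem x))
  have hadm : Adm W (cut u a) := ⟨hcut, hi⟩
  have hE := hmin _ hadm
  have hWc : (1 + a) * c ≤ ∫ x in (0:ℝ)..(1 + a), W (u x) := by
    have := intervalIntegral.integral_mono_on (a := 0) (b := 1 + a) (μ := volume)
      (f := fun _ => c) (g := fun x => W (u x)) (by linarith) (by simp)
      hu.int.intervalIntegrable hc
    simpa using this
  have hL : 0 ≤ (C1 + 1) ^ 2 := sq_nonneg _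
  have hF := integrable_cutF (s := s) hs hL ha
  have hK : ∫ t, J t * sqInc (cut u a) t
      ≤ ∫ t, (J t * sqInc u t + a * cutF s ((C1 + 1) ^ 2) a t) := by
    refine integral_mono_ae (hcut.integrable_sqInc hJ)
      ((hu.integrable_sqInc hJ).fun_add (hF.const_mul a)) ?_
    filter_upwards [Measure.ae_ne volume (0:ℝ)] with t ht
    have h1 := hu.toProf.sqInc_cut_le ha0 hl (abs_nonneg t)
    have h2 := hu.toProf.sqInc_cut_le' ha0 (t := t)
    rw [sqInc_abs, sqInc_abs, sq_abs] at h1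
    have h3 : sqInc (cut u a) t - sqInc u t
        ≤ a * min ((1 + |t|) * min 1 ((C1 + 1) ^ 2 * t ^ 2) / a) 4 := by
      rw [mul_min_of_nonneg _ _ ha0, mul_div_cancel₀ _ (by linarith : a ≠ 0)]
      exact le_min (by linarith) (by linarith)
    have h0 : 0 ≤ a * min ((1 + |t|) * min 1 ((C1 + 1) ^ 2 * t ^ 2) / a) 4 := by
      have : 0 ≤ min 1 ((C1 + 1) ^ 2 * t ^ 2) := le_min zero_le_one (by positivity)
      exact mul_nonneg ha0 (le_min (by positivity) (by norm_num))
    have h4 := mul_le_mul_of_nonneg_left h3 (hJ.nonneg t)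
    have h5 := mul_le_mul_of_nonneg_right (hJ.le t ht) h0
    unfold cutF
    linarith
  rw [integral_add (hu.integrable_sqInc hJ) (hF.const_mul a), integral_const_mul] at hK
  unfold energy at hE
  linarith

/-- The transition happens on an interval whose length does not depend on the kernel. -/
lemma Pot.exists_width (hW : Pot W W1 W2 W3 Λ r D) (hs : s ∈ Ioo (0:ℝ) 1)
    {δ C1 : ℝ} (hδ : 0 < δ) (hδ2 : δ < 1 / 2) :
    ∃ A > 0, ∀ J, Ker s J → ∀ u, Adm W u → (∀ v, Adm W v → energy J W u ≤ energy J W v) →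
      (∀ x y, |u x - u y| ≤ C1 * |x - y|) → u 0 = 1 / 2 →
      (∀ x ≤ -A, u x ≤ δ) ∧ ∀ x, A ≤ x → 1 - δ ≤ u x := by
  obtain ⟨c, hc, hcW⟩ := hW.exists_W_lower hδ
  obtain ⟨B, hB, hBW⟩ := hW.exists_W_upper
  have hL : 0 ≤ (C1 + 1) ^ 2 := sq_nonneg _
  obtain ⟨a, ha1, haB, haF⟩ := ((eventually_ge_atTop (1:ℝ)).and
    ((eventually_ge_atTop (2 * B / c)).and
    ((tendsto_integral_cutF hs hL).eventually (gt_mem_nhds hc)))).exists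
  rw [div_le_iff₀ hc] at haB
  have key : ∀ J, Ker s J → ∀ u, Adm W u → (∀ v, Adm W v → energy J W u ≤ energy J W v) →
      (∀ x y, |u x - u y| ≤ C1 * |x - y|) → ∃ x ∈ Icc 0 (1 + a), W (u x) < c := by
    intro J hJ u hu hmin hl
    by_contra! hcon
    have := hW.cut_estimate hs hJ hu hmin hl ha1 hcon hB.le hBW
    have h2 := mul_lt_mul_of_pos_left haF (show 0 < a / 4 by linarith)
    nlinarith
  refine ⟨1 + a, by linarith, fun J hJ u hu hmin hl h0 => ⟨fun x hx => ?_, fun x hx => ?_⟩⟩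
  · obtain ⟨y, hy, hyc⟩ := key J hJ _ (hu.shift (-(1 + a)))
      (fun v hv => by rw [energy_shift]; exact hmin v hv)
      (fun x y => by simpa using hl (x + -(1 + a)) (y + -(1 + a)))
    by_contra hlt
    have h1 : u x ≤ u (y + -(1 + a)) := hu.mono (by linarith [hy.1])
    have h2 : u (y + -(1 + a)) ≤ u 0 := hu.mono (by linarith [hy.2])
    have := hcW (u (y + -(1 + a))) ⟨by linarith, by linarith⟩
    linarith
  · obtain ⟨y, hy, hyc⟩ := key J hJ u hu hmin hl
    by_contra hlt
    have h1 : u y ≤ u x := hu.mono (by linarith [hy.2])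
    have h2 : u 0 ≤ u y := hu.mono hy.1
    have := hcW (u y) ⟨by linarith, by linarith⟩
    linarith

end

lemma tail_le {s R K : ℝ} {u v : ℝ → ℝ} (hs : 0 < s) (hR : 0 < R)
    (hu : ∀ x, HasDerivAt u (v x) x) (hv : ∀ x, v x ≤ K * bar s R x)
    (hb : Tendsto u atBot (𝓝 0)) {x : ℝ} (hx : x ≤ -R) :
    u x ≤ K / (2 * s) * |x| ^ (-(2 * s)) := by
  set f : ℝ → ℝ := fun y => u y - K / (2 * s) * (-y) ^ (-(2 * s)) with hf
  have hd : ∀ y ≤ -R, HasDerivAt f (v y - K * (-y) ^ (-(1 + 2 * s))) y := by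
    intro y hy
    have h1 : HasDerivAt (fun y : ℝ => (-y) ^ (-(2 * s))) (2 * s * (-y) ^ (-(1 + 2 * s))) y := by
      have := (hasDerivAt_neg y).rpow_const (p := -(2 * s)) (Or.inl (by linarith))
      refine this.congr_deriv ?_
      rw [show -(2 * s) - 1 = -(1 + 2 * s) by ring]; ring
    refine ((hu y).fun_sub (h1.const_mul (K / (2 * s)))).congr_deriv ?_
    field_simp
  have hanti : AntitoneOn f (Iic (-R)) := by
    refine antitoneOn_of_deriv_nonpos (convex_Iic _)
      (fun y hy => (hd y hy).continuousAt.continuousWithinAt)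
      (fun y hy => (hd y (interior_subset hy : y ∈ Iic (-R))).differentiableAt.differentiableWithinAt)
      fun y hy => ?_
    have hy' : y ≤ -R := (interior_subset hy : y ∈ Iic (-R))
    rw [(hd y hy').deriv]
    have := hv y
    rw [bar_of_ge (by rw [abs_of_nonpos (by linarith)]; linarith),
      abs_of_nonpos (by linarith)] at this
    linarith
  have hlim : Tendsto f atBot (𝓝 0) := by
    have h1 : Tendsto (fun y : ℝ => (-y) ^ (-(2 * s))) atBot (𝓝 0) :=
      (tendsto_rpow_neg_atTop (by linarith : 0 < 2 * s)).comp tendsto_neg_atBot_atTop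
    simpa using hb.sub (h1.const_mul (K / (2 * s)))
  have : f x ≤ 0 := ge_of_tendsto hlim <| (eventually_le_atBot x).mono fun y hy =>
    hanti (mem_Iic.2 (hy.trans hx)) (mem_Iic.2 hx) hy
  rw [abs_of_nonpos (by linarith)]
  simp only [hf] at this
  linarith

/-- Kernel-independent bounds for layer solutions. -/
structure Bds (s r R K : ℝ) (u v w : ℝ → ℝ) : Prop where
  hu : ∀ x, HasDerivAt u (v x) x
  hv : ∀ x, HasDerivAt v (w x) x
  half : u 0 = 1 / 2
  mem : ∀ x, u x ∈ Icc (0:ℝ) 1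
  nonneg : ∀ x, 0 ≤ v x
  hi : ∀ x, v x ≤ K * bar s R x
  w_le : ∀ x, |w x| ≤ K * bar s R x
  hol : ∀ x a, |w (x + a) - w x| ≤ K * |a| ^ r
  left : ∀ x ≤ -R, u x ≤ K * |x| ^ (-(2 * s))
  right : ∀ x, R ≤ x → 1 - u x ≤ K * |x| ^ (-(2 * s))

lemma exists_radius {s C0 β A : ℝ} (hs : 0 < s) (hβ : 0 < β) :
    ∃ R, 1 ≤ R ∧ A ≤ R ∧ C0 * R ^ (-(2 * s)) ≤ β := by
  have h := (tendsto_rpow_neg_atTop (by linarith : 0 < 2 * s)).const_mul C0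
  rw [mul_zero] at h
  obtain ⟨R, h1, h2, h3⟩ := ((eventually_ge_atTop 1).and ((eventually_ge_atTop A).and
    (h.eventually (gt_mem_nhds hβ)))).exists
  exact ⟨R, h1, h2, h3.le⟩

lemma uniform_estimates {s : ℝ} {W W1 W2 W3 : ℝ → ℝ} {Λ r D : ℝ}
    (hW : Pot W W1 W2 W3 Λ r D) (hs : s ∈ Ioo (0:ℝ) 1) {k ρ : ℝ} (hk : 0 < k) (hρ : 0 < ρ)
    (hkρ : Λ + 1 ≤ 2 * k * ρ) :
    ∃ R K A L : ℝ, 1 ≤ R ∧ 0 ≤ K ∧ 0 ≤ A ∧ 0 ≤ L ∧ ∀ J, Ker s J → (∀ t, |t| ≤ ρ → k ≤ J t) →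
      ∃ u v w, Bds s r R K u v w ∧ (∀ x, opL J u x = W1 (u x)) ∧
        ∀ x0 X j, 0 ≤ j → |x0| + 1 + A ≤ X → (∀ t, |t| ≤ X → j ≤ J t) → j ≤ L * v x0 := by
  have hs0 := hs.1
  have hΛ := hW.Λ_pos
  have hconv := hW.conv
  have hD := hW.D_nonneg
  obtain ⟨δ', hδ', hδ2', hw0', hw1'⟩ := hW.exists_well
  obtain ⟨δ, hδ, hδ2, hw0, hw1⟩ : ∃ δ : ℝ, 0 < δ ∧ δ ≤ 1 / 4 ∧
      (∀ v, |v| ≤ δ → W2 0 / 2 ≤ W2 v) ∧ (∀ v, |v - 1| ≤ δ → W2 0 / 2 ≤ W2 v) :=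
    ⟨min δ' (1 / 4), by positivity, min_le_right _ _, fun v hv => hw0' v (hv.trans (min_le_left _ _)),
      fun v hv => hw1' v (hv.trans (min_le_left _ _))⟩
  set C1 := 2 * k with hC1
  set C2 := 2 * k * C1 + Λ * C1 ^ 2 with hC2
  obtain ⟨A, hA, hwidth⟩ := hW.exists_width hs (C1 := C1) hδ (by linarith)
  obtain ⟨C0, hC0, hbar⟩ := exists_bar_supersolution hs
  have hβ : 0 < W2 0 / 4 := by positivity
  obtain ⟨R, hR1, hRA, hRβ⟩ := exists_radius (C0 := C0) (A := A) hs0 hβ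
  have hR : 0 < R := by linarith
  have hC1p : 0 < C1 := by positivity
  have hC2p : 0 < C2 := by positivity
  set K1 := C1 * R ^ (1 + 2 * s) with hK1
  have hK1p : 0 < K1 := by positivity
  set B := Λ * C1 * K1 with hB
  have hBp : 0 < B := by positivity
  set K2 := max (C2 * R ^ (1 + 2 * s)) (B / (W2 0 / 4)) with hK2
  have hK2p : 0 < K2 := lt_max_of_lt_right (by positivity)
  set H := 2 * k * C2 + (3 * Λ * C1 * C2 + D * C1 ^ r * C1 ^ 2) + 2 * C2 with hH
  have hHp : 0 < H := by positivity
  set K := K1 + K2 + H + K1 / (2 * s) with hK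
  have hKs : 0 < K1 / (2 * s) := by positivity
  set ρ' := min 1 (1 / (8 * C1)) with hρ'
  have hρ'0 : 0 < ρ' := by positivity
  have hρ'1 : C1 * ρ' ≤ 1 / 8 := by
    refine (mul_le_mul_of_nonneg_left (min_le_right _ _) hC1p.le).trans (le_of_eq ?_)
    field_simp
  have hImk : 0 ≤ ∫ t, mk s t := integral_nonneg fun t => mk_nonneg s t
  refine ⟨R, K, A, 4 * Λ + 8 / ρ' ^ 2 * ∫ t, mk s t, hR1, by positivity, hA.le, by positivity, ?_⟩
  intro J hJ hJk
  have hmass : Λ < ∫ t, J t := by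
    have h1 : ∫ t in Icc (-ρ) ρ, k ≤ ∫ t in Icc (-ρ) ρ, J t := by
      refine setIntegral_mono_on (integrableOn_const (by simp)) hJ.integrable.integrableOn
        measurableSet_Icc fun t ht => hJk t (abs_le.2 ht)
    have h2 : ∫ t in Icc (-ρ) ρ, J t ≤ ∫ t, J t :=
      setIntegral_le_integral hJ.integrable (Eventually.of_forall hJ.nonneg)
    have h3 : ∫ t in Icc (-ρ) ρ, k = 2 * k * ρ := by
      rw [setIntegral_const]
      simp [Real.volume_real_Icc_of_le (by linarith : -ρ ≤ ρ)]; ring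
    linarith
  obtain ⟨u, v, w, hsol, hadm, hmin, hhalf⟩ := hW.exists_sol hJ hmass
  have hv1 : ∀ x, |v x| ≤ C1 := hsol.abs_v_le hW hJ hk.le hρ.le hkρ hJk
  have hw2 : ∀ x, |w x| ≤ C2 := hsol.abs_w_le hW hJ hk.le hρ.le hkρ hJk hv1
  have hlip : ∀ x y, |u x - u y| ≤ C1 * |x - y| := lip_of_hasDerivAt hsol.hu hv1
  obtain ⟨hl, hr⟩ := hwidth J hJ u hadm hmin hlip hhalf
  have hW2 : ∀ x, R ≤ |x| → 2 * (W2 0 / 4) ≤ W2 (u x) := by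
    intro x hx
    have hm := hsol.mem x
    rw [show 2 * (W2 0 / 4) = W2 0 / 2 by ring]
    rcases le_abs'.1 (hRA.trans hx) with h | h
    · exact hw0 _ (abs_le.2 ⟨by linarith [hm.1], hl x h⟩)
    · exact hw1 _ (abs_le.2 ⟨by linarith [hr x h], by linarith [hm.2]⟩)
  have e1 := hsol.eqn1 hW hJ hv1
  have e2 := hsol.eqn2 hW hJ hv1 hw2
  have hvK : ∀ x, v x ≤ K1 * bar s R x := hJ.le_bar hR hsol.cv (N := C1)
    (fun x => (le_abs_self _).trans (hv1 x)) hβ (fun x hx => hbar R hR J hJ x hx) hRβ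
    (a := fun x => W2 (u x)) (b := fun _ => 0) (fun x _ => by rw [e1]; ring) hW2 (B := 0)
    (fun x _ => by simp) (F := C1) (fun x _ => (le_abs_self _).trans (hv1 x)) hK1p.le le_rfl
    (by positivity)
  have hW3 : ∀ x, |W3 (u x) * v x ^ 2| ≤ B * bar s R x := by
    intro x
    have h0 := hsol.nonneg x
    have h1 := hv1 x
    rw [abs_of_nonneg h0] at h1
    rw [abs_mul, abs_of_nonneg (sq_nonneg (v x)), hB, mul_assoc, mul_assoc]
    refine mul_le_mul (hW.b3 _) ?_ (sq_nonneg _) hΛ.le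
    rw [sq]
    exact mul_le_mul h1 (hvK x) h0 hC1p.le
  have hKB : B ≤ W2 0 / 4 * K2 := by
    have := le_max_right (C2 * R ^ (1 + 2 * s)) (B / (W2 0 / 4))
    rw [← hK2, div_le_iff₀ hβ] at this
    linarith
  have hwK : ∀ x, w x ≤ K2 * bar s R x := hJ.le_bar hR hsol.cw (N := C2)
    (fun x => (le_abs_self _).trans (hw2 x)) hβ (fun x hx => hbar R hR J hJ x hx) hRβ
    (a := fun x => W2 (u x)) (b := fun x => W3 (u x) * v x ^ 2) (fun x _ => e2 x) hW2 (B := B)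
    (fun x _ => (abs_le.1 (hW3 x)).1) (F := C2) (fun x _ => (le_abs_self _).trans (hw2 x)) hK2p.le
    (le_max_left _ _) hKB
  have hwK' : ∀ x, -w x ≤ K2 * bar s R x := hJ.le_bar hR hsol.cw.neg (N := C2)
    (fun x => (neg_le_abs _).trans (hw2 x)) hβ (fun x hx => hbar R hR J hJ x hx) hRβ
    (a := fun x => W2 (u x)) (b := fun x => -(W3 (u x) * v x ^ 2))
    (fun x _ => by rw [opL_neg, e2 x]; ring) hW2 (B := B)
    (fun x _ => neg_le_neg (abs_le.1 (hW3 x)).2) (F := C2)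
    (fun x _ => (neg_le_abs _).trans (hw2 x)) hK2p.le (le_max_left _ _) hKB
  have hup : ∀ a b x : ℝ, a ≤ K → b ≤ a * bar s R x → b ≤ K * bar s R x := fun a b x h h' =>
    h'.trans (mul_le_mul_of_nonneg_right h (bar_pos hR x).le)
  have hup2 : ∀ b x : ℝ, b ≤ K1 / (2 * s) * |x| ^ (-(2 * s)) → b ≤ K * |x| ^ (-(2 * s)) :=
    fun b x h' => h'.trans (mul_le_mul_of_nonneg_right (by linarith) (by positivity))
  refine ⟨u, v, w, ⟨hsol.hu, hsol.hv, hhalf, hsol.mem, hsol.nonneg,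
    fun x => hup K1 _ x (by linarith) (hvK x),
    fun x => hup K2 _ x (by linarith) (abs_le.2 ⟨by linarith [hwK' x], hwK x⟩),
    fun x a => (hsol.holder_w hW hJ hk.le hρ.le hkρ hJk hv1 hw2 x a).trans
      (mul_le_mul_of_nonneg_right (by linarith) (by positivity)),
    fun x hx => hup2 _ x (tail_le hs0 hR hsol.hu hvK hadm.bot hx), fun x hx => ?_⟩, hsol.eqn,
    fun x0 X j hj hX hjJ => ?_⟩
  · have hb' : Tendsto (fun y => 1 - u (-y)) atBot (𝓝 0) := by
      simpa using (hadm.top.comp tendsto_neg_atBot_atTop).const_sub 1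
    have := tail_le (u := fun y => 1 - u (-y)) (v := fun y => v (-y)) (K := K1) hs0 hR
      (fun y => (((hsol.hu (-y)).scomp y (hasDerivAt_neg y)).const_sub 1).congr_deriv (by simp))
      (fun y => by simpa [bar_neg] using hvK (-y)) hb' (x := -x) (by linarith)
    refine hup2 _ x ?_
    simpa using this
  · refine deriv_pos_bound hs hJ hsol.hu hsol.cv hsol.nonneg (fun x => ?_) hρ'0 (min_le_left _ _)
      hΛ.le (fun x => ?_) ?_ hX hA.le hj hjJ
    · rw [e1 x]
      exact mul_le_mul_of_nonneg_right ((le_abs_self _).trans (hW.b2 _)) (hsol.nonneg x)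
    · refine (le_abs_self _).trans ((hlip _ _).trans ?_)
      rw [show x + ρ' - (x - ρ') = 2 * ρ' by ring, abs_of_pos (by linarith)]
      linarith
    · linarith [hl (-A) le_rfl, hr A le_rfl]

lemma hasDerivAt_of_tendsto {f g : ℕ → ℝ → ℝ} {F G : ℝ → ℝ} {B : ℝ}
    (hf : ∀ n x, HasDerivAt (f n) (g n x) x) (hc : ∀ n, Continuous (g n))
    (hB : ∀ n x, |g n x| ≤ B) (hF : ∀ x, Tendsto (fun n => f n x) atTop (𝓝 (F x)))
    (hG : ∀ x, Tendsto (fun n => g n x) atTop (𝓝 (G x))) (hGc : Continuous G) (x : ℝ) :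
    HasDerivAt F (G x) x := by
  have key : ∀ y, F y = F 0 + ∫ t in (0:ℝ)..y, G t := by
    intro y
    have h1 : Tendsto (fun n => ∫ t in (0:ℝ)..y, g n t) atTop (𝓝 (∫ t in (0:ℝ)..y, G t)) := by
      refine intervalIntegral.tendsto_integral_filter_of_dominated_convergence (fun _ => B)
        (Eventually.of_forall fun n => (hc n).aestronglyMeasurable)
        (Eventually.of_forall fun n => Eventually.of_forall fun t _ => hB n t) (by simp)
        (Eventually.of_forall fun t _ => hG t)
    have h2 : ∀ n, ∫ t in (0:ℝ)..y, g n t = f n y - f n 0 := fun n =>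
      intervalIntegral.integral_eq_sub_of_hasDerivAt (fun t _ => hf n t)
        ((hc n).intervalIntegrable _ _)
    simp only [h2] at h1
    linarith [tendsto_nhds_unique h1 ((hF y).sub (hF 0))]
  rw [funext key]
  exact (intervalIntegral.integral_hasDerivAt_right (hGc.intervalIntegrable _ _)
    (hGc.stronglyMeasurableAtFilter _ _) hGc.continuousAt).const_add _

lemma exists_delta_of_holder {K r ε : ℝ} (hK : 0 ≤ K) (hr : 0 < r) (hε : 0 < ε) :
    ∃ δ > 0, ∀ a : ℝ, |a| ≤ δ → K * |a| ^ r ≤ ε := by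
  refine ⟨(ε / (K + 1)) ^ (1 / r), by positivity, fun a ha => ?_⟩
  have h1 : |a| ^ r ≤ ε / (K + 1) := by
    refine (rpow_le_rpow (abs_nonneg a) ha hr.le).trans (le_of_eq ?_)
    rw [← rpow_mul (by positivity), one_div_mul_cancel hr.ne', rpow_one]
  refine (mul_le_mul_of_nonneg_left h1 hK).trans ?_
  rw [← mul_div_assoc, div_le_iff₀ (by positivity)]
  nlinarith

lemma continuous_of_holder {f : ℝ → ℝ} {K r : ℝ} (hK : 0 ≤ K) (hr : 0 < r)
    (h : ∀ x a, |f (x + a) - f x| ≤ K * |a| ^ r) : Continuous f := by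
  refine Metric.continuous_iff.2 fun x ε hε => ?_
  obtain ⟨δ, hδ, hd⟩ := exists_delta_of_holder hK hr (half_pos hε)
  refine ⟨δ, hδ, fun y hy => ?_⟩
  have := (h x (y - x)).trans (hd (y - x) hy.le)
  rw [add_sub_cancel] at this
  rw [Real.dist_eq]; linarith

namespace Bds
variable {s r R K : ℝ} {u v w : ℝ → ℝ}

lemma bar_le_one (hs : 0 < s) (hR : 1 ≤ R) (x : ℝ) : bar s R x ≤ 1 :=
  (bar_le_const hs (by linarith) x).trans (rpow_le_one_of_one_le_of_nonpos hR (by linarith))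

lemma abs_v_le (h : Bds s r R K u v w) (hs : 0 < s) (hR : 1 ≤ R) (hK : 0 ≤ K) (x : ℝ) :
    |v x| ≤ K := by
  rw [abs_of_nonneg (h.nonneg x)]
  exact (h.hi x).trans (mul_le_of_le_one_right hK (bar_le_one hs hR x))

lemma abs_w_le (h : Bds s r R K u v w) (hs : 0 < s) (hR : 1 ≤ R) (hK : 0 ≤ K) (x : ℝ) :
    |w x| ≤ K :=
  (h.w_le x).trans (mul_le_of_le_one_right hK (bar_le_one hs hR x))

lemma cu (h : Bds s r R K u v w) : Continuous u :=
  continuous_iff_continuousAt.2 fun x => (h.hu x).continuousAt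

lemma cv (h : Bds s r R K u v w) : Continuous v :=
  continuous_iff_continuousAt.2 fun x => (h.hv x).continuousAt

lemma cw (h : Bds s r R K u v w) (hr : 0 < r) (hK : 0 ≤ K) : Continuous w :=
  continuous_of_holder hK hr h.hol

lemma second_diff (h : Bds s r R K u v w) (hs : 0 < s) (hR : 1 ≤ R) (hK : 0 ≤ K) (x t : ℝ) :
    |u (x + t) + u (x - t) - 2 * u x| ≤ (2 * K + 4) * min (t ^ 2) 1 := by
  have h1 : |u (x + t) + u (x - t) - 2 * u x| ≤ 2 * K * t ^ 2 :=
    second_diff_le (fun y _ => h.hu y) (fun y _ => h.hv y) fun y _ => h.abs_w_le hs hR hK y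
  have h2 : |u (x + t) + u (x - t) - 2 * u x| ≤ 4 := by
    have a := h.mem (x + t); have b := h.mem (x - t); have c := h.mem x
    exact abs_le.2 ⟨by linarith [a.1, b.1, c.2], by linarith [a.2, b.2, c.1]⟩
  rcases le_total (t ^ 2) 1 with h3 | h3
  · rw [min_eq_left h3]; nlinarith [sq_nonneg t]
  · rw [min_eq_right h3]; linarith

lemma exists_limit {u v w : ℕ → ℝ → ℝ} (h : ∀ n, Bds s r R K (u n) (v n) (w n)) (hs : 0 < s)
    (hr : 0 < r) (hR : 1 ≤ R) (hK : 0 ≤ K) :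
    ∃ φ : ℕ → ℕ, StrictMono φ ∧ ∃ U V Z : ℝ → ℝ,
      (∀ x, Tendsto (fun n => u (φ n) x) atTop (𝓝 (U x))) ∧
      (∀ x, Tendsto (fun n => v (φ n) x) atTop (𝓝 (V x))) ∧ Bds s r R K U V Z := by
  have equi : ∀ f f' : ℕ → ℝ → ℝ, (∀ n x, HasDerivAt (f n) (f' n x) x) → (∀ n x, |f' n x| ≤ K) →
      ∀ ε > 0, ∃ δ > 0, ∀ n x y, |x - y| ≤ δ → |f n x - f n y| ≤ ε := by
    intro f f' hf hf' ε hε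
    refine ⟨ε / (K + 1), by positivity, fun n x y hxy => ?_⟩
    refine (lip_of_hasDerivAt (hf n) (hf' n) x y).trans
      ((mul_le_mul_of_nonneg_left hxy hK).trans ?_)
    rw [← mul_div_assoc, div_le_iff₀ (by positivity)]
    nlinarith
  have hvb : ∀ n x, |v n x| ≤ K := fun n => (h n).abs_v_le hs hR hK
  have hwb : ∀ n x, |w n x| ≤ K := fun n => (h n).abs_w_le hs hR hK
  obtain ⟨φ₁, hφ₁, U, hU⟩ := exists_subseq_of_equicontinuous (f := u) (B := 1)
    (fun n x => abs_le.2 ⟨by linarith [((h n).mem x).1], ((h n).mem x).2⟩)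
    (equi u v (fun n => (h n).hu) hvb)
  obtain ⟨φ₂, hφ₂, V, hV⟩ := exists_subseq_of_equicontinuous (f := fun n => v (φ₁ n)) (B := K)
    (fun n => hvb (φ₁ n))
    (equi (fun n => v (φ₁ n)) (fun n => w (φ₁ n)) (fun n => (h (φ₁ n)).hv) (fun n => hwb (φ₁ n)))
  obtain ⟨φ₃, hφ₃, Z, hZ⟩ := exists_subseq_of_equicontinuous (f := fun n => w (φ₁ (φ₂ n)))
    (B := K) (fun n => hwb _) (fun ε hε => by
      obtain ⟨δ, hδ, hd⟩ := exists_delta_of_holder hK hr hε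
      refine ⟨δ, hδ, fun n x y hxy => ?_⟩
      have := ((h (φ₁ (φ₂ n))).hol y (x - y)).trans (hd _ hxy)
      rwa [add_sub_cancel] at this)
  have hU' : ∀ x, Tendsto (fun n => u (φ₁ (φ₂ (φ₃ n))) x) atTop (𝓝 (U x)) := fun x =>
    (hU x).comp (hφ₂.comp hφ₃).tendsto_atTop
  have hV' : ∀ x, Tendsto (fun n => v (φ₁ (φ₂ (φ₃ n))) x) atTop (𝓝 (V x)) := fun x =>
    (hV x).comp hφ₃.tendsto_atTop
  have hhol : ∀ x a, |Z (x + a) - Z x| ≤ K * |a| ^ r := fun x a =>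
    le_of_tendsto ((hZ (x + a)).sub (hZ x)).abs (Eventually.of_forall fun n => (h _).hol x a)
  have hcZ : Continuous Z := continuous_of_holder hK hr hhol
  have hvV : ∀ x, HasDerivAt V (Z x) x := hasDerivAt_of_tendsto (fun n => (h _).hv)
    (fun n => (h _).cw hr hK) (fun n => hwb _) hV' hZ hcZ
  have hcV : Continuous V := continuous_iff_continuousAt.2 fun x => (hvV x).continuousAt
  refine ⟨φ₁ ∘ φ₂ ∘ φ₃, hφ₁.comp (hφ₂.comp hφ₃), U, V, Z, hU', hV',
    hasDerivAt_of_tendsto (fun n => (h _).hu) (fun n => (h _).cv) (fun n => hvb _) hU' hV' hcV,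
    hvV, ?_, fun x => isClosed_Icc.mem_of_tendsto (hU' x) (Eventually.of_forall fun n => (h _).mem x),
    fun x => ge_of_tendsto' (hV' x) fun n => (h _).nonneg x,
    fun x => le_of_tendsto' (hV' x) fun n => (h _).hi x,
    fun x => le_of_tendsto' (hZ x).abs fun n => (h _).w_le x, hhol,
    fun x hx => le_of_tendsto' (hU' x) fun n => (h _).left x hx,
    fun x hx => le_of_tendsto' ((hU' x).const_sub 1) fun n => (h _).right x hx⟩
  exact tendsto_nhds_unique (hU' 0) (by simp only [(h _).half]; exact tendsto_const_nhds)

end Bds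

lemma fracLap_eq_of_tendsto {s r R K : ℝ} (hs : s ∈ Ioo (0:ℝ) 1) (hR : 1 ≤ R) (hK : 0 ≤ K)
    {J u v w : ℕ → ℝ → ℝ} {U W1 : ℝ → ℝ} (hW1 : Continuous W1) (hJ : ∀ n, Ker s (J n))
    (hJlim : ∀ t, t ≠ 0 → Tendsto (fun n => J n t) atTop (𝓝 (pk s t)))
    (h : ∀ n, Bds s r R K (u n) (v n) (w n)) (heq : ∀ n x, opL (J n) (u n) x = W1 (u n x))
    (hU : ∀ x, Tendsto (fun n => u n x) atTop (𝓝 (U x))) (x : ℝ) :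
    fracLap s U x = W1 (U x) := by
  have h1 : Tendsto (fun n => ∫ t, J n t * (u n (x + t) + u n (x - t) - 2 * u n x)) atTop
      (𝓝 (∫ t, pk s t * (U (x + t) + U (x - t) - 2 * U x))) := by
    refine tendsto_integral_of_dominated_convergence (fun t => (2 * K + 4) * mk s t)
      (fun n => ?_) ((integrable_mk hs).const_mul _) (fun n => ?_) ?_
    · have := (hJ n).cont
      have := (h n).cu
      exact Continuous.aestronglyMeasurable (by fun_prop)
    · filter_upwards [compl_mem_ae_iff.2 (measure_singleton (0:ℝ))] with t ht
      rw [norm_mul, Real.norm_eq_abs, Real.norm_eq_abs, abs_of_nonneg ((hJ n).nonneg t)]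
      refine (mul_le_mul ((hJ n).le t ht) ((h n).second_diff hs.1 hR hK x t) (abs_nonneg _)
        (pk_nonneg s t)).trans (le_of_eq ?_)
      unfold mk; ring
    · filter_upwards [compl_mem_ae_iff.2 (measure_singleton (0:ℝ))] with t ht
      exact (hJlim t ht).mul (((hU _).add (hU _)).sub ((hU _).const_mul 2))
  have h2 : ∀ n, ∫ t, J n t * (u n (x + t) + u n (x - t) - 2 * u n x) = 2 * W1 (u n x) := fun n => by
    rw [← heq, (hJ n).opL_symm (h n).cu]
  simp only [h2] at h1
  have h3 := tendsto_nhds_unique h1 (((hW1.tendsto _).comp (hU x)).const_mul 2)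
  have h4 : fracLap s U x = 1 / 2 * ∫ t, pk s t * (U (x + t) + U (x - t) - 2 * U x) := by
    unfold fracLap pk
    congr 2; ext t; ring
  rw [h4, h3]; ring

lemma exists_layer {s : ℝ} {W W1 W2 W3 : ℝ → ℝ} {Λ r D : ℝ}
    (hW : Pot W W1 W2 W3 Λ r D) (hs : s ∈ Ioo (0:ℝ) 1) :
    ∃ R K A L : ℝ, 1 ≤ R ∧ 0 ≤ K ∧ 0 ≤ A ∧ 0 ≤ L ∧ ∃ u v w, Bds s r R K u v w ∧
      (∀ x, fracLap s u x = W1 (u x)) ∧ ∀ x, pk s (|x| + 1 + A) / 2 ≤ L * v x := by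
  have hs0 := hs.1
  have hΛ := hW.Λ_pos
  obtain ⟨J, hJ, hJlim, hJlow⟩ := exists_kernels hs
  set ρ := (Λ + 1) ^ (-(1 / (2 * s))) with hρdef
  have hρ : 0 < ρ := by positivity
  have hkρ : Λ + 1 ≤ 2 * (pk s ρ / 2) * ρ := by
    have h1 : pk s ρ * ρ = ρ ^ (-(2 * s)) := by
      rw [pk_eq_rpow s hρ]
      nth_rw 2 [← rpow_one ρ]
      rw [← rpow_add hρ]; ring_nf
    rw [show 2 * (pk s ρ / 2) * ρ = pk s ρ * ρ by ring, h1, hρdef, ← rpow_mul (by positivity),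
      show -(1 / (2 * s)) * -(2 * s) = 1 by field_simp, rpow_one]
  obtain ⟨R, K, A, L, hR, hK, hA, hL, hun⟩ :=
    uniform_estimates hW hs (k := pk s ρ / 2) (half_pos (pk_pos s hρ.ne')) hρ hkρ
  obtain ⟨N, hN⟩ := eventually_atTop.1 (hJlow ρ hρ)
  choose u v w hb heq hlow using fun n => hun (J (n + N)) (hJ _) (hN (n + N) (by omega))
  obtain ⟨φ, hφ, U, V, Z, hU, hV, hB⟩ := Bds.exists_limit hb hs0 hW.r_pos hR hK
  have hφN : Tendsto (fun n => φ n + N) atTop atTop :=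
    tendsto_atTop_mono (fun n => Nat.le_add_right _ _) hφ.tendsto_atTop
  refine ⟨R, K, A, L, hR, hK, hA, hL, U, V, Z, hB,
    fracLap_eq_of_tendsto hs hR hK hW.cont1 (fun n => hJ (φ n + N))
      (fun t ht => (hJlim t ht).comp hφN) (fun n => hb (φ n)) (fun n => heq (φ n)) hU, fun x => ?_⟩
  refine ge_of_tendsto ((hV x).const_mul L) ?_
  filter_upwards [hφN.eventually (hJlow (|x| + 1 + A) (by positivity))] with n hn
  exact hlow (φ n) x _ _ (half_pos (pk_pos s (by positivity))).le le_rfl hn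

/-- `|y|^{-s}` truncated to the unit ball. -/
def sp (s y : ℝ) : ℝ := if |y| ≤ 1 then |y| ^ (-s) else 0

/-- Profile of the error between a layer and the step function. -/
def errG (s t : ℝ) : ℝ := if |t| ≤ 1 / 2 then |t| ^ (1 + s) else 3 + |(1 - |t|)| ^ (-s)

lemma sp_nonneg (s y : ℝ) : 0 ≤ sp s y := by
  unfold sp; split_ifs <;> positivity

lemma measurable_errG (s : ℝ) : Measurable (errG s) :=
  Measurable.ite (measurableSet_le (by fun_prop) (by fun_prop)) (by fun_prop) (by fun_prop)

lemma errG_nonneg (s t : ℝ) : 0 ≤ errG s t := by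
  unfold errG; split_ifs <;> positivity

lemma integrable_sp {s : ℝ} (hs : s < 1) : Integrable (sp s) := by
  refine integrable_of_even (fun t => by simp [sp]) ?_
  have h1 : IntegrableOn (fun t : ℝ => t ^ (-s)) (Ioc 0 1) := by
    have := intervalIntegral.intervalIntegrable_rpow' (a := 0) (b := 1) (r := -s) (by linarith)
    rwa [intervalIntegrable_iff_integrableOn_Ioc_of_le zero_le_one] at this
  rw [← Ioc_union_Ioi_eq_Ioi (zero_le_one' ℝ)]
  refine IntegrableOn.union (h1.congr_fun (fun t ht => ?_) measurableSet_Ioc)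
    (integrableOn_zero.congr_fun (fun t ht => ?_) measurableSet_Ioi)
  · simp [sp, abs_of_pos ht.1, ht.2]
  · have : (1:ℝ) < t := ht
    simp [sp, abs_of_pos (by linarith : (0:ℝ) < t), this]

lemma rpow_le_one_add_sp {s : ℝ} (hs : 0 < s) (y : ℝ) : |y| ^ (-s) ≤ 1 + sp s y := by
  unfold sp; split_ifs with h
  · linarith
  · rw [add_zero]
    exact rpow_le_one_of_one_le_of_nonpos (not_le.1 h).le (by linarith)

lemma integrable_pk_errG {s : ℝ} (hs : s ∈ Ioo (0:ℝ) 1) :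
    Integrable (fun t => pk s t * errG s t) := by
  have hs0 := hs.1
  have hsp := integrable_sp hs.2
  have hdom : Integrable (fun t => sp s t + 16 * mk s t
      + 2 ^ (1 + 2 * s) * (sp s (1 - t) + sp s (1 + t))) :=
    (hsp.fun_add ((integrable_mk hs).const_mul _)).fun_add
      (((hsp.comp_sub_left 1).fun_add (hsp.comp_add_left 1)).const_mul _)
  refine hdom.mono' ((measurable_pk s).mul (measurable_errG s)).aestronglyMeasurable ?_
  filter_upwards [compl_mem_ae_iff.2 (measure_singleton (0:ℝ))] with t ht
  have ht0 : 0 < |t| := abs_pos.2 ht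
  have n1 := sp_nonneg s t
  have n2 := mk_nonneg s t
  have n3 := sp_nonneg s (1 - t)
  have n4 := sp_nonneg s (1 + t)
  have n5 := pk_nonneg s t
  have hq : (0:ℝ) < 2 ^ (1 + 2 * s) := by positivity
  rw [Real.norm_eq_abs, abs_of_nonneg (mul_nonneg n5 (errG_nonneg s t))]
  have hpk : pk s t = |t| ^ (-(1 + 2 * s)) := by
    rw [pk, one_div, rpow_neg (abs_nonneg t)]
  unfold errG
  split_ifs with h
  · have e : pk s t * |t| ^ (1 + s) = sp s t := by
      rw [hpk, ← rpow_add ht0, sp, if_pos (by linarith)]; ring_nf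
    rw [e]
    have : 0 ≤ 2 ^ (1 + 2 * s) * (sp s (1 - t) + sp s (1 + t)) := by positivity
    linarith
  · have h' : 1 / 2 < |t| := not_le.1 h
    have hp : pk s t ≤ 2 ^ (1 + 2 * s) := by
      rw [hpk]
      refine (rpow_le_rpow_of_nonpos (by norm_num) h'.le (by linarith)).trans (le_of_eq ?_)
      rw [one_div, inv_rpow (by norm_num), rpow_neg (by norm_num), inv_inv]
    have hm : pk s t ≤ 4 * mk s t := by
      have : 1 / 4 ≤ min (t ^ 2) 1 := le_min (by rw [← sq_abs]; nlinarith) (by norm_num)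
      unfold mk; nlinarith
    have hsplit : sp s (1 - |t|) ≤ sp s (1 - t) + sp s (1 + t) := by
      rcases abs_cases t with ⟨e, _⟩ | ⟨e, _⟩ <;> rw [e]
      · linarith
      · rw [sub_neg_eq_add]; linarith
    have h1 := rpow_le_one_add_sp hs0 (1 - |t|)
    calc pk s t * (3 + |(1 - |t|)| ^ (-s))
        ≤ pk s t * (4 + (sp s (1 - t) + sp s (1 + t))) :=
          mul_le_mul_of_nonneg_left (by linarith) n5
      _ = pk s t * 4 + pk s t * (sp s (1 - t) + sp s (1 + t)) := mul_add _ _ _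
      _ ≤ 16 * mk s t + 2 ^ (1 + 2 * s) * (sp s (1 - t) + sp s (1 + t)) :=
          add_le_add (by linarith) (mul_le_mul_of_nonneg_right hp (by positivity))
      _ ≤ _ := by linarith

lemma integral_pk_tail {s x : ℝ} (hs : 0 < s) (hx : 0 < x) :
    Integrable (fun t => pk s t * (if x < |t| then 1 else 0)) ∧
    ∫ t, pk s t * (if x < |t| then 1 else 0) = x ^ (-(2 * s)) / s := by
  have e : ∀ t ∈ Ioi x, t ^ (-(1 + 2 * s)) = pk s t := fun t ht =>
    (pk_eq_rpow s (hx.trans ht)).symm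
  have h1 : IntegrableOn (fun t => pk s t) (Ioi x) :=
    (integrableOn_Ioi_rpow_of_lt (by linarith : -(1 + 2 * s) < -1) hx).congr_fun e
      measurableSet_Ioi
  have e2 : ∀ t ∈ Ioi (0:ℝ), (Ioi x).indicator (pk s) t = pk s t * (if x < |t| then 1 else 0) := by
    intro t ht
    rw [abs_of_pos ht]
    simp [indicator_apply]
  have hsub : Ioi (0:ℝ) ∩ Ioi x = Ioi x := inter_eq_right.2 fun t ht => hx.trans ht
  constructor
  · refine integrable_of_even (fun t => by simp [pk_neg]) ?_
    refine IntegrableOn.congr_fun ?_ e2 measurableSet_Ioi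
    exact ((integrable_indicator_iff measurableSet_Ioi).2 h1).integrableOn
  · have h2 : ∀ t, pk s t * (if x < |t| then 1 else 0)
        = (fun y => pk s y * (if x < |y| then (1:ℝ) else 0)) |t| := fun t => by
      simp [pk]
    rw [integral_congr_ae (Eventually.of_forall h2), integral_comp_abs (f := fun y => pk s y * (if x < |y| then (1:ℝ) else 0)),
      ← setIntegral_congr_fun measurableSet_Ioi e2, setIntegral_indicator measurableSet_Ioi, hsub,
      ← setIntegral_congr_fun measurableSet_Ioi e,
      integral_Ioi_rpow_of_lt (by linarith) hx]
    rw [show -(1 + 2 * s) + 1 = -(2 * s) by ring]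
    field_simp

namespace Bds
variable {s r R K : ℝ} {u v w : ℝ → ℝ}

lemma tails (h : Bds s r R K u v w) (hs : 0 < s) (hR : 1 ≤ R) (hK : 0 ≤ K) :
    ∃ C, 1 ≤ C ∧ (∀ y > 0, |u y - 1| ≤ C * |y| ^ (-(2 * s))) ∧
      ∀ y < 0, |u y| ≤ C * |y| ^ (-(2 * s)) := by
  have hRs : 1 ≤ R ^ (2 * s) := one_le_rpow hR (by linarith)
  have hsmall : ∀ y, 0 < |y| → |y| ≤ R → 1 ≤ (K + R ^ (2 * s)) * |y| ^ (-(2 * s)) := by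
    intro y hy hyR
    have h1 : 1 ≤ R ^ (2 * s) * |y| ^ (-(2 * s)) := by
      rw [rpow_neg hy.le, ← div_eq_mul_inv, one_le_div (by positivity)]
      exact rpow_le_rpow hy.le hyR (by linarith)
    have : 0 ≤ K * |y| ^ (-(2 * s)) := by positivity
    linarith
  have hbig : ∀ y, K * |y| ^ (-(2 * s)) ≤ (K + R ^ (2 * s)) * |y| ^ (-(2 * s)) := fun y =>
    mul_le_mul_of_nonneg_right (by linarith) (by positivity)
  refine ⟨K + R ^ (2 * s), by linarith, fun y hy => ?_, fun y hy => ?_⟩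
  · have hm := h.mem y
    rcases le_total |y| R with h1 | h1
    · refine le_trans ?_ (hsmall y (abs_pos.2 hy.ne') h1)
      exact abs_le.2 ⟨by linarith [hm.1], by linarith [hm.2]⟩
    · rw [abs_sub_comm, abs_of_nonneg (by linarith [hm.2])]
      exact (h.right y (by rwa [abs_of_pos hy] at h1)).trans (hbig y)
  · have hm := h.mem y
    rw [abs_of_nonneg hm.1]
    rcases le_total |y| R with h1 | h1
    · exact hm.2.trans (hsmall y (abs_pos.2 hy.ne) h1)
    · exact (h.left y (by rw [abs_of_neg hy] at h1; linarith)).trans (hbig y)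

lemma second_diff_near (h : Bds s r R K u v w) (hs : s ∈ Ioo (0:ℝ) 1) (hK : 0 ≤ K) {x t : ℝ}
    (hx : 0 < x) (ht : |t| ≤ x / 2) :
    |u (x + t) + u (x - t) - 2 * u x| ≤ 2 * (K * (x / 2) ^ (-(1 + 2 * s))) * |t| ^ (1 + s) := by
  set B := K * (x / 2) ^ (-(1 + 2 * s)) with hB
  have hB0 : 0 ≤ B := by positivity
  have hb : ∀ y, |y - x| ≤ |t| → K * bar s R y ≤ B := by
    intro y hy
    have hy2 : x / 2 ≤ |y| := by
      have := (abs_le.1 (hy.trans ht)).1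
      exact le_trans (by linarith) (le_abs_self y)
    exact mul_le_mul_of_nonneg_left ((bar_le hs.1 (by linarith)).trans
      (rpow_le_rpow_of_nonpos (by linarith) hy2 (by linarith [hs.1]))) hK
  have h2 : |u (x + t) + u (x - t) - 2 * u x| ≤ 2 * B * t ^ 2 :=
    second_diff_le (fun y _ => h.hu y) (fun y _ => h.hv y) fun y hy => (h.w_le y).trans (hb y hy)
  have hl : ∀ a, |a| ≤ |t| → |u (x + a) - u x| ≤ B * |a| := by
    intro a ha
    have := (convex_Icc (x - |t|) (x + |t|)).norm_image_sub_le_of_norm_hasDerivWithin_le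
      (f := u) (f' := v) (C := B) (x := x) (y := x + a)
      (fun y _ => (h.hu y).hasDerivWithinAt) (fun y hy => ?_)
      (by constructor <;> linarith [abs_nonneg t])
      (by constructor <;> linarith [(abs_le.1 ha).1, (abs_le.1 ha).2])
    · simpa using this
    · rw [Real.norm_eq_abs, abs_of_nonneg (h.nonneg y)]
      exact (h.hi y).trans (hb y (abs_le.2 ⟨by linarith [hy.1], by linarith [hy.2]⟩))
  have h1 : |u (x + t) + u (x - t) - 2 * u x| ≤ 2 * B * |t| := by
    have a1 := hl t le_rfl
    have a2 := hl (-t) (by rw [abs_neg])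
    rw [abs_neg, ← sub_eq_add_neg] at a2
    rw [show u (x + t) + u (x - t) - 2 * u x = (u (x + t) - u x) + (u (x - t) - u x) by ring]
    exact (abs_add_le _ _).trans (by linarith)
  rcases le_total |t| 1 with h3 | h3
  · refine h2.trans (mul_le_mul_of_nonneg_left ?_ (by positivity))
    rw [← sq_abs]
    rcases (abs_nonneg t).eq_or_lt with h0 | h0
    · rw [← h0, zero_rpow (by linarith [hs.1])]; norm_num
    · rw [← rpow_natCast]
      exact rpow_le_rpow_of_exponent_ge h0 h3 (by push_cast; linarith [hs.2])
  · refine h1.trans (mul_le_mul_of_nonneg_left ?_ (by positivity))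
    nth_rw 1 [← rpow_one |t|]
    exact rpow_le_rpow_of_exponent_le h3 (by linarith [hs.1])

lemma fracLap_asymp (h : Bds s r R K u v w) (hs : s ∈ Ioo (0:ℝ) 1) (hR : 1 ≤ R) (hK : 0 ≤ K) :
    ∃ C, 0 ≤ C ∧ ∀ x > 0, |fracLap s u x + x ^ (-(2 * s)) / (2 * s)| ≤ C * x ^ (-(3 * s)) := by
  have hs0 := hs.1
  obtain ⟨C, hC1, hpos, hneg⟩ := h.tails hs0 hR hK
  have hG := integrable_pk_errG hs
  have hC0 : 0 ≤ C := by linarith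
  have hlow : ∀ y e : ℝ, |e| ≤ 1 → 0 < |y| → |e| ≤ C * |y| ^ (-(2 * s)) → |e| ≤ C * |y| ^ (-s) := by
    intro y e he hy h1
    rcases le_total |y| 1 with h2 | h2
    · have : 1 ≤ |y| ^ (-s) := one_le_rpow_of_pos_of_le_one_of_nonpos hy h2 (by linarith)
      nlinarith
    · exact h1.trans (mul_le_mul_of_nonneg_left
        (rpow_le_rpow_of_exponent_le h2 (by linarith)) hC0)
  have hpos' : ∀ y > 0, |u y - 1| ≤ C * |y| ^ (-s) := fun y hy =>
    hlow y _ (abs_le.2 ⟨by linarith [(h.mem y).1], by linarith [(h.mem y).2]⟩)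
      (abs_pos.2 (ne_of_gt hy)) (hpos y hy)
  have hneg' : ∀ y < 0, |u y| ≤ C * |y| ^ (-s) := fun y hy =>
    hlow y _ (abs_le.2 ⟨by linarith [(h.mem y).1], by linarith [(h.mem y).2]⟩)
      (abs_pos.2 (ne_of_lt hy)) (hneg y hy)
  set M := 2 * (K * 2 ^ (1 + 2 * s)) + C with hM
  have hM0 : 0 ≤ M := by positivity
  refine ⟨M * (∫ t, pk s t * errG s t) / 2, div_nonneg (mul_nonneg hM0 (integral_nonneg fun t =>
    mul_nonneg (pk_nonneg s t) (errG_nonneg s t))) (by norm_num), fun x hx => ?_⟩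
  obtain ⟨hti, htv⟩ := integral_pk_tail hs0 hx
  have hSi : Integrable fun t => pk s t * (u (x + t) + u (x - t) - 2 * u x) := by
    have hcu := h.cu
    refine ((integrable_mk hs).const_mul (2 * K + 4)).mono'
      ((measurable_pk s).mul (by fun_prop)).aestronglyMeasurable (Eventually.of_forall fun t => ?_)
    rw [norm_mul, Real.norm_eq_abs, Real.norm_eq_abs, abs_of_nonneg (pk_nonneg s t)]
    refine (mul_le_mul_of_nonneg_left (h.second_diff hs0 hR hK x t) (pk_nonneg s t)).trans
      (le_of_eq ?_)
    unfold FracLayer.mk; ring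
  have hpt : ∀ᵐ t, ‖pk s t * (u (x + t) + u (x - t) - 2 * u x)
      + pk s t * (if x < |t| then 1 else 0)‖ ≤
      M * x ^ (-(1 + 3 * s)) * (pk s (t / x) * errG s (t / x)) := by
    filter_upwards [compl_mem_ae_iff.2 (measure_singleton x),
      compl_mem_ae_iff.2 (measure_singleton (-x))] with t ht1 ht2
    have hne : |t| ≠ x := fun e => by
      rcases eq_or_eq_neg_of_abs_eq e with e | e
      · exact ht1 e
      · exact ht2 e
    have hp := pk_nonneg s t
    have hxs : 0 < x ^ (-s) := by positivity
    have key : |u (x + t) + u (x - t) - 2 * u x + (if x < |t| then 1 else 0)|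
        ≤ M * x ^ (-s) * errG s (t / x) := by
      have habs : |t / x| = |t| / x := by rw [abs_div, abs_of_pos hx]
      unfold errG
      rw [habs]
      by_cases hc : |t| / x ≤ 1 / 2
      · rw [if_pos hc]
        rw [div_le_iff₀ hx] at hc
        rw [if_neg (by linarith), add_zero]
        refine (h.second_diff_near hs hK hx (by linarith)).trans ?_
        have e : (x / 2) ^ (-(1 + 2 * s)) * |t| ^ (1 + s)
            = 2 ^ (1 + 2 * s) * (x ^ (-s) * (|t| / x) ^ (1 + s)) := by
          rw [div_rpow hx.le (by norm_num), div_rpow (abs_nonneg t) hx.le,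
            rpow_neg (by norm_num : (0:ℝ) ≤ 2), show -(1 + 2 * s) = -s - (1 + s) by ring,
            rpow_sub hx]
          field_simp
        rw [mul_assoc, mul_assoc, e, hM]
        have : 0 ≤ x ^ (-s) * (|t| / x) ^ (1 + s) := by positivity
        nlinarith [mul_nonneg hC0 this]
      · rw [if_neg hc]
        rw [not_le, lt_div_iff₀ hx] at hc
        have e : x ^ (-s) * |1 - |t| / x| ^ (-s) = |(x - |t|)| ^ (-s) := by
          rw [← mul_rpow hx.le (abs_nonneg _)]
          congr 1
          nth_rw 1 [← abs_of_pos hx]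
          rw [← abs_mul]
          congr 1; field_simp
        have a1 : |u (x + |t|) - 1| ≤ C * x ^ (-s) := by
          refine (hpos' _ (by positivity)).trans (mul_le_mul_of_nonneg_left ?_ hC0)
          rw [abs_of_pos (by positivity)]
          exact rpow_le_rpow_of_nonpos hx (by linarith [abs_nonneg t]) (by linarith)
        have a2 : |u x - 1| ≤ C * x ^ (-s) := by
          have := hpos' x hx
          rwa [abs_of_pos hx] at this
        have a3 : |u (x - |t|) - 1 + (if x < |t| then 1 else 0)| ≤ C * |(x - |t|)| ^ (-s) := by
          rcases hne.lt_or_gt with h1 | h1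
          · rw [if_neg (by linarith), add_zero]; exact hpos' _ (by linarith)
          · rw [if_pos h1, sub_add_cancel]; exact hneg' _ (by linarith)
        have e2 : u (x + t) + u (x - t) = u (x + |t|) + u (x - |t|) := by
          rcases abs_cases t with ⟨e, _⟩ | ⟨e, _⟩ <;> rw [e]
          rw [sub_neg_eq_add, ← sub_eq_add_neg]; ring
        have hsum : |u (x + t) + u (x - t) - 2 * u x + (if x < |t| then 1 else 0)| ≤
            C * x ^ (-s) + C * |(x - |t|)| ^ (-s) + 2 * (C * x ^ (-s)) := by
          rw [e2]
          rw [abs_le] at a1 a2 a3 ⊢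
          constructor
          · linarith [a1.1, a2.2, a3.1]
          · linarith [a1.2, a2.1, a3.2]
        refine hsum.trans ?_
        rw [mul_assoc, mul_add, e]
        have n1 : 0 ≤ |(x - |t|)| ^ (-s) := by positivity
        have n2 : 0 ≤ K * 2 ^ (1 + 2 * s) := by positivity
        rw [hM]
        nlinarith [mul_nonneg n2 n1, mul_nonneg n2 hxs.le]
    rw [← mul_add, norm_mul, Real.norm_eq_abs, Real.norm_eq_abs, abs_of_nonneg hp]
    refine (mul_le_mul_of_nonneg_left key hp).trans (le_of_eq ?_)
    rw [pk_scale hx t, show -(1 + 3 * s) = -(1 + 2 * s) + -s by ring, rpow_add hx]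
    ring
  have hGi : Integrable fun t => M * x ^ (-(1 + 3 * s)) * (pk s (t / x) * errG s (t / x)) :=
    (hG.comp_div hx.ne').const_mul _
  have hfin := norm_integral_le_of_norm_le hGi hpt
  rw [integral_add hSi hti, htv, integral_const_mul,
    Measure.integral_comp_div (fun t => pk s t * errG s t) x, abs_of_pos hx, smul_eq_mul,
    Real.norm_eq_abs] at hfin
  have e1 : fracLap s u x = 1 / 2 * ∫ t, pk s t * (u (x + t) + u (x - t) - 2 * u x) := by
    unfold fracLap pk
    congr 2; ext t; ring
  have e2 : fracLap s u x + x ^ (-(2 * s)) / (2 * s)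
      = 1 / 2 * ((∫ t, pk s t * (u (x + t) + u (x - t) - 2 * u x)) + x ^ (-(2 * s)) / s) := by
    rw [e1]; field_simp
  have e3 : x ^ (-(1 + 3 * s)) * x = x ^ (-(3 * s)) := by
    nth_rw 2 [← rpow_one x]
    rw [← rpow_add hx]; ring_nf
  rw [e2, abs_mul, abs_of_pos (by norm_num : (0:ℝ) < 1 / 2)]
  calc 1 / 2 * _ ≤ 1 / 2 * _ := mul_le_mul_of_nonneg_left hfin (by norm_num)
    _ = M * (∫ t, pk s t * errG s t) / 2 * (x ^ (-(1 + 3 * s)) * x) := by ring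
    _ = _ := by rw [e3]

end Bds

lemma fracLap_reflect (s : ℝ) (u : ℝ → ℝ) (x : ℝ) :
    fracLap s (fun y => 1 - u (-y)) x = -fracLap s u (-x) := by
  unfold fracLap
  rw [← mul_neg, ← integral_neg]
  congr 2; ext y
  dsimp only
  rw [show -(x + y) = -x - y by ring, show -(x - y) = -x + y by ring]
  ring

namespace Bds
variable {s r R K : ℝ} {u v w : ℝ → ℝ}

lemma reflect (h : Bds s r R K u v w) :
    Bds s r R K (fun y => 1 - u (-y)) (fun y => v (-y)) (fun y => -w (-y)) where
  hu y := (((h.hu (-y)).scomp y (hasDerivAt_neg y)).const_sub 1).congr_deriv (by simp)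
  hv y := ((h.hv (-y)).scomp y (hasDerivAt_neg y)).congr_deriv (by simp)
  half := by rw [neg_zero, h.half]; norm_num
  mem x := ⟨by linarith [(h.mem (-x)).2], by linarith [(h.mem (-x)).1]⟩
  nonneg x := h.nonneg _
  hi x := by rw [← bar_neg]; exact h.hi (-x)
  w_le x := by rw [abs_neg, ← bar_neg]; exact h.w_le (-x)
  hol x a := by
    have := h.hol (-x) (-a)
    rw [abs_neg] at this
    rwa [neg_add, ← neg_sub', abs_neg]
  left x hx := by
    have := h.right (-x) (by linarith)
    rwa [abs_neg] at this
  right x hx := by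
    have := h.left (-x) (by linarith)
    rw [abs_neg] at this
    linarith

variable {W W1 W2 W3 : ℝ → ℝ} {Λ D : ℝ}

lemma asymp_right (h : Bds s r R K u v w) (hW : Pot W W1 W2 W3 Λ r D) (hs : s ∈ Ioo (0:ℝ) 1)
    (hR : 1 ≤ R) (hK : 0 ≤ K) (heq : ∀ x, fracLap s u x = W1 (u x)) :
    ∃ C, 0 ≤ C ∧ ∀ x, 1 ≤ x →
      |u x - 1 + x ^ (-(2 * s)) / (2 * s * W2 0)| ≤ C * x ^ (-(3 * s)) := by
  have hs0 := hs.1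
  have hc := hW.conv
  have hΛ := hW.Λ_pos
  obtain ⟨C1, hC1, h1⟩ := h.fracLap_asymp hs hR hK
  obtain ⟨C2, hC2, h2, -⟩ := h.tails hs0 hR hK
  refine ⟨(C1 + Λ * C2 ^ 2) / W2 0, by positivity, fun x hx => ?_⟩
  have hx0 : 0 < x := by linarith
  have a1 := h1 x hx0
  have a2 := h2 x hx0
  rw [abs_of_pos hx0] at a2
  have a3 := hW.taylor_W1 1 (u x)
  rw [hW.crit_one, hW.conv_eq, sub_zero] at a3
  rw [heq] at a1
  have a4 : (u x - 1) ^ 2 ≤ C2 ^ 2 * x ^ (-(3 * s)) := by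
    rw [← sq_abs]
    refine (pow_le_pow_left₀ (abs_nonneg _) a2 2).trans ?_
    rw [mul_pow, ← rpow_natCast (x ^ _), ← rpow_mul hx0.le]
    exact mul_le_mul_of_nonneg_left
      (rpow_le_rpow_of_exponent_le hx (by push_cast; linarith)) (sq_nonneg _)
  have e : u x - 1 + x ^ (-(2 * s)) / (2 * s * W2 0)
      = ((W1 (u x) + x ^ (-(2 * s)) / (2 * s)) - (W1 (u x) - W2 0 * (u x - 1))) / W2 0 := by
    field_simp; ring
  rw [e, abs_div, abs_of_pos hc, div_le_iff₀ hc]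
  refine (abs_sub _ _).trans ?_
  have : (C1 + Λ * C2 ^ 2) / W2 0 * x ^ (-(3 * s)) * W2 0
      = C1 * x ^ (-(3 * s)) + Λ * (C2 ^ 2 * x ^ (-(3 * s))) := by field_simp
  rw [this]
  exact add_le_add a1 (a3.trans (mul_le_mul_of_nonneg_left a4 hΛ.le))

lemma asymp (h : Bds s r R K u v w) (hW : Pot W W1 W2 W3 Λ r D) (hs : s ∈ Ioo (0:ℝ) 1)
    (hR : 1 ≤ R) (hK : 0 ≤ K) (heq : ∀ x, fracLap s u x = W1 (u x)) :
    ∃ C, 0 ≤ C ∧ ∀ x, 1 ≤ |x| →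
      |u x - heaviside x + x / (2 * s * W2 0 * |x| ^ (2 * s + 1))| ≤ C / |x| ^ (3 * s) := by
  obtain ⟨C1, hC1, h1⟩ := h.asymp_right hW hs hR hK heq
  obtain ⟨C2, hC2, h2⟩ := h.reflect.asymp_right hW.reflect hs hR hK fun x => by
    rw [fracLap_reflect, heq, sub_sub_cancel]
  rw [sub_zero, hW.conv_eq] at h2
  have e : ∀ y : ℝ, 0 < y → y / (2 * s * W2 0 * y ^ (2 * s + 1)) = y ^ (-(2 * s)) / (2 * s * W2 0) := by
    intro y hy
    rw [rpow_add hy, rpow_one, rpow_neg hy.le]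
    field_simp
  refine ⟨C1 + C2, by positivity, fun x hx => ?_⟩
  have hx0 : 0 < |x| := by linarith
  rw [div_eq_mul_inv (C1 + C2), ← rpow_neg hx0.le, add_mul]
  have n1 : 0 ≤ C1 * |x| ^ (-(3 * s)) := by positivity
  have n2 : 0 ≤ C2 * |x| ^ (-(3 * s)) := by positivity
  rcases le_abs'.1 hx with hc | hc
  · have := h2 (-x) (by linarith)
    rw [abs_of_neg (by linarith : x < 0)] at n1 n2 ⊢
    rw [neg_neg] at this
    have hh : heaviside x = 0 := by simp [heaviside]; linarith
    have e2 : x / (2 * s * W2 0 * (-x) ^ (2 * s + 1))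
        = -((-x) ^ (-(2 * s)) / (2 * s * W2 0)) := by
      rw [← e (-x) (by linarith), neg_div, neg_neg]
    rw [hh, e2, ← abs_neg]
    refine le_trans (le_of_eq ?_) (this.trans (by linarith))
    congr 1; ring
  · have := h1 x hc
    rw [abs_of_pos (by linarith : 0 < x)] at n1 n2 ⊢
    have hh : heaviside x = 1 := by simp [heaviside]; linarith
    rw [hh, e x (by linarith)]
    linarith

end Bds

lemma deriv_lower {s A L : ℝ} {v : ℝ → ℝ} (hs : 0 < s) (hA : 0 ≤ A) (hL : 0 ≤ L)
    (hv : ∀ x, pk s (|x| + 1 + A) / 2 ≤ L * v x) :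
    (∀ x, 0 < v x) ∧ ∃ c, 0 < c ∧ ∀ x, 1 ≤ |x| → c / |x| ^ (1 + 2 * s) ≤ v x := by
  have hpos : ∀ x, 0 < v x := fun x => by
    have : 0 < L * v x := (half_pos (pk_pos s (by positivity))).trans_le (hv x)
    exact pos_of_mul_pos_right this hL
  refine ⟨hpos, 1 / (2 * (L + 1) * (2 + A) ^ (1 + 2 * s)), by positivity, fun x hx => ?_⟩
  have hx0 : 0 < |x| := by linarith
  have h1 : 1 / ((2 + A) * |x|) ^ (1 + 2 * s) ≤ pk s (|x| + 1 + A) := by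
    unfold pk
    rw [abs_of_pos (by positivity : 0 < |x| + 1 + A)]
    refine one_div_le_one_div_of_le (by positivity) (rpow_le_rpow (by positivity) ?_ (by linarith))
    nlinarith
  rw [mul_rpow (by positivity) hx0.le] at h1
  have h2 : L * v x ≤ (L + 1) * v x := by nlinarith [hpos x]
  have h3 := hv x
  calc 1 / (2 * (L + 1) * (2 + A) ^ (1 + 2 * s)) / |x| ^ (1 + 2 * s)
      = 1 / ((2 + A) ^ (1 + 2 * s) * |x| ^ (1 + 2 * s)) / 2 / (L + 1) := by field_simp
    _ ≤ v x := by
      rw [div_le_iff₀ (by positivity)]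
      linarith

/-- Layer solutions, in the form used for the uniqueness argument. -/
structure Lay (s : ℝ) (W1 f : ℝ → ℝ) : Prop where
  smooth : ContDiff ℝ 2 f
  mono : StrictMono f
  bot : Tendsto f atBot (𝓝 0)
  top : Tendsto f atTop (𝓝 1)
  eqn : ∀ x, fracLap s f x = W1 (f x)
  half : f 0 = 1 / 2

lemma fracLap_eq_pk (s : ℝ) (f : ℝ → ℝ) (x : ℝ) :
    fracLap s f x = 1 / 2 * ∫ t, pk s t * (f (x + t) + f (x - t) - 2 * f x) := by
  unfold fracLap pk
  congr 2; ext t; ring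

namespace Lay
variable {s : ℝ} {W1 f g : ℝ → ℝ}

lemma cont (h : Lay s W1 f) : Continuous f := h.smooth.continuous

lemma pos (h : Lay s W1 f) (x : ℝ) : 0 < f x :=
  (h.mono.monotone.le_of_tendsto h.bot (x - 1)).trans_lt (h.mono (by linarith))

lemma lt_one (h : Lay s W1 f) (x : ℝ) : f x < 1 :=
  (h.mono (by linarith : x < x + 1)).trans_le (h.mono.monotone.ge_of_tendsto h.top (x + 1))

lemma integrable (h : Lay s W1 f) (hs : s ∈ Ioo (0:ℝ) 1) (x : ℝ) :
    Integrable fun t => pk s t * (f (x + t) + f (x - t) - 2 * f x) := by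
  have hc := h.cont
  have h1 : ContDiff ℝ 1 (deriv f) := (contDiff_succ_iff_deriv (n := 1) (f := f)).1 h.smooth |>.2.2
  have h2 : Continuous (deriv (deriv f)) := h1.continuous_deriv le_rfl
  obtain ⟨K, hK⟩ := (isCompact_Icc (a := x - 1) (b := x + 1)).exists_bound_of_continuousOn
    h2.continuousOn
  have hK0 : 0 ≤ K := (norm_nonneg _).trans (hK x ⟨by linarith, by linarith⟩)
  refine ((integrable_mk hs).const_mul (2 * K + 4)).mono'
    ((measurable_pk s).mul (by fun_prop)).aestronglyMeasurable (Eventually.of_forall fun t => ?_)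
  have key : |f (x + t) + f (x - t) - 2 * f x| ≤ (2 * K + 4) * min (t ^ 2) 1 := by
    rcases le_total |t| 1 with h3 | h3
    · have ht2 : t ^ 2 ≤ 1 := by rw [← sq_abs]; exact pow_le_one₀ (abs_nonneg t) h3
      have := second_diff_le (f := f) (x := x) (t := t) (K := K)
        (fun y _ => (h.smooth.differentiable (by norm_num) y).hasDerivAt)
        (fun y _ => (h1.differentiable (by norm_num) y).hasDerivAt) fun y hy => by
          have := abs_le.1 (hy.trans h3)
          exact hK y ⟨by linarith [this.1], by linarith [this.2]⟩
      rw [min_eq_left ht2]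
      nlinarith [sq_nonneg t]
    · have ht2 : 1 ≤ t ^ 2 := by rw [← sq_abs]; exact one_le_pow₀ h3
      rw [min_eq_right ht2, abs_le]
      have a1 := h.pos (x + t); have a2 := h.pos (x - t); have a3 := h.pos x
      have b1 := h.lt_one (x + t); have b2 := h.lt_one (x - t); have b3 := h.lt_one x
      constructor <;> linarith
  rw [norm_mul, Real.norm_eq_abs, Real.norm_eq_abs, abs_of_nonneg (pk_nonneg s t)]
  refine (mul_le_mul_of_nonneg_left key (pk_nonneg s t)).trans (le_of_eq ?_)
  unfold FracLayer.mk; ring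

lemma diff_eqn (hf : Lay s W1 f) (hg : Lay s W1 g) (hs : s ∈ Ioo (0:ℝ) 1) {d : ℝ → ℝ} {T : ℝ}
    (hd : ∀ x, d x = f (x + T) - g x) (x : ℝ) :
    Integrable (fun t => pk s t * (d (x + t) + d (x - t) - 2 * d x)) ∧
    W1 (f (x + T)) - W1 (g x) = 1 / 2 * ∫ t, pk s t * (d (x + t) + d (x - t) - 2 * d x) := by
  have i1 := hf.integrable hs (x + T)
  have i2 := hg.integrable hs x
  have e : ∀ t, pk s t * (d (x + t) + d (x - t) - 2 * d x)
      = pk s t * (f (x + T + t) + f (x + T - t) - 2 * f (x + T))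
        - pk s t * (g (x + t) + g (x - t) - 2 * g x) := by
    intro t
    rw [hd, hd, hd, show x + t + T = x + T + t by ring, show x - t + T = x + T - t by ring]; ring
  simp only [e]
  refine ⟨integrable_fun_sub i1 i2, ?_⟩
  rw [integral_sub i1 i2, mul_sub, ← fracLap_eq_pk, ← fracLap_eq_pk, hf.eqn, hg.eqn]

variable {W W2 W3 : ℝ → ℝ} {Λ r D : ℝ}

lemma strictMonoOn_wells (hW : Pot W W1 W2 W3 Λ r D) :
    ∃ δ, 0 < δ ∧ StrictMonoOn W1 (Icc 0 δ) ∧ StrictMonoOn W1 (Icc (1 - δ) 1) := by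
  obtain ⟨δ, hδ, -, h0, h1⟩ := hW.exists_well
  have hc := hW.conv
  refine ⟨δ, hδ, ?_, ?_⟩ <;> refine strictMonoOn_of_deriv_pos (convex_Icc _ _)
    hW.cont1.continuousOn fun v hv => ?_ <;> rw [interior_Icc] at hv <;> rw [(hW.hd2 v).deriv]
  · have := h0 v (abs_le.2 ⟨by linarith [hv.1], hv.2.le⟩)
    linarith
  · have := h1 v (abs_le.2 ⟨by linarith [hv.1], by linarith [hv.2]⟩)
    linarith

lemma le_of_le_on (hf : Lay s W1 f) (hg : Lay s W1 g) (hs : s ∈ Ioo (0:ℝ) 1) {δ M T : ℝ}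
    (h0 : StrictMonoOn W1 (Icc 0 δ)) (h1 : StrictMonoOn W1 (Icc (1 - δ) 1))
    (hgM : ∀ x ≤ -M, g x ≤ δ) (hfM : ∀ x, M ≤ x → 1 - δ ≤ f x) (hT : 0 ≤ T)
    (hle : ∀ x ∈ Icc (-M) M, g x ≤ f (x + T)) (x : ℝ) : g x ≤ f (x + T) := by
  by_contra! hlt
  set d : ℝ → ℝ := fun x => f (x + T) - g x with hd
  have hcf := hf.cont
  have hcg := hg.cont
  have hdc : Continuous d := by fun_prop
  have hev : ∀ᶠ y in cocompact ℝ, d x ≤ d y := by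
    have hx0 : d x < 0 := by simp only [hd]; linarith
    rw [cocompact_eq_atBot_atTop, eventually_sup]
    constructor
    · have : Tendsto d atBot (𝓝 0) := by
        simpa using (hf.bot.comp (tendsto_atBot_add_const_right _ T tendsto_id)).sub hg.bot
      exact (this.eventually (lt_mem_nhds hx0)).mono fun y hy => le_of_lt hy
    · have : Tendsto d atTop (𝓝 0) := by
        simpa using (hf.top.comp (tendsto_atTop_add_const_right _ T tendsto_id)).sub hg.top
      exact (this.eventually (lt_mem_nhds hx0)).mono fun y hy => le_of_lt hy
  obtain ⟨y, hy⟩ := hdc.exists_forall_le' x hev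
  have hyx := hy x
  have hy0 : f (y + T) < g y := by simp only [hd] at hyx; linarith
  obtain ⟨-, he⟩ := hf.diff_eqn hg hs (d := d) (T := T) (fun _ => rfl) y
  have hnn : 0 ≤ ∫ t, pk s t * (d (y + t) + d (y - t) - 2 * d y) :=
    integral_nonneg fun t => mul_nonneg (pk_nonneg s t) (by linarith [hy (y + t), hy (y - t)])
  have hge : W1 (g y) ≤ W1 (f (y + T)) := by linarith
  refine absurd hge (not_le.2 ?_)
  rcases lt_or_ge y (-M) with h | h
  · have := hgM y h.le
    exact h0 ⟨(hf.pos _).le, by linarith⟩ ⟨(hg.pos _).le, this⟩ hy0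
  · rcases le_or_gt y M with h' | h'
    · exact absurd (hle y ⟨h, h'⟩) (not_le.2 hy0)
    · have := hfM (y + T) (by linarith)
      exact h1 ⟨this, (hf.lt_one _).le⟩ ⟨by linarith, (hg.lt_one _).le⟩ hy0

lemma le (hf : Lay s W1 f) (hg : Lay s W1 g) (hW : Pot W W1 W2 W3 Λ r D)
    (hs : s ∈ Ioo (0:ℝ) 1) (x : ℝ) : g x ≤ f x := by
  obtain ⟨δ, hδ, h0, h1⟩ := strictMonoOn_wells hW
  have hcf := hf.cont
  have hcg := hg.cont
  obtain ⟨a, ha⟩ := eventually_atBot.1 (hg.bot.eventually (gt_mem_nhds hδ))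
  obtain ⟨b, hb⟩ := eventually_atTop.1
    (hf.top.eventually (lt_mem_nhds (by linarith : 1 - δ < 1)))
  set M := max (-a) b with hM
  have hgM : ∀ x ≤ -M, g x ≤ δ := fun x hx =>
    (ha x (by linarith [le_max_left (-a) b])).le
  have hfM : ∀ x, M ≤ x → 1 - δ ≤ f x := fun x hx => (hb x (by linarith [le_max_right (-a) b])).le
  have cmp : ∀ T, 0 ≤ T → (∀ x ∈ Icc (-M) M, g x ≤ f (x + T)) → ∀ x, g x ≤ f (x + T) :=
    fun T hT hle => hf.le_of_le_on hg hs h0 h1 hgM hfM hT hle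
  set S : Set ℝ := {T | 0 ≤ T ∧ ∀ x, g x ≤ f (x + T)} with hS
  have hSne : S.Nonempty := by
    obtain ⟨T, hT, hT0⟩ := ((hf.top.comp (tendsto_atTop_add_const_left _ (-M) tendsto_id)).eventually
      (lt_mem_nhds (hg.lt_one M)) |>.and (eventually_ge_atTop 0)).exists
    refine ⟨T, hT0, cmp T hT0 fun x hx => ?_⟩
    exact (hg.mono.monotone hx.2).trans (hT.le.trans (hf.mono.monotone (by simp; linarith [hx.1])))
  have hSb : BddBelow S := ⟨0, fun T hT => hT.1⟩
  have hScl : IsClosed S := by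
    have : S = Ici 0 ∩ ⋂ x, {T | g x ≤ f (x + T)} := by ext T; simp [hS]
    rw [this]
    exact isClosed_Ici.inter (isClosed_iInter fun x => isClosed_le (by fun_prop) (by fun_prop))
  obtain ⟨hT0, hTle⟩ := hScl.csInf_mem hSne hSb
  set T := sInf S with hTdef
  rcases hT0.eq_or_lt with hT | hT
  · have := hTle x
    rwa [← hT, add_zero] at this
  exfalso
  by_cases hpos : ∀ x ∈ Icc (-M) M, g x < f (x + T)
  · have hev : ∀ᶠ T' in 𝓝 T, ∀ x ∈ Icc (-M) M, g x < f (x + T') := by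
      refine isCompact_Icc.eventually_forall_of_forall_eventually fun x hx => ?_
      have : IsOpen {z : ℝ × ℝ | g z.2 < f (z.2 + z.1)} := isOpen_lt (by fun_prop) (by fun_prop)
      exact this.mem_nhds (hpos x hx)
    obtain ⟨T', hT'1, hT'2, hT'3⟩ := ((hev.filter_mono nhdsWithin_le_nhds).and
      (Ioo_mem_nhdsLT hT)).exists (f := 𝓝[<] T)
    exact absurd (csInf_le hSb (show T' ∈ S from
      ⟨hT'2.le, cmp T' hT'2.le fun x hx => (hT'1 x hx).le⟩)) (not_le.2 hT'3)
  · push Not at hpos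
    obtain ⟨y, -, hy⟩ := hpos
    have hyeq : f (y + T) = g y := le_antisymm hy (hTle y)
    set d : ℝ → ℝ := fun x => f (x + T) - g x with hd
    have hd0 : ∀ x, 0 ≤ d x := fun x => by simp only [hd]; linarith [hTle x]
    have hdy : d y = 0 := by simp only [hd]; linarith
    have hdc : Continuous d := by fun_prop
    obtain ⟨hi, he⟩ := hf.diff_eqn hg hs (d := d) (T := T) (fun _ => rfl) y
    rw [hyeq, sub_self, hdy] at he
    rw [hdy] at hi
    have hz : ∫ t, pk s t * (d (y + t) + d (y - t) - 2 * 0) = 0 :=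
      (mul_eq_zero.1 he.symm).resolve_left (by norm_num)
    rw [integral_eq_zero_iff_of_nonneg (fun t => mul_nonneg (pk_nonneg s t)
      (by linarith [hd0 (y + t), hd0 (y - t)])) hi] at hz
    have hz2 : (fun t => d (y + t) + d (y - t)) =ᵐ[volume] fun _ => 0 := by
      filter_upwards [hz, compl_mem_ae_iff.2 (measure_singleton (0:ℝ))] with t ht ht0
      have hp := pk_pos s (t := t) ht0
      have : d (y + t) + d (y - t) - 2 * 0 = 0 := (mul_eq_zero.1 ht).resolve_left hp.ne'
      linarith
    have hz3 := congrFun (Continuous.ae_eq_iff_eq volume (by fun_prop) (by fun_prop) |>.1 hz2) (-y)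
    simp only [add_neg_cancel] at hz3
    have hdz : d 0 = 0 := by linarith [hd0 0, hd0 (y - -y)]
    simp only [hd, zero_add] at hdz
    have := hf.mono hT
    rw [hf.half] at this
    rw [hg.half] at hdz
    linarith

end Lay

lemma deriv_eq_and_iteratedDeriv_two_eq {f f' f'' : ℝ → ℝ} (h : ∀ x, HasDerivAt f (f' x) x)
    (h' : ∀ x, HasDerivAt f' (f'' x) x) : deriv f = f' ∧ iteratedDeriv 2 f = f'' := by
  have e : deriv f = f' := funext fun x => (h x).deriv
  refine ⟨e, ?_⟩
  rw [iteratedDeriv_succ, iteratedDeriv_one, e]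
  exact funext fun x => (h' x).deriv

lemma holderWith_of_abs_le {f : ℝ → ℝ} {K r : NNReal}
    (h : ∀ x a, |f (x + a) - f x| ≤ K * |a| ^ (r : ℝ)) : HolderWith K r f := by
  intro x y
  have h1 := h y (x - y)
  rw [add_sub_cancel] at h1
  rw [edist_dist, edist_dist, Real.dist_eq, Real.dist_eq,
    ENNReal.ofReal_rpow_of_nonneg (abs_nonneg _) (NNReal.coe_nonneg r), ← ENNReal.ofReal_coe_nnreal,
    ← ENNReal.ofReal_mul (NNReal.coe_nonneg K)]
  exact ENNReal.ofReal_le_ofReal h1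

namespace Bds
variable {s r R K : ℝ} {u v w : ℝ → ℝ}

lemma c2Holder (h : Bds s r R K u v w) (hr0 : 0 < r) (hr1 : r < 1) (hK : 0 ≤ K) :
    C2Holder u := by
  have hc := contDiff_two_of_hasDerivAt h.hu h.hv (h.cw hr0 hK)
  lift K to NNReal using hK
  lift r to NNReal using hr0.le
  refine ⟨hc, K, r, hr0, hr1, ?_⟩
  rw [(deriv_eq_and_iteratedDeriv_two_eq h.hu h.hv).2]
  exact holderWith_of_abs_le h.hol

lemma tendsto_atBot (h : Bds s r R K u v w) (hs : 0 < s) : Tendsto u atBot (𝓝 0) := by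
  have h1 : Tendsto (fun x : ℝ => K * |x| ^ (-(2 * s))) atBot (𝓝 0) := by
    have := ((tendsto_rpow_neg_atTop (by linarith : 0 < 2 * s)).comp
      tendsto_abs_atBot_atTop).const_mul K
    rwa [mul_zero] at this
  exact tendsto_of_tendsto_of_tendsto_of_le_of_le' tendsto_const_nhds h1
    (Eventually.of_forall fun x => (h.mem x).1)
    ((eventually_le_atBot (-R)).mono fun x hx => h.left x hx)

lemma tendsto_atTop (h : Bds s r R K u v w) (hs : 0 < s) : Tendsto u atTop (𝓝 1) := by
  have h1 : Tendsto (fun x : ℝ => 1 - K * |x| ^ (-(2 * s))) atTop (𝓝 1) := by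
    have := (((tendsto_rpow_neg_atTop (by linarith : 0 < 2 * s)).comp
      tendsto_abs_atTop_atTop).const_mul K).const_sub 1
    rwa [mul_zero, sub_zero] at this
  exact tendsto_of_tendsto_of_tendsto_of_le_of_le' h1 tendsto_const_nhds
    ((eventually_ge_atTop R).mono fun x hx => by linarith [h.right x hx])
    (Eventually.of_forall fun x => (h.mem x).2)

end Bds

lemma Lay.of_layerEqn {s : ℝ} {W u : ℝ → ℝ} (h : LayerEqn s W u) (hu : C2Holder u) :
    Lay s (deriv W) u :=
  ⟨hu.1, strictMono_of_deriv_pos h.2.1, h.2.2.1, h.2.2.2.1, h.1, h.2.2.2.2⟩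

end FracLayer

end

theorem statement_5
    (s : ℝ) (hs : s ∈ Ioo (0:ℝ) 1)
    (W : ℝ → ℝ) (hW : IsPotential W) :
    ∃ u : ℝ → ℝ,
      (LayerEqn s W u ∧ C2Holder u) ∧
      (∀ w : ℝ → ℝ, LayerEqn s W w ∧ C2Holder w → w = u) ∧
      ∃ C c κ : ℝ, 0 < C ∧ 0 < c ∧ 2*s < κ ∧
        (∀ x : ℝ, 1 ≤ |x| →
          |u x - heaviside x + x / (2*s*deriv (deriv W) 0 * |x| ^ (2*s+1))| ≤ C / |x| ^ κ) ∧
        (∀ x : ℝ, 1 ≤ |x| →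
          c / |x| ^ (1+2*s) ≤ deriv u x ∧ deriv u x ≤ C / |x| ^ (1+2*s)) := by
  obtain ⟨Λ, r, D, hP⟩ := FracLayer.exists_pot hW
  obtain ⟨R, K, A, L, hR, hK, hA, hL, u, v, w, h, heq, hlow⟩ := FracLayer.exists_layer hP hs
  obtain ⟨hv, c, hc, hcv⟩ := FracLayer.deriv_lower hs.1 hA hL hlow
  obtain ⟨C, hC, hasymp⟩ := h.asymp hP hs hR hK heq
  have hd := (FracLayer.deriv_eq_and_iteratedDeriv_two_eq h.hu h.hv).1
  have hu : LayerEqn s W u :=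
    ⟨heq, fun x => hd ▸ hv x, h.tendsto_atBot hs.1, h.tendsto_atTop hs.1, h.half⟩
  have hu2 := h.c2Holder hP.r_pos hP.r_lt hK
  refine ⟨u, ⟨hu, hu2⟩, fun w' hw => ?_, C + K + 1, c, 3 * s, by positivity, hc,
    by linarith [hs.1], fun x hx => ?_, fun x hx => ⟨hd ▸ hcv x hx, ?_⟩⟩
  · have l1 := FracLayer.Lay.of_layerEqn hw.1 hw.2
    have l2 := FracLayer.Lay.of_layerEqn hu hu2
    exact funext fun x => le_antisymm (l2.le l1 hP hs x) (l1.le l2 hP hs x)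
  · refine (hasymp x hx).trans ?_
    gcongr
    linarith
  · have hx0 : 0 < |x| := by linarith
    have h1 : deriv u x ≤ K / |x| ^ (1 + 2 * s) := by
      rw [hd, div_eq_mul_inv, ← rpow_neg hx0.le]
      exact (h.hi x).trans (mul_le_mul_of_nonneg_left (FracLayer.bar_le hs.1 hx0) hK)
    refine h1.trans ?_
    gcongr
    linarith
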